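/- arXiv:2511.04863 — 3 statements merged into one kernel-verified Lean document; each statement's English description precedes it below -/
import Mathlib

section
/- Let G be a finite simple graph with maximum degree Δ, and let 𝒱 = {V_1, …, V_n} be a partition of V(G) with |V_i| ≥ 2Δ for all i. If for every nonempty subset I ⊆ {1,…,n} the induced subgraph G[V_I] is not isomorphic to the disjoint union of |I| pairwise disjoint copies of the complete bipartite graph K_{Δ,Δ}, then the reconfiguration graph RG(G, 𝒱) is connected. -/
/-- `S` is an independent set of the graph `G`. -/
def IndepSet {V : Type*} (G : SimpleGraph V) (S : Finset V) : Prop :=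
  ∀ u ∈ S, ∀ v ∈ S, ¬ G.Adj u v

/-- `S` is an independent transversal of `G` with respect to the vertex partition
`P : Fin n → Finset V`: an independent set meeting each class in exactly one vertex. -/
def IsIndepTransversal {V : Type*} [DecidableEq V] (G : SimpleGraph V) {n : ℕ}
    (P : Fin n → Finset V) (S : Finset V) : Prop :=
  IndepSet G S ∧ ∀ i, (S ∩ P i).card = 1

/-- Adjacency in the reconfiguration graph `RG(G, 𝒱)`: two independent transversals
are adjacent if their union is an independent set of cardinality `n + 1`. -/
def ITAdj {V : Type*} [DecidableEq V] (G : SimpleGraph V) {n : ℕ}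
    (P : Fin n → Finset V) (S T : Finset V) : Prop :=
  IsIndepTransversal G P S ∧ IsIndepTransversal G P T ∧
    IndepSet G (S ∪ T) ∧ (S ∪ T).card = n + 1

/-- The subgraph of `G` induced on `W` is the disjoint union of `m` pairwise disjoint
copies of the complete bipartite graph `K_{Δ,Δ}`. -/
def IsDisjointUnionOfKDD {V : Type*} [DecidableEq V] (G : SimpleGraph V) (Δ : ℕ)
    (W : Finset V) (m : ℕ) : Prop :=
  ∃ A B : Fin m → Finset V,
    (∀ j, (A j).card = Δ ∧ (B j).card = Δ) ∧
    (∀ j, Disjoint (A j) (B j)) ∧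
    (∀ j k, j ≠ k → Disjoint (A j ∪ B j) (A k ∪ B k)) ∧
    (Finset.univ.biUnion (fun j => A j ∪ B j) = W) ∧
    (∀ u ∈ W, ∀ v ∈ W,
      (G.Adj u v ↔ ∃ j, (u ∈ A j ∧ v ∈ B j) ∨ (u ∈ B j ∧ v ∈ A j)))

section helpers

variable {V : Type*} [DecidableEq V]

/-- Chains over `ZMod 2` on finite sets. -/
abbrev FChain (V : Type*) := Finset V → ZMod 2

/-- Boundary operator. -/
def fbd [Fintype V] : FChain V →+ FChain V where
  toFun c := fun t => ∑ v, if v ∈ t then 0 else c (insert v t)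
  map_zero' := by ext t; simp
  map_add' c d := by
    ext t
    simp only [Pi.add_apply]
    rw [← Finset.sum_add_distrib]
    refine Finset.sum_congr rfl fun v _ => ?_
    split_ifs <;> simp

theorem fbd_apply [Fintype V] (c : FChain V) (t : Finset V) :
    fbd c t = ∑ v, if v ∈ t then 0 else c (insert v t) := rfl

theorem zmod2_add_self (a : ZMod 2) : a + a = 0 := CharTwo.add_self_eq_zero a

/-- The chain `c` is supported on independent `k`-subsets of `W`. -/
def FSupp (G : SimpleGraph V) (W : Finset V) (k : ℕ) (c : FChain V) : Prop :=
  ∀ s, c s ≠ 0 → s ⊆ W ∧ s.card = k ∧ IndepSet G s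

/-- Acyclicity in one degree. -/
def FAc [Fintype V] (G : SimpleGraph V) (W : Finset V) (k : ℕ) : Prop :=
  ∀ z : FChain V, FSupp G W k z → fbd z = 0 → ∃ w, FSupp G W (k + 1) w ∧ fbd w = z

theorem fbd_fbd [Fintype V] (c : FChain V) : fbd (fbd c) = 0 := by
  ext t
  simp only [fbd_apply, Pi.zero_apply]
  have h : ∀ v : V, (if v ∈ t then (0 : ZMod 2) else
      ∑ u, if u ∈ insert v t then 0 else c (insert u (insert v t)))
      = ∑ u, if v ∈ t ∨ u ∈ t ∨ u = v then 0 else c (insert u (insert v t)) := by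
    intro v
    by_cases hv : v ∈ t
    · simp [hv]
    · simp only [hv, if_false, false_or, Finset.mem_insert]
      refine Finset.sum_congr rfl fun u _ => ?_
      congr 1
      simp [or_comm]
  simp only [h]
  rw [← Finset.sum_product']
  refine Finset.sum_involution (fun p _ => (p.2, p.1)) ?_ ?_ ?_ ?_
  · rintro ⟨a, b⟩ _
    simp only
    rw [Finset.insert_comm a b]
    by_cases h1 : a ∈ t <;> by_cases h2 : b ∈ t <;> by_cases h3 : a = b <;>
      simp [h1, h2, h3, Ne.symm, eq_comm, zmod2_add_self] <;>
      simp_all [eq_comm, zmod2_add_self]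
  · rintro ⟨a, b⟩ _ hne heq
    simp only [Prod.mk.injEq] at heq
    apply hne
    simp [heq.1]
  · simp
  · simp

theorem fsupp_add {G : SimpleGraph V} {W : Finset V} {k : ℕ} {c d : FChain V}
    (hc : FSupp G W k c) (hd : FSupp G W k d) : FSupp G W k (c + d) := by
  intro s hs
  by_cases h : c s = 0
  · apply hd
    intro h'
    apply hs
    simp [h, h']
  · exact hc s h

theorem indepSet_mono {G : SimpleGraph V} {s t : Finset V} (h : IndepSet G t) (hst : s ⊆ t) :
    IndepSet G s := fun u hu v hv => h u (hst hu) v (hst hv)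

theorem fsupp_fbd [Fintype V] {G : SimpleGraph V} {W : Finset V} {k : ℕ} {c : FChain V}
    (hc : FSupp G W (k + 1) c) : FSupp G W k (fbd c) := by
  intro s hs
  rw [fbd_apply] at hs
  obtain ⟨v, _, hv⟩ := Finset.exists_ne_zero_of_sum_ne_zero hs
  by_cases hvs : v ∈ s
  · simp [hvs] at hv
  · simp only [hvs, if_false] at hv
    obtain ⟨h1, h2, h3⟩ := hc _ hv
    refine ⟨(Finset.subset_insert _ _).trans h1, ?_, indepSet_mono h3 (Finset.subset_insert _ _)⟩
    rw [Finset.card_insert_of_notMem hvs] at h2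
    omega

/-- Cone argument. -/
theorem fac_cone [Fintype V] (G : SimpleGraph V) (W : Finset V) (k : ℕ) (x : V) (hx : x ∈ W)
    (h : ∀ s ⊆ W, s.card = k → IndepSet G s → IndepSet G (insert x s)) : FAc G W k := by
  intro z hz hbd
  refine ⟨fun s => if x ∈ s then z (s.erase x) else 0, ?_, ?_⟩
  · intro s hs
    by_cases hxs : x ∈ s
    · simp only [hxs, if_true] at hs
      obtain ⟨h1, h2, h3⟩ := hz _ hs
      have h4 := h _ h1 h2 h3
      have h5 := Finset.card_erase_add_one hxs
      rw [Finset.insert_erase hxs] at h4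
      refine ⟨?_, by omega, h4⟩
      rw [← Finset.insert_erase hxs]
      exact Finset.insert_subset hx h1
    · simp [hxs] at hs
  · ext t
    rw [fbd_apply]
    by_cases hxt : x ∈ t
    · have h0 := congrFun hbd (t.erase x)
      rw [fbd_apply, ← Finset.add_sum_erase _ _ (Finset.mem_univ x)] at h0
      simp only [Finset.notMem_erase, if_false, Finset.insert_erase hxt, Pi.zero_apply] at h0
      rw [← Finset.add_sum_erase _ _ (Finset.mem_univ x)]
      simp only [hxt, if_true, zero_add, Finset.mem_insert, or_true]
      have h1 : ∀ a b : ZMod 2, a + b = 0 → b = a := by decide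
      rw [← h1 _ _ h0]
      refine Finset.sum_congr rfl fun v hv => ?_
      have hvx : v ≠ x := Finset.ne_of_mem_erase hv
      by_cases hvt : v ∈ t
      · simp [hvt, hvx]
      · simp only [hvt, if_false, Finset.mem_erase, and_false]
        rw [Finset.erase_insert_of_ne hvx]
    · rw [Finset.sum_eq_single x]
      · simp [hxt]
      · intro v _ hvx
        simp [hxt, Ne.symm hvx]
      · simp

/-- Edge deletion / explosion. -/
theorem fac_edge [Fintype V] (G H : SimpleGraph V) (W W' : Finset V) (k : ℕ) (x y : V)
    (hx : x ∈ W) (hy : y ∈ W) (hxy : G.Adj x y)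
    (hH : ∀ u v, H.Adj u v ↔ G.Adj u v ∧ ¬ (u = x ∧ v = y ∨ u = y ∧ v = x))
    (hW' : ∀ u, u ∈ W' ↔ u ∈ W ∧ ¬ G.Adj x u ∧ ¬ G.Adj y u)
    (h1 : FAc H W (k + 1)) (h2 : FAc G W' k) : FAc G W (k + 1) := by
  have hne : x ≠ y := hxy.ne
  intro z hz hbd
  have hzH : FSupp H W (k + 1) z := by
    intro s hs
    obtain ⟨a, b, c⟩ := hz s hs
    exact ⟨a, b, fun u hu v hv huv => c u hu v hv ((hH u v).1 huv).1⟩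
  obtain ⟨w, hw, hwz⟩ := h1 z hzH hbd
  let u : FChain V := fun t => if x ∈ t ∨ y ∈ t then 0 else w (insert x (insert y t))
  have hu : FSupp G W' k u := by
    intro t ht
    by_cases hxt : x ∈ t
    · simp [u, hxt] at ht
    by_cases hyt : y ∈ t
    · simp [u, hyt] at ht
    simp only [u, hxt, hyt, or_self, if_false] at ht
    obtain ⟨a, b, c⟩ := hw _ ht
    rw [Finset.card_insert_of_notMem (by simp [hne, hxt]),
      Finset.card_insert_of_notMem hyt] at b
    refine ⟨?_, by omega, ?_⟩
    · intro v hv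
      have hvx : v ≠ x := fun h => hxt (h ▸ hv)
      have hvy : v ≠ y := fun h => hyt (h ▸ hv)
      rw [hW']
      refine ⟨a (by simp [hv]), fun h => ?_, fun h => ?_⟩
      · exact c x (by simp) v (by simp [hv]) ((hH _ _).2 ⟨h, by simp [hvx, hvy]⟩)
      · exact c y (by simp) v (by simp [hv]) ((hH _ _).2 ⟨h, by simp [hvx, hvy]⟩)
    · intro p hp q hq hpq
      have hpx : p ≠ x := fun h => hxt (h ▸ hp)
      have hpy : p ≠ y := fun h => hyt (h ▸ hp)
      exact c p (by simp [hp]) q (by simp [hq]) ((hH _ _).2 ⟨hpq, by simp [hpx, hpy]⟩)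
  have hubd : fbd u = 0 := by
    ext t
    rw [fbd_apply, Pi.zero_apply]
    by_cases hxt : x ∈ t
    · exact Finset.sum_eq_zero fun v _ => by simp [u, hxt]
    by_cases hyt : y ∈ t
    · exact Finset.sum_eq_zero fun v _ => by simp [u, hyt]
    have hz0 : z (insert x (insert y t)) = 0 := by
      by_contra h
      exact (hz _ h).2.2 x (by simp) y (by simp) hxy
    rw [← hwz, fbd_apply] at hz0
    refine Eq.trans ?_ hz0
    refine Finset.sum_congr rfl fun v _ => ?_
    by_cases hvx : v = x
    · simp [u, hvx]
    by_cases hvy : v = y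
    · simp [u, hvy]
    by_cases hvt : v ∈ t
    · simp [hvt]
    simp only [u, hvt, hvx, hvy, Finset.mem_insert, if_false, or_false, hxt, hyt, Ne.symm hvx,
      Ne.symm hvy, eq_comm]
    congr 1
    ext a
    simp only [Finset.mem_insert]
    tauto
  obtain ⟨u', hu', hu'u⟩ := h2 u hu hubd
  have hu'x : ∀ t, x ∈ t → u' t = 0 := by
    intro t ht
    by_contra h
    exact ((hW' x).1 ((hu' t h).1 ht)).2.2 hxy.symm
  have hu'y : ∀ t, y ∈ t → u' t = 0 := by
    intro t ht
    by_contra h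
    exact ((hW' y).1 ((hu' t h).1 ht)).2.1 hxy
  let E : FChain V := fun s => if x ∈ s ∧ y ∈ s then u' ((s.erase x).erase y) else 0
  have hE : FSupp H W (k + 1 + 1 + 1) E := by
    intro s hs
    by_cases hxs : x ∈ s
    swap
    · simp [E, hxs] at hs
    by_cases hys : y ∈ s
    swap
    · simp [E, hys] at hs
    simp only [E, hxs, hys, and_self, if_true] at hs
    obtain ⟨a, b, c⟩ := hu' _ hs
    have e1 := Finset.card_erase_add_one hxs
    have e2 := Finset.card_erase_add_one (show y ∈ s.erase x by simp [hys, hne.symm])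
    have key : ∀ p ∈ s, p = x ∨ p = y ∨ p ∈ (s.erase x).erase y := by
      intro p hp
      simp only [Finset.mem_erase, hp, and_true]
      tauto
    refine ⟨?_, by omega, ?_⟩
    · intro p hp
      rcases key p hp with rfl | rfl | h
      · exact hx
      · exact hy
      · exact ((hW' p).1 (a h)).1
    · intro p hp q hq hpq
      obtain ⟨hG, hn⟩ := (hH _ _).1 hpq
      rcases key p hp with rfl | rfl | h <;> rcases key q hq with rfl | rfl | h'
      · exact hG.ne rfl
      · exact hn (by simp)
      · exact ((hW' q).1 (a h')).2.1 hG
      · exact hn (by simp)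
      · exact hG.ne rfl
      · exact ((hW' q).1 (a h')).2.2 hG
      · exact ((hW' p).1 (a h)).2.1 hG.symm
      · exact ((hW' p).1 (a h)).2.2 hG.symm
      · exact c p h q h' hG
  refine ⟨w + fbd E, ?_, ?_⟩
  · intro s hs
    obtain ⟨a, b, c⟩ := fsupp_add hw (fsupp_fbd hE) s hs
    refine ⟨a, b, ?_⟩
    have hnot : ¬ (x ∈ s ∧ y ∈ s) := by
      rintro ⟨hxs, hys⟩
      apply hs
      have hins : insert x (insert y ((s.erase x).erase y)) = s := by
        rw [Finset.insert_erase (by simp [hys, hne.symm]), Finset.insert_erase hxs]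
      have h3 := congrFun hu'u ((s.erase x).erase y)
      have h4 : u ((s.erase x).erase y) = w s := by
        simp [u, hins]
      rw [h4, fbd_apply] at h3
      have h5 : fbd E s = w s := by
        rw [← h3, fbd_apply]
        refine Finset.sum_congr rfl fun v _ => ?_
        by_cases hvx : v = x
        · subst hvx
          simp [hxs, hu'x]
        by_cases hvy : v = y
        · subst hvy
          simp [hys, hu'y]
        by_cases hvs : v ∈ s
        · simp [hvs, hvx, hvy]
        · simp only [E, hvs, if_false, Finset.mem_insert, hxs, hys, or_true, and_self, if_true,
            Finset.mem_erase, and_false]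
          rw [Finset.erase_insert_of_ne hvx, Finset.erase_insert_of_ne hvy]
      rw [Pi.add_apply, h5, zmod2_add_self]
    intro p hp q hq hpq
    refine c p hp q hq ((hH _ _).2 ⟨hpq, ?_⟩)
    rintro (⟨rfl, rfl⟩ | ⟨rfl, rfl⟩)
    · exact hnot ⟨hp, hq⟩
    · exact hnot ⟨hq, hp⟩
  · rw [map_add, fbd_fbd, add_zero, hwz]

theorem kdd_zero_card (G : SimpleGraph V) (D k : ℕ) (h : D * k = 0) :
    IsDisjointUnionOfKDD G D ∅ k := by
  refine ⟨fun _ => ∅, fun _ => ∅, ?_, by simp, by simp, by ext; simp, by simp⟩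
  intro j
  have : k ≠ 0 := by
    rintro rfl
    exact j.elim0
  have hD : D = 0 := by simpa [this] using h
  simp [hD]

theorem kdd_card {G : SimpleGraph V} {D k : ℕ} {W : Finset V}
    (h : IsDisjointUnionOfKDD G D W k) : W.card = 2 * D * k := by
  obtain ⟨A, B, hc, hd, hdd, hW, _⟩ := h
  rw [← hW, Finset.card_biUnion (fun j _ k _ hjk => hdd j k hjk)]
  rw [Finset.sum_congr rfl (g := fun _ => 2 * D)]
  · simp [mul_comm]
  · intro j _
    rw [Finset.card_union_of_disjoint (hd j), (hc j).1, (hc j).2]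
    ring

theorem kdd_nbr {G : SimpleGraph V} {D k : ℕ} {W : Finset V}
    (h : IsDisjointUnionOfKDD G D W k) (u : V) (hu : u ∈ W) :
    ∃ N ⊆ W, N.card = D ∧ ∀ v ∈ N, G.Adj u v := by
  obtain ⟨A, B, hc, hd, hdd, hW, hadj⟩ := h
  have hsub : ∀ j, A j ∪ B j ⊆ W := fun j => by
    rw [← hW]
    exact Finset.subset_biUnion_of_mem (fun j => A j ∪ B j) (Finset.mem_univ j)
  have hu' := hu
  rw [← hW] at hu'
  simp only [Finset.mem_biUnion, Finset.mem_univ, true_and, Finset.mem_union] at hu'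
  obtain ⟨j, hj | hj⟩ := hu'
  · have hs := Finset.subset_union_right.trans (hsub j)
    exact ⟨B j, hs, (hc j).2, fun v hv => (hadj u hu v (hs hv)).2 ⟨j, Or.inl ⟨hj, hv⟩⟩⟩
  · have hs := Finset.subset_union_left.trans (hsub j)
    exact ⟨A j, hs, (hc j).1, fun v hv => (hadj u hu v (hs hv)).2 ⟨j, Or.inr ⟨hj, hv⟩⟩⟩

theorem kdd_cons {G : SimpleGraph V} {D k : ℕ} {W W' A B : Finset V}
    (h : IsDisjointUnionOfKDD G D W' k) (hA : A.card = D) (hB : B.card = D)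
    (hAB : Disjoint A B) (hd : Disjoint (A ∪ B) W') (hW : A ∪ B ∪ W' = W)
    (h1 : ∀ u ∈ A, ∀ v ∈ W, G.Adj u v ↔ v ∈ B)
    (h2 : ∀ u ∈ B, ∀ v ∈ W, G.Adj u v ↔ v ∈ A) :
    IsDisjointUnionOfKDD G D W (k + 1) := by
  obtain ⟨A', B', hc, hd', hdd, hW', hadj⟩ := h
  have hsub : ∀ j, A' j ∪ B' j ⊆ W' := fun j => by
    rw [← hW']
    exact Finset.subset_biUnion_of_mem (fun j => A' j ∪ B' j) (Finset.mem_univ j)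
  refine ⟨Fin.cons A A', Fin.cons B B', ?_, ?_, ?_, ?_, ?_⟩
  · intro j
    refine Fin.cases ?_ (fun j => ?_) j
    · simp [hA, hB]
    · simpa using hc j
  · intro j
    refine Fin.cases ?_ (fun j => ?_) j
    · simpa using hAB
    · simpa using hd' j
  · intro i j
    refine Fin.cases ?_ (fun i => ?_) i <;> refine Fin.cases ?_ (fun j => ?_) j
    · simp
    · intro _
      simp only [Fin.cons_zero, Fin.cons_succ]
      exact Finset.disjoint_of_subset_right (hsub j) hd
    · intro _
      simp only [Fin.cons_zero, Fin.cons_succ]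
      exact (Finset.disjoint_of_subset_right (hsub i) hd).symm
    · intro hij
      simp only [Fin.cons_succ]
      exact hdd i j (fun h => hij (by rw [h]))
  · rw [← hW, ← hW']
    ext a
    simp only [Finset.mem_biUnion, Finset.mem_univ, true_and, Finset.mem_union, Fin.exists_fin_succ,
      Fin.cons_zero, Fin.cons_succ]
  · intro u hu v hv
    simp only [Fin.exists_fin_succ, Fin.cons_zero, Fin.cons_succ]
    have nA : ∀ a ∈ A, a ∉ B := fun a ha hb => Finset.disjoint_left.1 hAB ha hb
    have nW : ∀ a, a ∈ A ∨ a ∈ B → a ∉ W' := fun a ha hb =>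
      Finset.disjoint_left.1 hd (Finset.mem_union.2 ha) hb
    have sA : ∀ j a, a ∈ A' j → a ∈ W' := fun j a ha => hsub j (by simp [ha])
    have sB : ∀ j a, a ∈ B' j → a ∈ W' := fun j a ha => hsub j (by simp [ha])
    have hcov : ∀ a ∈ W, a ∈ A ∨ a ∈ B ∨ a ∈ W' := by
      intro a ha
      rw [← hW] at ha
      simpa [or_assoc] using ha
    rcases hcov u hu with h | h | h
    · rw [h1 u h v hv]
      have := nA u h
      have := nW u (Or.inl h)
      constructor
      · intro hb
        exact Or.inl (Or.inl ⟨h, hb⟩)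
      · rintro ((h | h) | ⟨j, h | h⟩)
        · exact h.2
        · exact absurd h.1 (nA u ‹_›)
        · exact absurd (sA j u h.1) this
        · exact absurd (sB j u h.1) this
    · rw [h2 u h v hv]
      have := nW u (Or.inr h)
      constructor
      · intro hb
        exact Or.inl (Or.inr ⟨h, hb⟩)
      · rintro ((h' | h') | ⟨j, h' | h'⟩)
        · exact absurd h (nA u h'.1)
        · exact h'.2
        · exact absurd (sA j u h'.1) this
        · exact absurd (sB j u h'.1) this
    · have hu1 : u ∉ A := fun h' => nW u (Or.inl h') h
      have hu2 : u ∉ B := fun h' => nW u (Or.inr h') h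
      rcases hcov v hv with h' | h' | h'
      · rw [G.adj_comm, h1 v h' u hu]
        have := nW v (Or.inl h')
        constructor
        · exact fun hb => absurd hb hu2
        · rintro ((h | h) | ⟨j, h | h⟩)
          · exact absurd h.1 hu1
          · exact absurd h.1 hu2
          · exact absurd (sB j v h.2) this
          · exact absurd (sA j v h.2) this
      · rw [G.adj_comm, h2 v h' u hu]
        have := nW v (Or.inr h')
        constructor
        · exact fun hb => absurd hb hu1
        · rintro ((h | h) | ⟨j, h | h⟩)
          · exact absurd h.1 hu1
          · exact absurd h.1 hu2
          · exact absurd (sB j v h.2) this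
          · exact absurd (sA j v h.2) this
      · rw [hadj u h v h']
        simp [hu1, hu2]

/-- The extremal acyclicity theorem. -/
theorem kdd_of_not_fac [Fintype V] (D : ℕ) (k : ℕ) : ∀ (G : SimpleGraph V) (W : Finset V),
    (∀ v ∈ W, ∀ N ⊆ W, (∀ u ∈ N, G.Adj v u) → N.card ≤ D) →
    2 * D * k ≤ W.card → ¬ FAc G W k → IsDisjointUnionOfKDD G D W k := by
  classical
  induction k with
  | zero =>
    intro G W _ _ hac
    have : W = ∅ := by
      by_contra h
      obtain ⟨x, hx⟩ := Finset.nonempty_iff_ne_empty.2 h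
      refine hac (fac_cone G W 0 x hx ?_)
      intro s _ hs _
      rw [Finset.card_eq_zero.1 hs]
      intro u hu v hv
      simp only [insert_empty_eq, Finset.mem_singleton] at hu hv
      subst hu hv
      exact G.loopless.irrefl _
    rw [this]
    exact kdd_zero_card G D 0 (by simp)
  | succ k ih =>
    intro G
    induction G using WellFoundedLT.induction with
    | ind G ihG =>
    intro W hdeg hcard hac
    by_cases hedge : ∃ x ∈ W, ∃ y ∈ W, G.Adj x y
    swap
    · push Not at hedge
      have : W = ∅ := by
        by_contra h
        obtain ⟨x, hx⟩ := Finset.nonempty_iff_ne_empty.2 h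
        refine hac (fac_cone G W _ x hx ?_)
        intro s hs _ _
        exact indepSet_mono (t := W) hedge (Finset.insert_subset hx hs)
      subst this
      refine kdd_zero_card G D _ ?_
      simp only [Finset.card_empty, nonpos_iff_eq_zero] at hcard
      simpa [mul_assoc] using hcard
    let N : V → Finset V := fun v => W.filter (fun u => G.Adj v u)
    let R : V → V → Finset V := fun x y => W.filter (fun u => ¬ G.Adj x u ∧ ¬ G.Adj y u)
    have hNdeg : ∀ v ∈ W, (N v).card ≤ D := fun v hv =>
      hdeg v hv _ (Finset.filter_subset _ _) (fun u hu => (Finset.mem_filter.1 hu).2)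
    have hN : ∀ v u, u ∈ N v ↔ u ∈ W ∧ G.Adj v u := fun v u => Finset.mem_filter
    have hR : ∀ x y u, u ∈ R x y ↔ u ∈ W ∧ ¬ G.Adj x u ∧ ¬ G.Adj y u :=
      fun x y u => Finset.mem_filter
    have hK : ∀ x ∈ W, ∀ y ∈ W, G.Adj x y → IsDisjointUnionOfKDD G D (R x y) k ∧
        Disjoint (N x) (N y) ∧ (N x).card = D ∧ (N y).card = D := by
      intro x hx y hy hxy
      have hun : R x y ∪ (N x ∪ N y) = W := by
        ext a
        simp only [Finset.mem_union, hR, hN]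
        tauto
      have hle := Finset.card_union_le (R x y) (N x ∪ N y)
      rw [hun] at hle
      have hle2 := Finset.card_union_add_card_inter (N x) (N y)
      have hx1 := hNdeg x hx
      have hy1 := hNdeg y hy
      have hk : IsDisjointUnionOfKDD G D (R x y) k := by
        apply ih
        · intro v hv M hM
          exact hdeg v ((hR _ _ _).1 hv).1 M (hM.trans (Finset.filter_subset _ _))
        · rw [mul_add] at hcard
          omega
        · intro hac2
          apply hac
          refine fac_edge G (G.deleteEdges {s(x, y)}) W (R x y) k x y hx hy hxy ?_
            (hR x y) ?_ hac2
          · intro u v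
            simp [SimpleGraph.deleteEdges_adj]
          · by_contra hac3
            have hlt : G.deleteEdges {s(x, y)} < G := by
              refine lt_of_le_of_ne (SimpleGraph.deleteEdges_le _) ?_
              intro h
              rw [← h] at hxy
              simp [SimpleGraph.deleteEdges_adj] at hxy
            have hkk := ihG _ hlt W (fun v hv M hM hM2 => hdeg v hv M hM
              (fun u hu => (SimpleGraph.deleteEdges_adj.1 (hM2 u hu)).1)) hcard hac3
            obtain ⟨M, hM, hMc, hMa⟩ := kdd_nbr hkk x hx
            have hyM : y ∉ M := by
              intro hyM
              have := hMa y hyM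
              simp [SimpleGraph.deleteEdges_adj] at this
            have := hdeg x hx (insert y M) (Finset.insert_subset hy hM) (by
              intro u hu
              rcases Finset.mem_insert.1 hu with rfl | hu
              · exact hxy
              · exact (SimpleGraph.deleteEdges_adj.1 (hMa u hu)).1)
            rw [Finset.card_insert_of_notMem hyM] at this
            omega
      have hkc := kdd_card hk
      rw [mul_add] at hcard
      refine ⟨hk, ?_, by omega, by omega⟩
      rw [Finset.disjoint_iff_inter_eq_empty, ← Finset.card_eq_zero]
      omega
    have hsat : ∀ x ∈ W, ∀ y ∈ W, G.Adj x y → ∀ u ∈ R x y, ∀ v ∈ W, G.Adj u v → v ∈ R x y := by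
      intro x hx y hy hxy u hu v hv huv
      obtain ⟨M, hM, hMc, hMa⟩ := kdd_nbr (hK x hx y hy hxy).1 u hu
      by_contra hvR
      have hvM : v ∉ M := fun h => hvR (hM h)
      have := hdeg u ((hR _ _ _).1 hu).1 (insert v M)
        (Finset.insert_subset hv (hM.trans (Finset.filter_subset _ _))) (by
          intro a ha
          rcases Finset.mem_insert.1 ha with rfl | ha
          · exact huv
          · exact hMa a ha)
      rw [Finset.card_insert_of_notMem hvM] at this
      omega
    have hNN : ∀ x ∈ W, ∀ y ∈ W, G.Adj x y → ∀ a ∈ N x, N a = N y := by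
      intro x hx y hy hxy a ha
      obtain ⟨haW, hxa⟩ := (hN _ _).1 ha
      obtain ⟨_, hd, _, hc⟩ := hK x hx a haW hxa
      refine Finset.eq_of_subset_of_card_le ?_ (by rw [hc, (hK x hx y hy hxy).2.2.2])
      intro b hb
      obtain ⟨hbW, hab⟩ := (hN _ _).1 hb
      have hbx : ¬ G.Adj x b := fun h => Finset.disjoint_left.1 hd ((hN _ _).2 ⟨hbW, h⟩) hb
      rw [hN]
      refine ⟨hbW, ?_⟩
      by_contra hyb
      have := hsat x hx y hy hxy b ((hR _ _ _).2 ⟨hbW, hbx, hyb⟩) a haW hab.symm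
      exact ((hR _ _ _).1 this).2.1 hxa
    obtain ⟨x, hx, y, hy, hxy⟩ := hedge
    obtain ⟨k1, k2, k3, k4⟩ := hK x hx y hy hxy
    refine kdd_cons k1 k3 k4 k2 ?_ ?_ ?_ ?_
    · rw [Finset.disjoint_left]
      intro a ha hb
      simp only [Finset.mem_union, hN] at ha
      rw [hR] at hb
      tauto
    · ext a
      simp only [Finset.mem_union, hR, hN]
      tauto
    · intro u hu v hv
      rw [← hNN x hx y hy hxy u hu, hN]
      simp [hv]
    · intro u hu v hv
      rw [← hNN y hy x hx hxy.symm u hu, hN]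
      simp [hv]

/-- Indicator chain of a single set. -/
def fdelta (A : Finset V) : FChain V := fun t => if t = A then 1 else 0

theorem fbd_fdelta [Fintype V] (A : Finset V) :
    fbd (fdelta A) = ∑ v ∈ A, fdelta (A.erase v) := by
  ext t
  rw [fbd_apply, Finset.sum_apply, ← Finset.sum_filter_add_sum_filter_not Finset.univ (· ∈ A)]
  rw [Finset.sum_eq_zero (s := Finset.univ.filter (fun v => ¬ v ∈ A)), add_zero]
  · rw [Finset.filter_mem_eq_inter, Finset.univ_inter]
    refine Finset.sum_congr rfl fun v hv => ?_
    unfold fdelta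
    by_cases hvt : v ∈ t
    · have : t ≠ A.erase v := by
        rintro rfl
        simp at hvt
      simp [hvt, this]
    · simp only [hvt, if_false]
      congr 1
      rw [eq_iff_iff]
      constructor
      · rintro rfl
        simp [hvt]
      · rintro rfl
        exact Finset.insert_erase hv
  · intro v hv
    have hvA : v ∉ A := (Finset.mem_filter.1 hv).2
    have : insert v t ≠ A := by
      rintro rfl
      simp at hvA
    simp [fdelta, this]

theorem sum_fbd [Fintype V] (K : Finset (Finset V)) (f : FChain V)
    (h : ∀ s, f s ≠ 0 → Even (s.filter (fun v => s.erase v ∈ K)).card) :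
    ∑ R ∈ K, fbd f R = 0 := by
  have e : ∑ R ∈ K, fbd f R =
      ∑ s : Finset V, ∑ v ∈ s.filter (fun v => s.erase v ∈ K), f s := by
    simp only [fbd_apply, Finset.sum_ite, Finset.sum_const_zero, zero_add]
    rw [Finset.sum_sigma', Finset.sum_sigma']
    refine Finset.sum_bij' (fun p _ => ⟨insert p.2 p.1, p.2⟩) (fun p _ => ⟨p.1.erase p.2, p.2⟩)
      ?_ ?_ ?_ ?_ ?_
    · rintro ⟨R, v⟩ hp
      simp only [Finset.mem_sigma, Finset.mem_filter, Finset.mem_univ, true_and] at hp ⊢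
      simp [Finset.erase_insert hp.2, hp.1]
    · rintro ⟨R, v⟩ hp
      simp only [Finset.mem_sigma, Finset.mem_filter, Finset.mem_univ, true_and] at hp ⊢
      simp [hp.2]
    · rintro ⟨R, v⟩ hp
      simp only [Finset.mem_sigma, Finset.mem_filter, Finset.mem_univ, true_and] at hp ⊢
      simp [Finset.erase_insert hp.2]
    · rintro ⟨R, v⟩ hp
      simp only [Finset.mem_sigma, Finset.mem_filter, Finset.mem_univ, true_and] at hp ⊢
      simp [Finset.insert_erase hp.1]
    · rintro ⟨R, v⟩ hp
      rfl
  rw [e]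
  refine Finset.sum_eq_zero fun s _ => ?_
  rw [Finset.sum_const]
  by_cases hs : f s = 0
  · simp [hs]
  · obtain ⟨r, hr⟩ := h s hs
    rw [hr, add_smul, zmod2_add_self]

/-- Filling chains. -/
theorem exists_filling [Fintype V] (G : SimpleGraph V) {n : ℕ} (P : Fin n → Finset V)
    (hac : ∀ I : Finset (Fin n), I.Nonempty → FAc G (I.biUnion P) I.card)
    (s t : Fin n → V) (hs : Function.Injective s) (ht : Function.Injective t)
    (hsP : ∀ i, s i ∈ P i) (htP : ∀ i, t i ∈ P i)
    (hsI : IndepSet G (Finset.univ.image s)) (htI : IndepSet G (Finset.univ.image t)) (m : ℕ) :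
    ∃ f : Finset (Fin n) → FChain V, ∀ I : Finset (Fin n), I.card ≤ m →
      FSupp G (I.biUnion P) (I.card + 1) (f I) ∧
      fbd (f I) = fdelta (I.image s) + fdelta (I.image t) + ∑ i ∈ I, f (I.erase i) := by
  have hself : ∀ c : FChain V, c + c = 0 := fun c => by
    ext a
    exact zmod2_add_self _
  induction m with
  | zero =>
    refine ⟨fun _ => 0, fun I hI => ?_⟩
    have : I = ∅ := by simpa using hI
    subst this
    refine ⟨fun s hs => absurd rfl hs, ?_⟩
    simp [hself]
  | succ m ih =>
    obtain ⟨f, hf⟩ := ih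
    have key : ∀ I : Finset (Fin n), ∃ c : FChain V, I.card = m + 1 →
        FSupp G (I.biUnion P) (I.card + 1) c ∧
        fbd c = fdelta (I.image s) + fdelta (I.image t) + ∑ i ∈ I, f (I.erase i) := by
      intro I
      by_cases hI : I.card = m + 1
      swap
      · exact ⟨0, fun h => absurd h hI⟩
      have hdel : ∀ s : Fin n → V, Function.Injective s → (∀ i, s i ∈ P i) →
          IndepSet G (Finset.univ.image s) →
          FSupp G (I.biUnion P) I.card (fdelta (I.image s)) ∧
          fbd (fdelta (I.image s)) = ∑ i ∈ I, fdelta ((I.erase i).image s) := by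
        intro s hs hsP hsI
        constructor
        · intro a ha
          have : a = I.image s := by
            by_contra h
            simp [fdelta, h] at ha
          subst this
          refine ⟨?_, Finset.card_image_of_injective _ hs,
            indepSet_mono hsI (Finset.image_subset_image (Finset.subset_univ _))⟩
          intro v hv
          obtain ⟨i, hi, rfl⟩ := Finset.mem_image.1 hv
          exact Finset.mem_biUnion.2 ⟨i, hi, hsP i⟩
        · rw [fbd_fdelta, Finset.sum_image (fun a _ b _ h => hs h)]
          refine Finset.sum_congr rfl fun i _ => ?_
          rw [Finset.image_erase hs]
      obtain ⟨d1, d2⟩ := hdel s hs hsP hsI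
      obtain ⟨d3, d4⟩ := hdel t ht htP htI
      have hce : ∀ i ∈ I, (I.erase i).card = m := fun i hi => by
        rw [Finset.card_erase_of_mem hi]
        omega
      have hz : FSupp G (I.biUnion P) I.card
          (fdelta (I.image s) + fdelta (I.image t) + ∑ i ∈ I, f (I.erase i)) := by
        refine fsupp_add (fsupp_add d1 d3) ?_
        intro a ha
        rw [Finset.sum_apply] at ha
        obtain ⟨i, hi, hne⟩ := Finset.exists_ne_zero_of_sum_ne_zero ha
        obtain ⟨e1, e2, e3⟩ := (hf (I.erase i) (hce i hi).le).1 a hne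
        rw [hce i hi] at e2
        exact ⟨e1.trans (Finset.biUnion_subset_biUnion_of_subset_left _ (Finset.erase_subset _ _)),
          by omega, e3⟩
      have hcyc : fbd (fdelta (I.image s) + fdelta (I.image t) + ∑ i ∈ I, f (I.erase i)) = 0 := by
        rw [map_add, map_add, map_sum, d2, d4]
        rw [Finset.sum_congr rfl fun i hi => (hf (I.erase i) (hce i hi).le).2]
        rw [Finset.sum_add_distrib, Finset.sum_add_distrib]
        have hdd : ∑ i ∈ I, ∑ j ∈ I.erase i, f ((I.erase i).erase j) = 0 := by
          rw [Finset.sum_sigma']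
          refine Finset.sum_involution (fun p _ => ⟨p.2, p.1⟩) ?_ ?_ ?_ ?_
          · rintro ⟨i, j⟩ _
            simp only
            rw [Finset.erase_right_comm]
            exact hself _
          · rintro ⟨i, j⟩ h _ heq
            simp only [Finset.mem_sigma, Finset.mem_erase] at h
            simp only [Sigma.mk.injEq] at heq
            exact h.2.1 heq.1
          · rintro ⟨i, j⟩ h
            simp only [Finset.mem_sigma, Finset.mem_erase] at h ⊢
            exact ⟨h.2.2, h.2.1.symm, h.1⟩
          · rintro ⟨i, j⟩ h
            rfl
        rw [hdd, add_zero]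
        exact hself _
      obtain ⟨c, hc1, hc2⟩ := hac I (Finset.card_pos.1 (by omega)) _ hz hcyc
      exact ⟨c, fun _ => ⟨hc1, hc2⟩⟩
    choose c hc using key
    refine ⟨fun I => if I.card ≤ m then f I else c I, fun I hI => ?_⟩
    have hsum : ∑ i ∈ I, (fun I => if I.card ≤ m then f I else c I) (I.erase i)
        = ∑ i ∈ I, f (I.erase i) := by
      refine Finset.sum_congr rfl fun i hi => ?_
      have : (I.erase i).card ≤ m := by
        rw [Finset.card_erase_of_mem hi]
        omega
      simp [this]
    rw [hsum]
    by_cases h : I.card ≤ m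
    · simp only [h, if_true]
      exact hf I h
    · simp only [h, if_false]
      exact hc I (by omega)

theorem it_choice {G : SimpleGraph V} {n : ℕ} {P : Fin n → Finset V} {S : Finset V}
    (hdisj : ∀ i j, i ≠ j → Disjoint (P i) (P j)) (hcover : ∀ v, ∃ i, v ∈ P i)
    (hS : IsIndepTransversal G P S) :
    ∃ s : Fin n → V, Function.Injective s ∧ (∀ i, s i ∈ P i) ∧ Finset.univ.image s = S := by
  have h := hS.2
  simp only [Finset.card_eq_one] at h
  choose s hs using h
  have hm : ∀ i, s i ∈ S ∩ P i := fun i => by rw [hs]; simp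
  refine ⟨s, ?_, fun i => (Finset.mem_inter.1 (hm i)).2, ?_⟩
  · intro i j hij
    by_contra hne
    refine Finset.disjoint_left.1 (hdisj i j hne) (Finset.mem_inter.1 (hm i)).2 ?_
    rw [hij]
    exact (Finset.mem_inter.1 (hm j)).2
  · ext v
    simp only [Finset.mem_image, Finset.mem_univ, true_and]
    constructor
    · rintro ⟨i, rfl⟩
      exact (Finset.mem_inter.1 (hm i)).1
    · intro hv
      obtain ⟨i, hi⟩ := hcover v
      have : v ∈ S ∩ P i := Finset.mem_inter.2 ⟨hv, hi⟩
      rw [hs, Finset.mem_singleton] at this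
      exact ⟨i, this.symm⟩

end helpers

/-- Buys--Kang--Ozeki: if `G` has maximum degree `Δ`, every class of the partition has
size at least `2Δ`, and for every nonempty `I` the induced subgraph `G[V_I]` is not a
disjoint union of `|I|` copies of `K_{Δ,Δ}`, then the reconfiguration graph on
independent transversals is connected. -/
theorem stmt_0 {V : Type*} [Fintype V] [DecidableEq V]
    (G : SimpleGraph V) [DecidableRel G.Adj] (Δ n : ℕ)
    (hΔ : ∀ v, G.degree v ≤ Δ)
    (P : Fin n → Finset V)
    (hne : ∀ i, (P i).Nonempty)
    (hdisj : ∀ i j, i ≠ j → Disjoint (P i) (P j))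
    (hcover : ∀ v, ∃ i, v ∈ P i)
    (hsize : ∀ i, 2 * Δ ≤ (P i).card)
    (hnotKDD : ∀ I : Finset (Fin n), I.Nonempty →
      ¬ IsDisjointUnionOfKDD G Δ (I.biUnion P) I.card)
    (S T : Finset V)
    (hS : IsIndepTransversal G P S) (hT : IsIndepTransversal G P T) :
    Relation.ReflTransGen (ITAdj G P) S T := by
  classical
  have hac : ∀ I : Finset (Fin n), I.Nonempty → FAc G (I.biUnion P) I.card := by
    intro I hI
    by_contra hcon
    refine hnotKDD I hI (kdd_of_not_fac Δ I.card G _ ?_ ?_ hcon)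
    · intro v _ N _ hN
      refine le_trans (Finset.card_le_card ?_) (hΔ v)
      intro u hu
      rw [SimpleGraph.mem_neighborFinset]
      exact hN u hu
    · rw [Finset.card_biUnion (fun i _ j _ hij => hdisj i j hij), mul_comm, ← smul_eq_mul]
      exact Finset.card_nsmul_le_sum _ _ _ (fun i _ => hsize i)
  obtain ⟨s, hs1, hs2, hs3⟩ := it_choice hdisj hcover hS
  obtain ⟨t, ht1, ht2, ht3⟩ := it_choice hdisj hcover hT
  obtain ⟨f, hf⟩ := exists_filling G P hac s t hs1 ht1 hs2 ht2 (hs3 ▸ hS.1) (ht3 ▸ hT.1) n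
  obtain ⟨hsupp, hbd⟩ := hf Finset.univ (by simp)
  rw [hs3, ht3] at hbd
  rw [Finset.card_univ, Fintype.card_fin] at hsupp
  by_contra hST
  let K : Finset (Finset V) := Finset.univ.filter (fun R => Relation.ReflTransGen (ITAdj G P) S R)
  have hK : ∀ R, R ∈ K ↔ Relation.ReflTransGen (ITAdj G P) S R := fun R => by simp [K]
  have hKIT : ∀ R ∈ K, IsIndepTransversal G P R := by
    intro R hR
    rw [hK] at hR
    rcases hR.cases_tail with h | ⟨Q, _, h⟩
    · rw [h]
      exact hS
    · exact h.2.1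
  have hzero : ∑ R ∈ K, fbd (f Finset.univ) R = 0 := by
    apply sum_fbd
    intro σ hσ
    obtain ⟨_, hcard, hind⟩ := hsupp σ hσ
    rcases Finset.eq_empty_or_nonempty (σ.filter (fun v => σ.erase v ∈ K)) with h | ⟨v, hv⟩
    · rw [h]
      simp
    · obtain ⟨hvσ, hvK⟩ := Finset.mem_filter.1 hv
      have hIT := hKIT _ hvK
      obtain ⟨i, hi⟩ := hcover v
      obtain ⟨r, hr⟩ := Finset.card_eq_one.1 (hIT.2 i)
      have hr' : r ∈ σ.erase v ∩ P i := by rw [hr]; simp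
      simp only [Finset.mem_inter, Finset.mem_erase] at hr'
      obtain ⟨⟨hrv, hrσ⟩, hrP⟩ := hr'
      have huniq : ∀ a ∈ σ, a ∈ P i → a = v ∨ a = r := by
        intro a ha hai
        by_cases hav : a = v
        · exact Or.inl hav
        · right
          have : a ∈ σ.erase v ∩ P i := by simp [ha, hai, hav]
          rw [hr] at this
          simpa using this
      have hother : ∀ j, j ≠ i → ∀ a ∈ P i, σ.erase a ∩ P j = σ ∩ P j := by
        intro j hj a ha
        have haj : a ∉ P j := fun h => Finset.disjoint_left.1 (hdisj i j hj.symm) ha h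
        rw [Finset.erase_inter, Finset.erase_eq_of_notMem]
        simp [haj]
      have hIT2 : IsIndepTransversal G P (σ.erase r) := by
        refine ⟨indepSet_mono hind (Finset.erase_subset _ _), fun j => ?_⟩
        by_cases hj : j = i
        · subst hj
          rw [Finset.card_eq_one]
          refine ⟨v, ?_⟩
          ext a
          simp only [Finset.mem_inter, Finset.mem_erase, Finset.mem_singleton]
          constructor
          · rintro ⟨⟨h1, h2⟩, h3⟩
            exact (huniq a h2 h3).resolve_right h1
          · rintro rfl
            exact ⟨⟨hrv.symm, hvσ⟩, hi⟩
        · rw [hother j hj r hrP, ← hother j hj v hi]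
          exact hIT.2 j
      have hun : σ.erase v ∪ σ.erase r = σ := by
        ext a
        simp only [Finset.mem_union, Finset.mem_erase]
        constructor
        · rintro (h | h) <;> exact h.2
        · intro h
          by_cases hav : a = v
          · right
            exact ⟨fun h' => hrv (h'.symm.trans hav), h⟩
          · exact Or.inl ⟨hav, h⟩
      have hrK : σ.erase r ∈ K := by
        rw [hK] at hvK ⊢
        refine hvK.tail ⟨hIT, hIT2, ?_, ?_⟩
        · rw [hun]
          exact hind
        · rw [hun, hcard]
      have : σ.filter (fun v => σ.erase v ∈ K) = {v, r} := by
        ext a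
        simp only [Finset.mem_filter, Finset.mem_insert, Finset.mem_singleton]
        constructor
        · rintro ⟨haσ, haK⟩
          by_contra hcon
          obtain ⟨j, hj⟩ := hcover a
          by_cases hji : j = i
          · subst hji
            exact hcon (huniq a haσ hj)
          · obtain ⟨b, hb⟩ := Finset.card_eq_one.1 ((hKIT _ haK).2 j)
            have h1 := hIT.2 j
            rw [hother j hji v hi] at h1
            have h2 := (hKIT _ haK).2 j
            rw [Finset.erase_inter, Finset.card_erase_of_mem (by simp [haσ, hj]), h1] at h2
            omega
        · rintro (rfl | rfl)
          · exact ⟨hvσ, hvK⟩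
          · exact ⟨hrσ, hrK⟩
      rw [this, Finset.card_pair hrv.symm]
      exact even_two
  have hone : ∑ R ∈ K, fbd (f Finset.univ) R = 1 := by
    have hSK : S ∈ K := (hK S).2 Relation.ReflTransGen.refl
    have hTK : T ∉ K := fun h => hST ((hK T).1 h)
    have : ∀ R ∈ K, fbd (f Finset.univ) R = if R = S then 1 else 0 := by
      intro R hR
      have hRT : R ≠ T := fun h => hTK (h ▸ hR)
      rw [hbd, Pi.add_apply, Pi.add_apply, Finset.sum_apply, Finset.sum_eq_zero]
      · simp [fdelta, hRT]
      · intro i _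
        by_contra hne0
        have hsub := ((hf (Finset.univ.erase i) (by
          refine (Finset.card_le_univ _).trans ?_
          simp)).1 R hne0).1
        obtain ⟨b, hb⟩ := Finset.card_eq_one.1 ((hKIT R hR).2 i)
        have hb' : b ∈ R ∩ P i := by rw [hb]; simp
        obtain ⟨hbR, hbi⟩ := Finset.mem_inter.1 hb'
        obtain ⟨j, hj, hbj⟩ := Finset.mem_biUnion.1 (hsub hbR)
        exact Finset.disjoint_left.1 (hdisj j i (Finset.ne_of_mem_erase hj)) hbj hbi
    rw [Finset.sum_congr rfl this]
    simp [hSK]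
  rw [hzero] at hone
  exact zero_ne_one hone
end

section
/- Let G be a finite simple graph with maximum degree Δ, and let 𝒱 = {V_1, …, V_n} be a partition of V(G). If |V_i| ≥ 2Δ + 1 for all i, then the reconfiguration graph RG(G, 𝒱) is connected. -/
set_option linter.unusedSectionVars false

namespace Reconf

variable {V ι : Type*} [DecidableEq ι]

/-- partial independent transversal on the index set `I`. -/
def Ok (G : SimpleGraph V) (I : Finset ι) (P : ι → Set V) (r : ι → V) : Prop :=
  (∀ i ∈ I, r i ∈ P i) ∧ ∀ i ∈ I, ∀ j ∈ I, ¬ G.Adj (r i) (r j)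

/-- a (possibly trivial) reconfiguration step on the index set `I`. -/
def Step (G : SimpleGraph V) (I : Finset ι) (P : ι → Set V) (r s : ι → V) : Prop :=
  Ok G I P r ∧ Ok G I P s ∧ (∀ i ∈ I, ¬ G.Adj (r i) (s i)) ∧
    ∀ i ∈ I, ∀ j ∈ I, r i ≠ s i → r j ≠ s j → i = j

abbrev Reach (G : SimpleGraph V) (I : Finset ι) (P : ι → Set V) :=
  Relation.ReflTransGen (Step G I P)

def Disj (I : Finset ι) (P : ι → Set V) : Prop :=
  ∀ i ∈ I, ∀ j ∈ I, ∀ x, x ∈ P i → x ∈ P j → i = j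

def Undom (G : SimpleGraph V) (I : Finset ι) (P : ι → Set V) (m : ι) (k : ℕ) : Prop :=
  ∀ J ⊆ I, m ∈ J → ∀ D : Finset V, D.card + k ≤ 2 * J.card →
    ∃ i ∈ J, ∃ y ∈ P i, ∀ z ∈ D, ¬ G.Adj z y

/-- Classes after exploding the edge `uv` and merging class `j` into class `m`. -/
def Expl (G : SimpleGraph V) (P : ι → Set V) (m j : ι) (u v : V) : ι → Set V :=
  fun i => {x | (x ∈ P i ∨ (i = m ∧ x ∈ P j)) ∧ ¬ G.Adj u x ∧ ¬ G.Adj v x}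

/-- `G'` is `G` with the edge `uv` deleted. -/
def IsDel (G G' : SimpleGraph V) (u v : V) : Prop :=
  ∀ a b, G'.Adj a b ↔ G.Adj a b ∧ ¬ (a = u ∧ b = v) ∧ ¬ (a = v ∧ b = u)

lemma exists_del [Finite V] (G : SimpleGraph V) (u v : V) (h : G.Adj u v) :
    ∃ G' : SimpleGraph V, IsDel G G' u v ∧ G'.edgeSet.ncard < G.edgeSet.ncard := by
  refine ⟨G.deleteEdges {s(u, v)}, ?_, ?_⟩
  · intro a b
    simp only [SimpleGraph.deleteEdges_adj, Set.mem_singleton_iff, Sym2.eq_iff]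
    tauto
  · apply Set.ncard_lt_ncard _ (Set.toFinite _)
    rw [SimpleGraph.edgeSet_deleteEdges]
    refine ⟨Set.sdiff_subset, fun hs => ?_⟩
    have := hs (show s(u, v) ∈ G.edgeSet from h)
    simp at this

lemma Step.symm {G : SimpleGraph V} {I : Finset ι} {P : ι → Set V} {r s : ι → V}
    (h : Step G I P r s) : Step G I P s r := by
  obtain ⟨h1, h2, h3, h4⟩ := h
  exact ⟨h2, h1, fun i hi ha => h3 i hi ha.symm, fun i hi j hj a b => h4 i hi j hj a.symm b.symm⟩

lemma Reach.symm {G : SimpleGraph V} {I : Finset ι} {P : ι → Set V} {r s : ι → V}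
    (h : Reach G I P r s) : Reach G I P s r := by
  induction h with
  | refl => exact .refl
  | tail _ h ih => exact .head h.symm ih

lemma Ok.congr {G : SimpleGraph V} {I : Finset ι} {P : ι → Set V} {r s : ι → V}
    (h : Ok G I P r) (e : ∀ i ∈ I, r i = s i) : Ok G I P s := by
  refine ⟨fun i hi => e i hi ▸ h.1 i hi, fun i hi j hj => ?_⟩
  rw [← e i hi, ← e j hj]; exact h.2 i hi j hj

lemma Ok.step {G : SimpleGraph V} {I : Finset ι} {P : ι → Set V} {r s : ι → V}
    (h : Ok G I P r) (e : ∀ i ∈ I, r i = s i) : Step G I P r s := by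
  refine ⟨h, h.congr e, fun i hi => ?_, fun i hi j hj a => absurd (e i hi) a⟩
  rw [e i hi]; exact G.loopless.irrefl _

/-- Putting a fixed vertex `v` back into class `j`. -/
lemma ok_lift {G : SimpleGraph V} {I : Finset ι} {P : ι → Set V} {j : ι} {v : V}
    {r : ι → V} (h : ∀ a ∈ I, ∀ b ∈ I, a ≠ j → b ≠ j → ¬ G.Adj (r a) (r b)) (hv : v ∈ P j)
    (hP : ∀ i ∈ I, i ≠ j → r i ∈ P i ∧ ¬ G.Adj v (r i)) :
    Ok G I P (Function.update r j v) := by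
  constructor
  · intro i hi
    by_cases hj : i = j
    · subst hj; simpa using hv
    · simpa [hj] using (hP i hi hj).1
  · intro a ha b hb
    by_cases haj : a = j <;> by_cases hbj : b = j
    · subst haj; subst hbj; simp
    · subst haj; simpa [hbj] using (hP b hb hbj).2
    · subst hbj; simpa [haj, G.adj_comm] using (hP a ha haj).2
    · simpa [haj, hbj] using h a ha b hb haj hbj

lemma Ok.lift {G : SimpleGraph V} {I : Finset ι} {P P' : ι → Set V} {j : ι} {v : V}
    {r : ι → V} (h : Ok G (I.erase j) P' r) (hv : v ∈ P j)
    (hP : ∀ i ∈ I, i ≠ j → ∀ x ∈ P' i, x ∈ P i ∧ ¬ G.Adj v x) :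
    Ok G I P (Function.update r j v) := by
  refine ok_lift (fun a ha b hb haj hbj => ?_) hv (fun i hi hj => hP i hi hj _ ?_)
  · exact h.2 a (by simp [ha, haj]) b (by simp [hb, hbj])
  · exact h.1 i (by simp [hi, hj])

lemma Step.lift {G : SimpleGraph V} {I : Finset ι} {P P' : ι → Set V} {j : ι} {v : V}
    {r s : ι → V} (h : Step G (I.erase j) P' r s) (hv : v ∈ P j)
    (hP : ∀ i ∈ I, i ≠ j → ∀ x ∈ P' i, x ∈ P i ∧ ¬ G.Adj v x) :
    Step G I P (Function.update r j v) (Function.update s j v) := by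
  obtain ⟨h1, h2, h3, h4⟩ := h
  refine ⟨h1.lift hv hP, h2.lift hv hP, fun i hi => ?_, fun a ha b hb hna hnb => ?_⟩
  · by_cases hj : i = j
    · subst hj; simp
    · simpa [hj] using h3 i (by simp [hi, hj])
  · have haj : a ≠ j := by rintro rfl; simp at hna
    have hbj : b ≠ j := by rintro rfl; simp at hnb
    exact h4 a (by simp [ha, haj]) b (by simp [hb, hbj]) (by simpa [haj] using hna)
      (by simpa [hbj] using hnb)

lemma Reach.lift {G : SimpleGraph V} {I : Finset ι} {P P' : ι → Set V} {j : ι} {v : V}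
    {r s : ι → V} (h : Reach G (I.erase j) P' r s) (hv : v ∈ P j)
    (hP : ∀ i ∈ I, i ≠ j → ∀ x ∈ P' i, x ∈ P i ∧ ¬ G.Adj v x) :
    Reach G I P (Function.update r j v) (Function.update s j v) := by
  induction h with
  | refl => exact .refl
  | tail _ h ih => exact ih.tail (h.lift hv hP)

lemma Ok.mono {G G' : SimpleGraph V} {I I' : Finset ι} {P P' : ι → Set V} {r : ι → V}
    (h : Ok G I P r) (hI : I' ⊆ I) (hP : ∀ i ∈ I', ∀ x ∈ P i, x ∈ P' i)
    (hG : ∀ i ∈ I', ∀ j ∈ I', ∀ x ∈ P i, ∀ y ∈ P j, G'.Adj x y → G.Adj x y) :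
    Ok G' I' P' r :=
  ⟨fun i hi => hP i hi _ (h.1 i (hI hi)), fun i hi j hj ha =>
    h.2 i (hI hi) j (hI hj) (hG i hi j hj _ (h.1 i (hI hi)) _ (h.1 j (hI hj)) ha)⟩

lemma Step.mono {G G' : SimpleGraph V} {I I' : Finset ι} {P P' : ι → Set V} {r s : ι → V}
    (h : Step G I P r s) (hI : I' ⊆ I) (hP : ∀ i ∈ I', ∀ x ∈ P i, x ∈ P' i)
    (hG : ∀ i ∈ I', ∀ j ∈ I', ∀ x ∈ P i, ∀ y ∈ P j, G'.Adj x y → G.Adj x y) :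
    Step G' I' P' r s := by
  obtain ⟨h1, h2, h3, h4⟩ := h
  exact ⟨h1.mono hI hP hG, h2.mono hI hP hG, fun i hi ha => h3 i (hI hi)
    (hG i hi i hi _ (h1.1 i (hI hi)) _ (h2.1 i (hI hi)) ha),
    fun i hi j hj => h4 i (hI hi) j (hI hj)⟩

lemma Reach.mono {G G' : SimpleGraph V} {I I' : Finset ι} {P P' : ι → Set V} {r s : ι → V}
    (h : Reach G I P r s) (hI : I' ⊆ I) (hP : ∀ i ∈ I', ∀ x ∈ P i, x ∈ P' i)
    (hG : ∀ i ∈ I', ∀ j ∈ I', ∀ x ∈ P i, ∀ y ∈ P j, G'.Adj x y → G.Adj x y) :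
    Reach G' I' P' r s := by
  induction h with
  | refl => exact .refl
  | tail _ h ih => exact ih.tail (h.mono hI hP hG)

lemma Undom.del {G G' : SimpleGraph V} {I : Finset ι} {P : ι → Set V} {m : ι} {k : ℕ}
    {u v : V} (h : Undom G I P m k) (hd : IsDel G G' u v) : Undom G' I P m k := by
  intro J hJ hm D hD
  obtain ⟨i, hi, y, hy, hz⟩ := h J hJ hm D hD
  exact ⟨i, hi, y, hy, fun z hzD ha => hz z hzD ((hd _ _).1 ha).1⟩

lemma Disj.expl {G : SimpleGraph V} {I : Finset ι} {P : ι → Set V} {m j : ι} {u v : V}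
    (h : Disj I P) (hm : m ∈ I) (hj : j ∈ I) : Disj (I.erase j) (Expl G P m j u v) := by
  intro a ha b hb x hxa hxb
  simp only [Finset.mem_erase] at ha hb
  obtain ⟨h1, -, -⟩ := hxa
  obtain ⟨h2, -, -⟩ := hxb
  rcases h1 with h1 | ⟨rfl, h1⟩ <;> rcases h2 with h2 | ⟨rfl, h2⟩
  · exact h _ ha.2 _ hb.2 _ h1 h2
  · exact absurd (h _ ha.2 _ hj _ h1 h2) ha.1
  · exact absurd (h _ hb.2 _ hj _ h2 h1) hb.1
  · rfl

lemma Undom.expl {G G' : SimpleGraph V} {I : Finset ι} {P : ι → Set V} {m j : ι} {k : ℕ}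
    {u v : V} (h : Undom G I P m k) (hd : IsDel G G' u v) (hj : j ∈ I) (hjm : j ≠ m) :
    Undom G' (I.erase j) (Expl G P m j u v) m k := by
  classical
  intro J hJ hm D hD
  have hjJ : j ∉ J := fun h => by simpa using hJ h
  obtain ⟨i, hi, y, hy, hz⟩ := h (insert j J)
    (Finset.insert_subset hj (hJ.trans (Finset.erase_subset _ _))) (by simp [hm])
    (insert u (insert v D)) (by
      have h1 := Finset.card_insert_le u (insert v D)
      have h2 := Finset.card_insert_le v D
      rw [Finset.card_insert_of_notMem hjJ]; omega)
  have hu := hz u (by simp)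
  have hv := hz v (by simp)
  have hD : ∀ z ∈ D, ¬ G'.Adj z y := fun z hzD ha => hz z (by simp [hzD]) ((hd _ _).1 ha).1
  rcases Finset.mem_insert.1 hi with rfl | hi
  · exact ⟨m, hm, y, ⟨Or.inr ⟨rfl, hy⟩, hu, hv⟩, hD⟩
  · exact ⟨i, hi, y, ⟨Or.inl hy, hu, hv⟩, hD⟩

lemma Undom.expl_self {G : SimpleGraph V} {I : Finset ι} {P : ι → Set V} {m : ι}
    {u v : V} (h : Undom G I P m 0) :
    Undom G I (Expl G P m m u v) m 2 := by
  classical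
  intro J hJ hm D hD
  obtain ⟨i, hi, y, hy, hz⟩ := h J hJ hm
    (insert u (insert v D)) (by
      have h1 := Finset.card_insert_le u (insert v D)
      have h2 := Finset.card_insert_le v D
      omega)
  exact ⟨i, hi, y, ⟨Or.inl hy, hz u (by simp), hz v (by simp)⟩, fun z hzD => hz z (by simp [hzD])⟩

/-- Bad states restrict to the exploded system. -/
lemma bad_rest {G G' : SimpleGraph V} {I : Finset ι} {P : ι → Set V} {m j : ι}
    {u v : V} {t : ι → V} (hP : Disj I P) (hd : IsDel G G' u v) (hj : j ∈ I) (hm : m ∈ I)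
    (hu : u ∈ P m) (hv : v ∈ P j) (ht : Ok G' I P t) (h1 : t m = u) (h2 : t j = v) :
    Ok G' ((I.erase j).erase m) (Expl G P m j u v) t := by
  have key : ∀ i ∈ (I.erase j).erase m, i ∈ I ∧ t i ≠ u ∧ t i ≠ v := by
    intro i hi
    simp only [Finset.mem_erase] at hi
    refine ⟨hi.2.2, fun h => hi.1 (hP i hi.2.2 m hm u ?_ hu),
      fun h => hi.2.1 (hP i hi.2.2 j hj v ?_ hv)⟩
    · rw [← h]; exact ht.1 i hi.2.2
    · rw [← h]; exact ht.1 i hi.2.2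
  refine ⟨fun i hi => ?_, fun a ha b hb => ht.2 a (key a ha).1 b (key b hb).1⟩
  obtain ⟨hi, hiu, hiv⟩ := key i hi
  refine ⟨Or.inl (ht.1 i hi), fun ha => ?_, fun ha => ?_⟩
  · refine ht.2 m hm i hi ((hd _ _).2 ⟨by rwa [h1], fun h => hiv h.2, fun h => hiu h.2⟩)
  · refine ht.2 j hj i hi ((hd _ _).2 ⟨by rwa [h2], fun h => hiv h.2, fun h => hiu h.2⟩)

/-- A `G'`-state which is not bad is a `G`-state. -/
lemma good_ok {G G' : SimpleGraph V} {I : Finset ι} {P : ι → Set V} {m j : ι}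
    {u v : V} {t : ι → V} (hP : Disj I P) (hd : IsDel G G' u v) (hj : j ∈ I) (hm : m ∈ I)
    (hu : u ∈ P m) (hv : v ∈ P j) (ht : Ok G' I P t) (h : ¬ (t m = u ∧ t j = v)) :
    Ok G I P t := by
  refine ⟨ht.1, fun a ha b hb hab => ?_⟩
  have := ht.2 a ha b hb
  rw [hd] at this
  have h3 : (t a = u ∧ t b = v) ∨ (t a = v ∧ t b = u) := by tauto
  rcases h3 with ⟨h3, h4⟩ | ⟨h3, h4⟩
  · obtain rfl := hP a ha m hm u (h3 ▸ ht.1 a ha) hu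
    obtain rfl := hP b hb j hj v (h4 ▸ ht.1 b hb) hv
    exact h ⟨h3, h4⟩
  · obtain rfl := hP b hb m hm u (h4 ▸ ht.1 b hb) hu
    obtain rfl := hP a ha j hj v (h3 ▸ ht.1 a ha) hv
    exact h ⟨h4, h3⟩

open Classical in
/-- Expand a state of the merged/exploded system. -/
noncomputable def Xp (P : ι → Set V) (m j : ι) (u v : V) (w : ι → V) : ι → V :=
  if w m ∈ P m then Function.update w j v else Function.update (Function.update w j (w m)) m u

section expand

variable {G : SimpleGraph V} {I : Finset ι} {P : ι → Set V} {m j : ι} {u v : V}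

lemma expl_rest {w : ι → V} (hjm : j ≠ m) (hw : Ok G (I.erase j) (Expl G P m j u v) w)
    {i : ι} (hi : i ∈ I) (hij : i ≠ j) (him : i ≠ m) :
    w i ∈ P i ∧ ¬ G.Adj u (w i) ∧ ¬ G.Adj v (w i) := by
  have := hw.1 i (by simp [hi, hij])
  obtain ⟨h1, h2, h3⟩ := this
  exact ⟨by tauto, h2, h3⟩

lemma expl_m {w : ι → V} (hm : m ∈ I) (hjm : j ≠ m)
    (hw : Ok G (I.erase j) (Expl G P m j u v) w) :
    (w m ∈ P m ∨ w m ∈ P j) ∧ ¬ G.Adj u (w m) ∧ ¬ G.Adj v (w m) := by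
  have := hw.1 m (by simp [hm, hjm.symm])
  obtain ⟨h1, h2, h3⟩ := this
  exact ⟨by tauto, h2, h3⟩

lemma ok_left {w : ι → V} (hm : m ∈ I) (hjm : j ≠ m) (hv : v ∈ P j)
    (hw : Ok G (I.erase j) (Expl G P m j u v) w) (h : w m ∈ P m) :
    Ok G I P (Function.update w j v) := by
  refine ok_lift (fun a ha b hb haj hbj => hw.2 a (by simp [ha, haj]) b (by simp [hb, hbj])) hv
    (fun i hi hj => ?_)
  by_cases him : i = m
  · subst him; exact ⟨h, (expl_m hm hjm hw).2.2⟩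
  · have := expl_rest hjm hw hi hj him
    exact ⟨this.1, this.2.2⟩

lemma ok_right {w : ι → V} (hm : m ∈ I) (hjm : j ≠ m) (hu : u ∈ P m)
    (hw : Ok G (I.erase j) (Expl G P m j u v) w) (h : w m ∈ P j) :
    Ok G I P (Function.update (Function.update w j (w m)) m u) := by
  refine ok_lift (fun a ha b hb haj hbj => ?_) hu (fun i hi hj => ?_)
  · have hm' : m ∈ I.erase j := by simp [hm, hjm.symm]
    by_cases h1 : a = j <;> by_cases h2 : b = j
    · subst h1; subst h2; simp
    · subst h1; simpa [h2] using hw.2 m hm' b (by simp [hb, h2])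
    · subst h2; simpa [h1] using hw.2 a (by simp [ha, h1]) m hm'
    · simpa [h1, h2] using hw.2 a (by simp [ha, h1]) b (by simp [hb, h2])
  · by_cases h1 : i = j
    · subst h1; simpa using ⟨h, (expl_m hm hjm hw).2.1⟩
    · have := expl_rest hjm hw hi h1 hj
      simpa [h1] using ⟨this.1, this.2.1⟩

lemma mixed (hP : Disj I P) (hj : j ∈ I) (hm : m ∈ I) (hjm : j ≠ m) (hu : u ∈ P m) (hv : v ∈ P j)
    {w w' : ι → V}
    (h : Step G (I.erase j) (Expl G P m j u v) w w') (h1 : w m ∈ P m) (h2 : w' m ∈ P j) :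
    Reach G I P (Function.update w j v) (Function.update (Function.update w' j (w' m)) m u) := by
  obtain ⟨hw, hw', hc, hk⟩ := h
  have hm' : m ∈ I.erase j := by simp [hm, hjm.symm]
  have hne : w m ≠ w' m := fun e => hjm (hP j hj m hm (w' m) h2 (e ▸ h1))
  have hag : ∀ i ∈ I, i ≠ j → i ≠ m → w i = w' i := by
    intro i hi hij him
    by_contra hc
    exact him (hk i (by simp [hi, hij]) m hm' hc hne)
  have hz : Ok G I P (Function.update w j (w' m)) := by
    refine ok_lift (fun a ha b hb haj hbj => hw.2 a (by simp [ha, haj]) b (by simp [hb, hbj])) h2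
      (fun i hi hij => ?_)
    by_cases him : i = m
    · subst him; exact ⟨h1, fun ha => hc _ hm' ha.symm⟩
    · refine ⟨(expl_rest hjm hw hi hij him).1, ?_⟩
      rw [hag i hi hij him]
      exact hw'.2 m hm' i (by simp [hi, hij])
  have s1 : Step G I P (Function.update w j v) (Function.update w j (w' m)) := by
    refine ⟨ok_left hm hjm hv hw h1, hz, fun i hi => ?_, fun a ha b hb hna hnb => ?_⟩
    · by_cases hij : i = j
      · subst hij; simpa using (expl_m hm hjm hw').2.2
      · simp [hij]
    · have e1 : a = j := by by_contra h; simp [h] at hna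
      have e2 : b = j := by by_contra h; simp [h] at hnb
      rw [e1, e2]
  have s2 : Step G I P (Function.update w j (w' m))
      (Function.update (Function.update w' j (w' m)) m u) := by
    have key : ∀ a ∈ I, a ≠ m → Function.update w j (w' m) a =
      Function.update (Function.update w' j (w' m)) m u a := by
      intro a ha ham
      by_cases haj : a = j
      · subst haj; simp [ham]
      · simp [ham, haj, hag a ha haj ham]
    refine ⟨hz, ok_right hm hjm hu hw' h2, fun i hi => ?_, fun a ha b hb hna hnb => ?_⟩
    · by_cases him : i = m
      · subst him
        simpa [hjm.symm, G.adj_comm] using (expl_m hm hjm hw).2.1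
      · rw [key i hi him]; exact G.loopless.irrefl _
    · have e1 : a = m := by by_contra h; exact hna (key a ha h)
      have e2 : b = m := by by_contra h; exact hnb (key b hb h)
      rw [e1, e2]
  exact (Relation.ReflTransGen.single s1).tail s2

lemma Xp_left {w : ι → V} (h : w m ∈ P m) : Xp P m j u v w = Function.update w j v := by
  simp [Xp, h]

lemma Xp_right (hP : Disj I P) (hj : j ∈ I) (hm : m ∈ I) (hjm : j ≠ m)
    {w : ι → V} (h : w m ∈ P j) :
    Xp P m j u v w = Function.update (Function.update w j (w m)) m u := by
  have : w m ∉ P m := fun h' => hjm (hP j hj m hm _ h h')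
  simp [Xp, this]

lemma Xp_step (hP : Disj I P) (hj : j ∈ I) (hm : m ∈ I) (hjm : j ≠ m) (hu : u ∈ P m) (hv : v ∈ P j)
    {w w' : ι → V} (h : Step G (I.erase j) (Expl G P m j u v) w w') :
    Reach G I P (Xp P m j u v w) (Xp P m j u v w') := by
  have h0 := h
  obtain ⟨hw, hw', hc, hk⟩ := h
  have hm' : m ∈ I.erase j := by simp [hm, hjm.symm]
  rcases (expl_m hm hjm hw).1 with h1 | h1 <;> rcases (expl_m hm hjm hw').1 with h2 | h2
  · rw [Xp_left h1, Xp_left h2]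
    refine .single ⟨ok_left hm hjm hv hw h1, ok_left hm hjm hv hw' h2, fun i hi => ?_,
      fun a ha b hb hna hnb => ?_⟩
    · by_cases hij : i = j
      · subst hij; simp
      · simpa [hij] using hc i (by simp [hi, hij])
    · have haj : a ≠ j := by rintro rfl; simp at hna
      have hbj : b ≠ j := by rintro rfl; simp at hnb
      exact hk a (by simp [ha, haj]) b (by simp [hb, hbj]) (by simpa [haj] using hna)
        (by simpa [hbj] using hnb)
  · rw [Xp_left h1, Xp_right hP hj hm hjm h2]
    exact mixed hP hj hm hjm hu hv h0 h1 h2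
  · rw [Xp_left h2, Xp_right hP hj hm hjm h1]
    exact (mixed hP hj hm hjm hu hv h0.symm h2 h1).symm
  · rw [Xp_right hP hj hm hjm h1, Xp_right hP hj hm hjm h2]
    refine .single ⟨ok_right hm hjm hu hw h1, ok_right hm hjm hu hw' h2, fun i hi => ?_,
      fun a ha b hb hna hnb => ?_⟩
    · by_cases him : i = m
      · subst him; simp
      · by_cases hij : i = j
        · subst hij; simpa [him] using hc m hm'
        · simpa [him, hij] using hc i (by simp [hi, hij])
    · have ham : a ≠ m := by rintro rfl; simp at hna
      have hbm : b ≠ m := by rintro rfl; simp at hnb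
      by_cases haj : a = j <;> by_cases hbj : b = j
      · rw [haj, hbj]
      · subst haj
        exact absurd (hk m hm' b (by simp [hb, hbj]) (by simpa [ham] using hna)
          (by simpa [hbm, hbj] using hnb)).symm hbm
      · subst hbj
        exact absurd (hk a (by simp [ha, haj]) m hm' (by simpa [ham, haj] using hna)
          (by simpa [hbm] using hnb)) ham
      · exact hk a (by simp [ha, haj]) b (by simp [hb, hbj]) (by simpa [ham, haj] using hna)
          (by simpa [hbm, hbj] using hnb)

lemma Xp_reach (hP : Disj I P) (hj : j ∈ I) (hm : m ∈ I) (hjm : j ≠ m) (hu : u ∈ P m)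
    (hv : v ∈ P j) {w w' : ι → V} (h : Reach G (I.erase j) (Expl G P m j u v) w w') :
    Reach G I P (Xp P m j u v w) (Xp P m j u v w') := by
  induction h with
  | refl => exact .refl
  | tail _ h ih => exact ih.trans (Xp_step hP hj hm hjm hu hv h)

/-- A good state next to a bad one comes from a merged state. -/
lemma contract {G' : SimpleGraph V} {a t : ι → V} (hP : Disj I P) (hd : IsDel G G' u v)
    (hj : j ∈ I) (hm : m ∈ I) (hjm : j ≠ m) (hu : u ∈ P m) (hv : v ∈ P j)
    (h : Step G' I P a t) (hbad : t m = u ∧ t j = v) (hgood : ¬ (a m = u ∧ a j = v)) :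
    ∃ w, Ok G' (I.erase j) (Expl G P m j u v) w ∧ Xp P m j u v w = a ∧
      ∀ i ∈ (I.erase j).erase m, w i = t i := by
  obtain ⟨ha, ht, hc, hk⟩ := h
  obtain ⟨b1, b2⟩ := hbad
  have hrest := bad_rest hP hd hj hm hu hv ht b1 b2
  have huj : u ∉ P j := fun h => hjm (hP j hj m hm _ h hu)
  have hvm : v ∉ P m := fun h => hjm (hP j hj m hm _ hv h)
  by_cases h1 : a m = u
  · have h2 : a j ≠ v := fun h => hgood ⟨h1, h⟩
    have hag : ∀ i ∈ I, i ≠ j → a i = t i := by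
      intro i hi hij
      by_contra hne
      exact hij (hk i hi j hj hne (by rw [b2]; exact h2))
    refine ⟨Function.update a m (a j), ?_, ?_, ?_⟩
    · refine ok_lift (fun x hx y hy _ _ => ?_) ?_ (fun i hi him => ?_)
      · exact ha.2 x (Finset.mem_of_mem_erase hx) y (Finset.mem_of_mem_erase hy)
      · refine ⟨Or.inr ⟨rfl, ha.1 j hj⟩, fun hadj => ?_, fun hadj => ?_⟩
        · refine ha.2 m hm j hj ((hd _ _).2 ⟨by rwa [h1], fun h => h2 h.2, fun h => huj ?_⟩)
          rw [← h.2]; exact ha.1 j hj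
        · refine hc j hj ((hd _ _).2 ⟨by rw [b2]; exact hadj.symm, fun h => huj ?_, fun h => h2 h.1⟩)
          rw [← h.1]; exact ha.1 j hj
      · refine ⟨?_, ha.2 j hj i (Finset.mem_of_mem_erase hi)⟩
        simp only [Finset.mem_erase] at hi
        rw [hag i hi.2 hi.1]
        exact hrest.1 i (by simp [hi, him])
    · rw [Xp_right hP hj hm hjm (by simpa using ha.1 j hj)]
      funext i
      by_cases him : i = m
      · subst him; simp [h1]
      · by_cases hij : i = j
        · subst hij; simp [him]
        · simp [him, hij]
    · intro i hi
      simp only [Finset.mem_erase] at hi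
      simp [hi.1, hag i hi.2.2 hi.2.1]
  · have hag : ∀ i ∈ I, i ≠ m → a i = t i := by
      intro i hi hij
      by_contra hne
      exact hij (hk i hi m hm hne (by rw [b1]; exact h1))
    have h2 : a j = v := by rw [hag j hj hjm, b2]
    refine ⟨a, ⟨fun i hi => ?_, fun x hx y hy => ?_⟩, ?_, ?_⟩
    · by_cases him : i = m
      · subst him
        refine ⟨Or.inl (ha.1 _ hm), fun hadj => ?_, fun hadj => ?_⟩
        · refine hc i hm ((hd _ _).2 ⟨by rw [b1]; exact hadj.symm, fun h => h1 h.1, fun h => hvm ?_⟩)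
          rw [← h.1]; exact ha.1 i hm
        · refine ha.2 j hj i hm ((hd _ _).2 ⟨by rwa [h2], fun h => hvm ?_, fun h => h1 h.2⟩)
          rw [← h.2]; exact ha.1 i hm
      · simp only [Finset.mem_erase] at hi
        rw [hag i hi.2 him]
        exact hrest.1 i (by simp [hi, him])
    · exact ha.2 x (Finset.mem_of_mem_erase hx) y (Finset.mem_of_mem_erase hy)
    · rw [Xp_left (ha.1 m hm), ← h2, Function.update_eq_self]
    · intro i hi
      simp only [Finset.mem_erase] at hi
      exact hag i hi.2.2 hi.1

/-- On the exploded classes `G` and `G'` agree. -/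
lemma expl_adj {G' : SimpleGraph V} (huv : G.Adj u v) (hd : IsDel G G' u v) {i k : ι} {x y : V}
    (hx : x ∈ Expl G P m j u v i) (_hy : y ∈ Expl G P m j u v k) : G.Adj x y → G'.Adj x y := by
  intro h
  refine (hd _ _).2 ⟨h, ?_, ?_⟩
  · rintro ⟨rfl, rfl⟩; exact hx.2.2 huv.symm
  · rintro ⟨rfl, rfl⟩; exact hx.2.1 huv

end expand

/-- Existence lemma (Haxell): extend by one class after reconfiguring the rest. -/
lemma extend [Finite V] (N : ℕ) : ∀ (G : SimpleGraph V) (I : Finset ι) (P : ι → Set V) (m : ι)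
    (r : ι → V), G.edgeSet.ncard ≤ N → Disj I P → m ∈ I → Undom G I P m 2 →
    Ok G (I.erase m) P r → ∃ r', Reach G (I.erase m) P r r' ∧ Ok G I P r' := by
  induction N using Nat.strong_induction_on with
  | _ N ih =>
  intro G I P m r hN hP hm hU hr
  by_cases hE : ∃ u ∈ P m, ∃ j ∈ I, j ≠ m ∧ ∃ v ∈ P j, G.Adj u v
  · obtain ⟨u, hu, j, hj, hjm, v, hv, huv⟩ := hE
    obtain ⟨G', hd, hcard⟩ := exists_del G u v huv
    have hN' : G'.edgeSet.ncard < N := hcard.trans_le hN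
    have hsub : ∀ {a b}, G'.Adj a b → G.Adj a b := fun h => ((hd _ _).1 h).1
    have hum : ∀ i ∈ I.erase m, u ∉ P i := fun i hi h => by
      simp only [Finset.mem_erase] at hi
      exact hi.1 (hP i hi.2 m hm u h hu)
    have hrestG : ∀ i ∈ I.erase m, ∀ k ∈ I.erase m, ∀ x ∈ P i, ∀ y ∈ P k,
        G.Adj x y → G'.Adj x y := by
      intro i hi k hk x hx y hy h
      refine (hd _ _).2 ⟨h, ?_, ?_⟩
      · rintro ⟨rfl, rfl⟩; exact hum i hi hx
      · rintro ⟨rfl, rfl⟩; exact hum k hk hy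
    obtain ⟨r1, hr1, ho1⟩ := ih _ hN' G' I P m r le_rfl hP hm (hU.del hd)
      (hr.mono subset_rfl (fun _ _ _ h => h) (fun _ _ _ _ _ _ _ _ h => hsub h))
    have hr1' : Reach G (I.erase m) P r r1 :=
      hr1.mono subset_rfl (fun _ _ _ h => h) hrestG
    by_cases hbad : r1 m = u ∧ r1 j = v
    swap
    · exact ⟨r1, hr1', good_ok hP hd hj hm hu hv ho1 hbad⟩
    obtain ⟨b1, b2⟩ := hbad
    obtain ⟨r2, hr2, ho2⟩ := ih _ hN' G' (I.erase j) (Expl G P m j u v) m r1 le_rfl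
      (hP.expl hm hj) (by simp [hm, hjm.symm]) (hU.expl hd hj hjm)
      (bad_rest hP hd hj hm hu hv ho1 b1 b2)
    have hr2' : Reach G ((I.erase m).erase j) (Expl G P m j u v) r1 r2 :=
      hr2.mono (by rw [Finset.erase_right_comm]) (fun _ _ _ h => h)
        (fun _ _ _ _ _ hx _ hy h => expl_adj huv hd hx hy h)
    have ho2' : Ok G (I.erase j) (Expl G P m j u v) r2 :=
      ho2.mono subset_rfl (fun _ _ _ h => h)
        (fun _ _ _ _ _ hx _ hy h => expl_adj huv hd hx hy h)
    have hr3 := hr2'.lift (I := I.erase m) (P := P) hv (by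
      intro i hi hij x hx
      simp only [Finset.mem_erase] at hi
      obtain ⟨h1, h2, h3⟩ := hx
      exact ⟨by tauto, h3⟩)
    rw [← b2, Function.update_eq_self, b2] at hr3
    rcases (expl_m hm hjm ho2').1 with h | h
    · exact ⟨_, hr1'.trans hr3, ok_left hm hjm hv ho2' h⟩
    · refine ⟨_, (hr1'.trans hr3).tail ?_, ok_right hm hjm hu ho2' h⟩
      have key : ∀ a ∈ I.erase m, a ≠ j → Function.update r2 j v a =
          Function.update (Function.update r2 j (r2 m)) m u a := by
        intro a ha haj
        simp only [Finset.mem_erase] at ha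
        simp [ha.1, haj]
      refine ⟨?_, (ok_right hm hjm hu ho2' h).mono (Finset.erase_subset _ _) (fun _ _ _ h => h)
        (fun _ _ _ _ _ _ _ _ h => h), fun i hi => ?_, fun a ha b hb hna hnb => ?_⟩
      · refine ok_lift (fun a ha b hb haj hbj => ?_) hv (fun i hi hij => ?_)
        · exact ho2'.2 a (by simp [haj, Finset.mem_of_mem_erase ha]) b
            (by simp [hbj, Finset.mem_of_mem_erase hb])
        · simp only [Finset.mem_erase] at hi
          have := expl_rest hjm ho2' hi.2 hij hi.1
          exact ⟨this.1, this.2.2⟩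
      · by_cases hij : i = j
        · subst hij
          simpa [hjm] using (expl_m hm hjm ho2').2.2
        · rw [key i hi hij]; exact G.loopless.irrefl _
      · have e1 : a = j := by by_contra h; exact hna (key a ha h)
        have e2 : b = j := by by_contra h; exact hnb (key b hb h)
        rw [e1, e2]
  · push Not at hE
    obtain ⟨i, hi, y, hy, -⟩ := hU {m} (by simpa using hm) (by simp) ∅ (by simp)
    rw [Finset.mem_singleton] at hi
    subst hi
    have hr' : ∀ a ∈ I, a ≠ i → r a ∈ P a := fun a ha hai => hr.1 a (by simp [ha, hai])
    refine ⟨Function.update r i y, .single (hr.step fun a ha => ?_), ?_⟩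
    · simp [(Finset.mem_erase.1 ha).1]
    · refine ok_lift (fun a ha b hb hai hbi => hr.2 a (by simp [ha, hai]) b (by simp [hb, hbi])) hy
        (fun a ha hai => ⟨hr' a ha hai, hE y hy a ha hai _ (hr' a ha hai)⟩)


/-- Main lemma: reachability on the rest extends to the distinguished class. -/
lemma connect [Finite V] (N : ℕ) : ∀ (G : SimpleGraph V) (I : Finset ι) (P : ι → Set V) (m : ι)
    (r s : ι → V), G.edgeSet.ncard ≤ N → Disj I P → m ∈ I → Undom G I P m 0 →
    Ok G I P r → Ok G I P s → Reach G (I.erase m) P r s → Reach G I P r s := by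
  induction N using Nat.strong_induction_on with
  | _ N ih =>
  intro G I P m r s hN hP hm hU hr hs hrs
  by_cases hE : ∃ u ∈ P m, ∃ j ∈ I, ∃ v ∈ P j, G.Adj u v
  · obtain ⟨u, hu, j, hj, v, hv, huv⟩ := hE
    obtain ⟨G', hd, hcard⟩ := exists_del G u v huv
    have hN' : G'.edgeSet.ncard < N := hcard.trans_le hN
    have hsub : ∀ {a b}, G'.Adj a b → G.Adj a b := fun h => ((hd _ _).1 h).1
    have hpath : Reach G' I P r s := ih _ hN' G' I P m r s le_rfl hP hm (hU.del hd)
      (hr.mono subset_rfl (fun _ _ _ h => h) (fun _ _ _ _ _ _ _ _ h => hsub h))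
      (hs.mono subset_rfl (fun _ _ _ h => h) (fun _ _ _ _ _ _ _ _ h => hsub h))
      (hrs.mono subset_rfl (fun _ _ _ h => h) (fun _ _ _ _ _ _ _ _ h => hsub h))
    by_cases hjm : j = m
    · subst hjm
      -- an edge inside the distinguished class
      have hgood : ∀ t : ι → V, ¬ (t j = u ∧ t j = v) := fun t h => huv.ne (h.1.symm.trans h.2)
      have hone : ∀ a b, Step G' I P a b → Reach G I P a b := by
        intro a b hab
        obtain ⟨ha', hb', hc, hk⟩ := hab
        have ha := good_ok hP hd hj hj hu hv ha' (hgood a)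
        have hb := good_ok hP hd hj hj hu hv hb' (hgood b)
        by_cases hc' : ∀ i ∈ I, ¬ G.Adj (a i) (b i)
        · exact .single ⟨ha, hb, hc', hk⟩
        push Not at hc'
        obtain ⟨i, hi, hadj⟩ := hc'
        have h3 : (a i = u ∧ b i = v) ∨ (a i = v ∧ b i = u) := by
          have := hc i hi
          rw [hd] at this
          tauto
        have hij : i = j := by
          rcases h3 with h3 | h3
          · exact hP i hi j hj u (h3.1 ▸ ha.1 i hi) hu
          · exact hP i hi j hj u (h3.2 ▸ hb.1 i hi) hu
        subst hij
        have hag : ∀ k ∈ I, k ≠ i → a k = b k := by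
          intro k hkI hki
          by_contra hne
          exact hki (hk k hkI i hi hne hadj.ne)
        have hnb : ∀ k ∈ I, k ≠ i → ¬ G.Adj (a i) (a k) ∧ ¬ G.Adj (b i) (a k) := by
          intro k hkI hki
          refine ⟨ha.2 i hi k hkI, ?_⟩
          rw [hag k hkI hki]; exact hb.2 i hi k hkI
        have hnuv : ∀ x, ¬ G.Adj (a i) x → ¬ G.Adj (b i) x → ¬ G.Adj u x ∧ ¬ G.Adj v x := by
          intro x h1 h2
          rcases h3 with ⟨e1, e2⟩ | ⟨e1, e2⟩
          · rw [← e1, ← e2]; exact ⟨h1, h2⟩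
          · rw [← e1, ← e2]; exact ⟨h2, h1⟩
        have hnab : ∀ x, ¬ G.Adj u x → ¬ G.Adj v x → ¬ G.Adj (a i) x ∧ ¬ G.Adj (b i) x := by
          intro x h1 h2
          rcases h3 with ⟨e1, e2⟩ | ⟨e1, e2⟩
          · rw [e1, e2]; exact ⟨h1, h2⟩
          · rw [e1, e2]; exact ⟨h2, h1⟩
        have hoa : Ok G (I.erase i) (Expl G P i i u v) a := by
          refine ⟨fun k hk => ?_, fun x hx y hy =>
            ha.2 x (Finset.mem_of_mem_erase hx) y (Finset.mem_of_mem_erase hy)⟩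
          simp only [Finset.mem_erase] at hk
          have := hnb k hk.2 hk.1
          exact ⟨Or.inl (ha.1 k hk.2), hnuv _ this.1 this.2⟩
        have hsubP : ∀ k x, x ∈ Expl G P i i u v k → x ∈ P k := by
          rintro k x ⟨h | ⟨rfl, h⟩, -⟩ <;> exact h
        obtain ⟨a', hra, hoa'⟩ := extend _ G I (Expl G P i i u v) i a le_rfl
          (fun x hx y hy z hz hz' => hP x hx y hy z (hsubP _ _ hz) (hsubP _ _ hz'))
          hm hU.expl_self hoa
        have hl1 := hra.lift (I := I) (P := P) (ha.1 i hi)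
          (fun k _ _ x hx => ⟨hsubP k x hx, (hnab x hx.2.1 hx.2.2).1⟩)
        have hl2 := hra.lift (I := I) (P := P) (hb.1 i hi)
          (fun k _ _ x hx => ⟨hsubP k x hx, (hnab x hx.2.1 hx.2.2).2⟩)
        rw [Function.update_eq_self] at hl1
        have hoaP : Ok G I P a' := hoa'.mono subset_rfl (fun k _ x hx => hsubP k x hx)
          (fun _ _ _ _ _ _ _ _ h => h)
        have hswap : ∀ p, p ∈ P i → (∀ x, ¬ G.Adj u x → ¬ G.Adj v x → ¬ G.Adj p x) →
            Step G I P (Function.update a' i p) a' := by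
          intro p hp hpx
          have hpk : ∀ k ∈ I, ¬ G.Adj p (a' k) := fun k hk =>
            hpx _ (hoa'.1 k hk).2.1 (hoa'.1 k hk).2.2
          refine ⟨ok_lift (fun x hx y hy _ _ => hoaP.2 x hx y hy) hp
            (fun k hk _ => ⟨hoaP.1 k hk, hpk k hk⟩), hoaP, fun k hk => ?_,
            fun x hx y hy hnx hny => ?_⟩
          · by_cases hki : k = i
            · subst hki; simpa using hpk k hk
            · simp [hki]
          · have e1 : x = i := by by_contra h; simp [h] at hnx
            have e2 : y = i := by by_contra h; simp [h] at hny
            rw [e1, e2]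
        have s1 := hswap (a i) (ha.1 i hi) (fun x h1 h2 => (hnab x h1 h2).1)
        have s2 := hswap (b i) (hb.1 i hi) (fun x h1 h2 => (hnab x h1 h2).2)
        have s3 : Step G I P b (Function.update a i (b i)) := by
          refine hb.step fun k hk => ?_
          by_cases hki : k = i
          · subst hki; simp
          · simp [hki, hag k hk hki]
        exact ((hl1.tail s1).tail s2.symm).trans (Reach.symm (Relation.ReflTransGen.head s3 hl2))
      clear hrs
      have : ∀ t, Reach G' I P r t → Reach G I P r t := by
        intro t h
        induction h with
        | refl => exact .refl
        | tail _ h ih => exact ih.trans (hone _ _ h)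
      exact this s hpath
    · -- an edge leaving the distinguished class
      have hgood : ∀ t, Ok G I P t → ¬ (t m = u ∧ t j = v) := by
        rintro t ht ⟨h1, h2⟩
        exact ht.2 m hm j hj (by rw [h1, h2]; exact huv)
      have hcr : ∀ i ∈ I, ∀ x ∈ P i, ∀ y ∈ P i, G.Adj x y → G'.Adj x y := by
        intro i hi x hx y hy h
        refine (hd _ _).2 ⟨h, ?_, ?_⟩
        · rintro ⟨rfl, rfl⟩
          exact hjm ((hP i hi j hj _ hy hv).symm.trans (hP i hi m hm _ hx hu))
        · rintro ⟨rfl, rfl⟩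
          exact hjm ((hP i hi j hj _ hx hv).symm.trans (hP i hi m hm _ hy hu))
      have inv : ∀ t, Reach G' I P r t →
          ((¬ (t m = u ∧ t j = v) → Reach G I P r t) ∧
          ((t m = u ∧ t j = v) → ∃ w, Ok G' (I.erase j) (Expl G P m j u v) w ∧
            Reach G I P r (Xp P m j u v w) ∧
            Reach G' ((I.erase j).erase m) (Expl G P m j u v) w t)) := by
        intro t h
        induction h with
        | refl => exact ⟨fun _ => .refl, fun h => absurd h (hgood r hr)⟩
        | @tail a b hab hstep IH =>
          by_cases ha : a m = u ∧ a j = v <;> by_cases hb : b m = u ∧ b j = v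
          · refine ⟨fun h => absurd hb h, fun _ => ?_⟩
            obtain ⟨w, hw, hrw, hwa⟩ := IH.2 ha
            refine ⟨w, hw, hrw, hwa.tail ?_⟩
            refine ⟨bad_rest hP hd hj hm hu hv hstep.1 ha.1 ha.2,
              bad_rest hP hd hj hm hu hv hstep.2.1 hb.1 hb.2, fun i hi => ?_,
              fun i hi k hk => ?_⟩
            · simp only [Finset.mem_erase] at hi
              exact hstep.2.2.1 i hi.2.2
            · simp only [Finset.mem_erase] at hi hk
              exact hstep.2.2.2 i hi.2.2 k hk.2.2
          · refine ⟨fun _ => ?_, fun h => absurd h hb⟩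
            obtain ⟨w, hw, hrw, hwa⟩ := IH.2 ha
            obtain ⟨w', hw', hx, hag⟩ := contract hP hd hj hm hjm hu hv hstep.symm ha hb
            have hww : Reach G' ((I.erase j).erase m) (Expl G P m j u v) w w' :=
              hwa.tail ((bad_rest hP hd hj hm hu hv hstep.1 ha.1 ha.2).step
                fun i hi => (hag i hi).symm)
            have hfin := ih _ hN' G' (I.erase j) (Expl G P m j u v) m w w' le_rfl
              (hP.expl hm hj) (by simp [hm, Ne.symm hjm]) (hU.expl hd hj hjm) hw hw' hww
            have hfin' : Reach G (I.erase j) (Expl G P m j u v) w w' :=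
              hfin.mono subset_rfl (fun _ _ _ h => h)
                (fun _ _ _ _ _ hx _ hy h => expl_adj huv hd hx hy h)
            have := Xp_reach hP hj hm hjm hu hv hfin'
            rw [hx] at this
            exact hrw.trans this
          · refine ⟨fun h => absurd hb h, fun _ => ?_⟩
            obtain ⟨w, hw, hx, hag⟩ := contract hP hd hj hm hjm hu hv hstep hb ha
            refine ⟨w, hw, by rw [hx]; exact IH.1 ha, .single ?_⟩
            exact ((bad_rest hP hd hj hm hu hv hstep.2.1 hb.1 hb.2).step
                fun i hi => (hag i hi).symm).symm
          · refine ⟨fun _ => (IH.1 ha).tail ?_, fun h => absurd h hb⟩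
            have hoa := good_ok hP hd hj hm hu hv hstep.1 ha
            have hob := good_ok hP hd hj hm hu hv hstep.2.1 hb
            exact ⟨hoa, hob, fun i hi h => hstep.2.2.1 i hi
              (hcr i hi _ (hoa.1 i hi) _ (hob.1 i hi) h), hstep.2.2.2⟩
      exact (inv s hpath).1 (hgood s hs)
  · push Not at hE
    have hl := hrs.lift (I := I) (P := P) (hr.1 m hm) (by
      intro i hi _ x hx
      exact ⟨hx, hE _ (hr.1 m hm) i hi x hx⟩)
    rw [Function.update_eq_self] at hl
    refine hl.tail ⟨?_, hs, fun i hi => ?_, fun a ha b hb hna hnb => ?_⟩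
    · exact ok_lift (fun a ha b hb _ _ => hs.2 a ha b hb) (hr.1 m hm)
        (fun i hi _ => ⟨hs.1 i hi, hE _ (hr.1 m hm) i hi _ (hs.1 i hi)⟩)
    · by_cases him : i = m
      · subst him; simpa using hE _ (hr.1 i hm) i hi _ (hs.1 i hi)
      · simp [him]
    · have e1 : a = m := by by_contra h; simp [h] at hna
      have e2 : b = m := by by_contra h; simp [h] at hnb
      rw [e1, e2]

lemma all_connected [Finite V] (G : SimpleGraph V) (P : ι → Set V)
    (hP : ∀ i j x, x ∈ P i → x ∈ P j → i = j)
    (hU : ∀ (J : Finset ι) (m : ι), m ∈ J → ∀ D : Finset V, D.card ≤ 2 * J.card →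
      ∃ i ∈ J, ∃ y ∈ P i, ∀ z ∈ D, ¬ G.Adj z y) (I : Finset ι) :
    ∀ r s, Ok G I P r → Ok G I P s → Reach G I P r s := by
  induction I using Finset.induction_on with
  | empty =>
    intro r s hr _
    exact .single (hr.step (by simp))
  | insert m I hmI ih =>
    intro r s hr hs
    have hsub : ∀ t, Ok G (insert m I) P t → Ok G I P t := fun t ht =>
      ht.mono (Finset.subset_insert _ _) (fun _ _ _ h => h) (fun _ _ _ _ _ _ _ _ h => h)
    refine connect _ G (insert m I) P m r s le_rfl (fun i _ j _ x => hP i j x) (by simp)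
      (fun J _ hm D hD => hU J m hm D (by simpa using hD)) hr hs ?_
    rw [Finset.erase_insert hmI]
    exact ih r s (hsub r hr) (hsub s hs)

end Reconf

/-- If `G` has maximum degree `Δ` and every class of the vertex partition has size at
least `2Δ + 1`, then the reconfiguration graph on independent transversals is connected. -/
theorem stmt_1 {V : Type*} [Fintype V] [DecidableEq V]
    (G : SimpleGraph V) [DecidableRel G.Adj] (Δ n : ℕ)
    (hΔ : ∀ v, G.degree v ≤ Δ)
    (P : Fin n → Finset V)
    (hne : ∀ i, (P i).Nonempty)
    (hdisj : ∀ i j, i ≠ j → Disjoint (P i) (P j))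
    (hcover : ∀ v, ∃ i, v ∈ P i)
    (hsize : ∀ i, 2 * Δ + 1 ≤ (P i).card)
    (S T : Finset V)
    (hS : IsIndepTransversal G P S) (hT : IsIndepTransversal G P T) :
    Relation.ReflTransGen (ITAdj G P) S T := by
  classical
  have hPd : ∀ (i j : Fin n) (x : V), x ∈ ((P i : Finset V) : Set V) → x ∈ ((P j : Finset V) : Set V) →
      i = j := by
    intro i j x hi hj
    by_contra hne
    exact Finset.disjoint_left.1 (hdisj i j hne) hi hj
  have hU : ∀ (J : Finset (Fin n)) (m : Fin n), m ∈ J → ∀ D : Finset V, D.card ≤ 2 * J.card →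
      ∃ i ∈ J, ∃ y ∈ ((P i : Finset V) : Set V), ∀ z ∈ D, ¬ G.Adj z y := by
    intro J m hm D hD
    by_contra hcon
    push Not at hcon
    have h1 : J.biUnion P ⊆ D.biUnion (fun z => G.neighborFinset z) := by
      intro y hy
      obtain ⟨i, hi, hyi⟩ := Finset.mem_biUnion.1 hy
      obtain ⟨z, hz, ha⟩ := hcon i hi y hyi
      exact Finset.mem_biUnion.2 ⟨z, hz, by simpa using ha⟩
    have h2 := Finset.card_le_card h1
    rw [Finset.card_biUnion (fun i _ j _ h => hdisj i j h)] at h2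
    have h3 : J.card * (2 * Δ + 1) ≤ ∑ i ∈ J, (P i).card := by
      rw [← smul_eq_mul]
      exact Finset.card_nsmul_le_sum _ _ _ (fun i _ => hsize i)
    have h4 : (D.biUnion (fun z => G.neighborFinset z)).card ≤ D.card * Δ :=
      Finset.card_biUnion_le_card_mul _ _ _ (fun z _ => by simpa using hΔ z)
    have h5 : D.card * Δ ≤ 2 * J.card * Δ := Nat.mul_le_mul_right _ hD
    have h6 : 0 < J.card := Finset.card_pos.2 ⟨m, hm⟩
    nlinarith
  have hrep : ∀ S, IsIndepTransversal G P S → ∃ r : Fin n → V,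
      Reconf.Ok G Finset.univ (fun i => ((P i : Finset V) : Set V)) r ∧
      Finset.univ.image r = S := by
    intro S hS
    have : ∀ i, ∃ x, S ∩ P i = {x} := fun i => Finset.card_eq_one.1 (hS.2 i)
    choose r hr using this
    have hm : ∀ i, r i ∈ S ∧ r i ∈ P i := fun i => by
      rw [← Finset.mem_inter, hr i]; simp
    refine ⟨r, ⟨fun i _ => (hm i).2, fun i _ j _ => hS.1 _ (hm i).1 _ (hm j).1⟩, ?_⟩
    ext x
    simp only [Finset.mem_image, Finset.mem_univ, true_and]
    constructor
    · rintro ⟨i, rfl⟩; exact (hm i).1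
    · intro hx
      obtain ⟨i, hi⟩ := hcover x
      have : x ∈ S ∩ P i := by simp [hx, hi]
      rw [hr i, Finset.mem_singleton] at this
      exact ⟨i, this.symm⟩
  have hback : ∀ r : Fin n → V,
      Reconf.Ok G Finset.univ (fun i => ((P i : Finset V) : Set V)) r →
      IsIndepTransversal G P (Finset.univ.image r) := by
    intro r hr
    refine ⟨?_, fun i => ?_⟩
    · intro a ha b hb
      obtain ⟨i, -, rfl⟩ := Finset.mem_image.1 ha
      obtain ⟨j, -, rfl⟩ := Finset.mem_image.1 hb
      exact hr.2 i (by simp) j (by simp)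
    · rw [Finset.card_eq_one]
      refine ⟨r i, ?_⟩
      ext x
      simp only [Finset.mem_inter, Finset.mem_image, Finset.mem_univ, true_and,
        Finset.mem_singleton]
      constructor
      · rintro ⟨⟨k, rfl⟩, hk⟩
        rw [hPd k i (r k) (hr.1 k (by simp)) hk]
      · rintro rfl
        exact ⟨⟨i, rfl⟩, hr.1 i (by simp)⟩
  have hstep : ∀ r s : Fin n → V,
      Reconf.Step G Finset.univ (fun i => ((P i : Finset V) : Set V)) r s →
      Relation.ReflTransGen (ITAdj G P) (Finset.univ.image r) (Finset.univ.image s) := by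
    intro r s h
    obtain ⟨hr, hs, hc, hk⟩ := h
    by_cases hrs : r = s
    · rw [hrs]
    obtain ⟨k, hkne⟩ := Function.ne_iff.1 hrs
    have hag : ∀ i, i ≠ k → s i = r i := by
      intro i hik
      by_contra hne
      exact hik (hk i (by simp) k (by simp) (Ne.symm hne) hkne)
    have hcross : ∀ i j, ¬ G.Adj (r i) (s j) := by
      intro i j
      by_cases hj : j = k
      · by_cases hi : i = k
        · rw [hi, hj]; exact hc k (by simp)
        · rw [← hag i hi]; exact hs.2 i (by simp) j (by simp)
      · rw [hag j hj]; exact hr.2 i (by simp) j (by simp)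
    have hunion : Finset.univ.image r ∪ Finset.univ.image s = insert (s k) (Finset.univ.image r) := by
      ext x
      simp only [Finset.mem_union, Finset.mem_image, Finset.mem_univ, true_and, Finset.mem_insert]
      constructor
      · rintro (h | ⟨i, rfl⟩)
        · exact Or.inr h
        · by_cases hi : i = k
          · rw [hi]; exact Or.inl rfl
          · exact Or.inr ⟨i, (hag i hi).symm⟩
      · rintro (rfl | h)
        · exact Or.inr ⟨k, rfl⟩
        · exact Or.inl h
    refine .single ⟨hback r hr, hback s hs, ?_, ?_⟩
    · intro a ha b hb
      simp only [Finset.mem_union, Finset.mem_image, Finset.mem_univ, true_and] at ha hb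
      rcases ha with ⟨i, rfl⟩ | ⟨i, rfl⟩ <;> rcases hb with ⟨j, rfl⟩ | ⟨j, rfl⟩
      · exact hr.2 i (by simp) j (by simp)
      · exact hcross i j
      · exact fun h => hcross j i h.symm
      · exact hs.2 i (by simp) j (by simp)
    · rw [hunion, Finset.card_insert_of_notMem, Finset.card_image_of_injective]
      · simp
      · intro i j hij
        exact hPd i j (r i) (hr.1 i (by simp)) (by rw [hij]; exact hr.1 j (by simp))
      · simp only [Finset.mem_image, Finset.mem_univ, true_and, not_exists]
        intro i hi
        have : i = k := hPd i k (r i) (hr.1 i (by simp)) (by rw [hi]; exact hs.1 k (by simp))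
        exact hkne (this ▸ hi)
  obtain ⟨r, hr, rfl⟩ := hrep S hS
  obtain ⟨s, hs, rfl⟩ := hrep T hT
  have hreach := Reconf.all_connected G (fun i => ((P i : Finset V) : Set V)) hPd hU Finset.univ
    r s hr hs
  clear hT hS hs
  induction hreach with
  | refl => exact .refl
  | tail _ h ih => exact ih.trans (hstep _ _ h)
end

section
/- Let X be a finite set of points in ℝ^d and let r ≥ 1 be an integer. If |X| ≥ (d+1)(r−1) + 2, then the reconfiguration graph RG_Tv(X, r) is connected: any two ordered Tverberg r-partitions of X are linked by a finite sequence of ordered Tverberg r-partitions of X in which consecutive ones are adjacent. -/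
/-- `P` is an ordered Tverberg `r`-partition of the finite point set `X ⊆ ℝ^d`:
an ordered partition of `X` into `r` parts whose convex hulls have a common point. -/
def IsTverbergPartition {d : ℕ} (X : Finset (Fin d → ℝ)) (r : ℕ)
    (P : Fin r → Finset (Fin d → ℝ)) : Prop :=
  (∀ i j, i ≠ j → Disjoint (P i) (P j)) ∧
  (Finset.univ.biUnion P = X) ∧
  (⋂ i, convexHull ℝ ((P i : Set (Fin d → ℝ)))).Nonempty

/-- Adjacency in the reconfiguration graph `RG_Tv(X, r)`: two ordered Tverberg
`r`-partitions are adjacent if they differ by moving a single point `x` from one part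
to another, and removing `x` altogether yields an ordered Tverberg `r`-partition of
`X - {x}`. -/
def TvAdj {d : ℕ} (X : Finset (Fin d → ℝ)) (r : ℕ)
    (P Q : Fin r → Finset (Fin d → ℝ)) : Prop :=
  IsTverbergPartition X r P ∧ IsTverbergPartition X r Q ∧
  ∃ x ∈ X, ∃ i j : Fin r, i ≠ j ∧ x ∈ P i ∧
    Q i = (P i).erase x ∧ Q j = insert x (P j) ∧
    (∀ k, k ≠ i → k ≠ j → Q k = P k) ∧
    (⋂ k, convexHull ℝ ((((P k).erase x) : Finset (Fin d → ℝ)) : Set (Fin d → ℝ))).Nonempty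

set_option linter.unusedSectionVars false


section Conic

open Module

variable {V : Type*} [NormedAddCommGroup V] [NormedSpace ℝ V] [FiniteDimensional ℝ V]
variable {ι κ : Type*} [Fintype ι] [DecidableEq ι] [Fintype κ]

/-- `b` is a combination of the chosen vectors, supported on `C`, with coefficients that are
nonnegative off the free set `F`. -/
def TvRep (v : ι → κ → V) (F C : Finset ι) (f : ι → κ) (b : V) : Prop :=
  ∃ l : ι → ℝ, (∀ i, i ∉ F → 0 ≤ l i) ∧ (∀ i, i ∉ C → l i = 0) ∧ ∑ i, l i • v i (f i) = b

/-- As `TvRep`, with support exactly `E` off `F`. -/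
def TvPos (v : ι → κ → V) (F E : Finset ι) (f : ι → κ) (b : V) : Prop :=
  ∃ l : ι → ℝ, (∀ i ∈ E, i ∉ F → 0 < l i) ∧ (∀ i, i ∉ E → l i = 0) ∧ ∑ i, l i • v i (f i) = b

/-- Any transversal of at most `dim V` vectors is independent. -/
def TvGen (v : ι → κ → V) : Prop :=
  ∀ f : ι → κ, ∀ E : Finset ι, E.card ≤ finrank ℝ V → ∀ l : ι → ℝ, (∀ i, i ∉ E → l i = 0) →
    ∑ i, l i • v i (f i) = 0 → l = 0

lemma tv_lift {α β : Type*} {q : α → α → Prop} {p : β → β → Prop} (f : α → β)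
    (h : ∀ a b, q a b → p (f a) (f b)) {a b : α} (hab : Relation.ReflTransGen q a b) :
    Relation.ReflTransGen p (f a) (f b) :=
  Relation.ReflTransGen.lift f h _ _ hab

lemma tv_dep (w : ι → V) (E : Finset ι) (hE : finrank ℝ V < E.card) :
    ∃ m : ι → ℝ, (∀ i, i ∉ E → m i = 0) ∧ ∑ i, m i • w i = 0 ∧ m ≠ 0 := by
  have h : ¬ LinearIndependent ℝ (fun i : E => w i) := by
    intro h
    have := h.fintype_card_le_finrank
    simp at this
    omega
  rw [Fintype.not_linearIndependent_iff] at h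
  obtain ⟨g, hg, i, hi⟩ := h
  refine ⟨fun i => if h : i ∈ E then g ⟨i, h⟩ else 0, ?_, ?_, ?_⟩
  · intro i hi; simp [hi]
  · rw [← hg, ← Finset.sum_subset (Finset.subset_univ E), ← Finset.sum_attach]
    · apply Finset.sum_congr rfl
      intro x _
      simp
    · intro x _ hx
      simp [hx]
  · intro h0
    have := congrFun h0 i.1
    simp at this
    exact hi this

lemma tv_red (F : Finset ι) (l m : ι → ℝ) (hl : ∀ i, i ∉ F → 0 ≤ l i)
    (hm : ∃ i, i ∉ F ∧ 0 < m i) :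
    ∃ t : ℝ, (∀ i, i ∉ F → 0 ≤ l i - t * m i) ∧ ∃ i, i ∉ F ∧ 0 < m i ∧ l i - t * m i = 0 := by
  classical
  obtain ⟨i0, hi0⟩ := hm
  obtain ⟨j, hj, hmin⟩ := Finset.exists_min_image
    (Finset.univ.filter (fun i => i ∉ F ∧ 0 < m i)) (fun i => l i / m i) ⟨i0, by simp [hi0]⟩
  simp only [Finset.mem_filter, Finset.mem_univ, true_and] at hj hmin
  refine ⟨l j / m j, ?_, j, hj.1, hj.2, ?_⟩
  · intro i hi
    have h0 : 0 ≤ l j / m j := div_nonneg (hl j hj.1) hj.2.le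
    rcases le_or_gt (m i) 0 with h | h
    · have := mul_nonneg h0 (neg_nonneg.2 h)
      have := hl i hi
      linarith
    · have h1 := hmin i ⟨hi, h⟩
      rw [le_div_iff₀ h] at h1
      linarith
  · have := hj.2.ne'
    field_simp
    ring

variable {v : ι → κ → V}

lemma TvRep.mono {F C C' : Finset ι} {f : ι → κ} {b : V} (h : TvRep v F C f b) (hC : C ⊆ C') :
    TvRep v F C' f b := by
  obtain ⟨l, h1, h2, h3⟩ := h
  exact ⟨l, h1, fun i hi => h2 i (fun h => hi (hC h)), h3⟩

lemma TvRep.congr {F C : Finset ι} {f g : ι → κ} {b : V} (h : TvRep v F C f b)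
    (hC : ∀ i ∈ C, f i = g i) : TvRep v F C g b := by
  obtain ⟨l, h1, h2, h3⟩ := h
  refine ⟨l, h1, h2, ?_⟩
  rw [← h3]
  apply Finset.sum_congr rfl
  intro i _
  by_cases hi : i ∈ C
  · rw [hC i hi]
  · simp [h2 i hi]

lemma TvPos.congr {F C : Finset ι} {f g : ι → κ} {b : V} (h : TvPos v F C f b)
    (hC : ∀ i ∈ C, f i = g i) : TvPos v F C g b := by
  obtain ⟨l, h1, h2, h3⟩ := h
  refine ⟨l, h1, h2, ?_⟩
  rw [← h3]
  apply Finset.sum_congr rfl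
  intro i _
  by_cases hi : i ∈ C
  · rw [hC i hi]
  · simp [h2 i hi]

lemma TvPos.rep {F C : Finset ι} {f : ι → κ} {b : V} (h : TvPos v F C f b) :
    TvRep v F C f b := by
  obtain ⟨l, h1, h2, h3⟩ := h
  refine ⟨l, ?_, h2, h3⟩
  intro i hi
  by_cases hC : i ∈ C
  · exact (h1 i hC hi).le
  · rw [h2 i hC]

lemma tv_carath (hgen : TvGen v) {F C : Finset ι} (hFC : F ⊆ C) (hF : F.card ≤ finrank ℝ V)
    {f : ι → κ} {b : V} (h : TvRep v F C f b) :
    ∃ E, F ⊆ E ∧ E ⊆ C ∧ E.card ≤ finrank ℝ V ∧ TvPos v F E f b := by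
  classical
  obtain ⟨l, h1, h2, h3⟩ := h
  obtain ⟨n, hn⟩ : ∃ n, n = (Finset.univ.filter (fun i => i ∉ F ∧ l i ≠ 0)).card := ⟨_, rfl⟩
  induction n using Nat.strong_induction_on generalizing l with
  | _ n ih =>
  set S := Finset.univ.filter (fun i => i ∉ F ∧ l i ≠ 0) with hS
  by_cases hc : (F ∪ S).card ≤ finrank ℝ V
  · refine ⟨F ∪ S, Finset.subset_union_left, ?_, hc, l, ?_, ?_, h3⟩
    · apply Finset.union_subset hFC
      intro i hi
      simp [hS] at hi
      by_contra hiC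
      exact hi.2 (h2 i hiC)
    · intro i hi hiF
      simp [hS, hiF] at hi
      exact lt_of_le_of_ne (h1 i hiF) (Ne.symm hi)
    · intro i hi
      simp only [Finset.mem_union, not_or] at hi
      by_contra h0
      exact hi.2 (by simp [hS, hi.1, h0])
  · push Not at hc
    obtain ⟨m, hm1, hm2, hm3⟩ := tv_dep (fun i => v i (f i)) (F ∪ S) hc
    have hex : ∃ i, i ∉ F ∧ m i ≠ 0 := by
      by_contra hno
      push Not at hno
      exact hm3 (hgen f F hF m hno hm2)
    have key : ∀ m : ι → ℝ, (∀ i, i ∉ F ∪ S → m i = 0) → ∑ i, m i • v i (f i) = 0 →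
        (∃ i, i ∉ F ∧ 0 < m i) →
        ∃ E, F ⊆ E ∧ E ⊆ C ∧ E.card ≤ finrank ℝ V ∧ TvPos v F E f b := by
      intro m hm1 hm2 hex
      obtain ⟨t, ht1, j, hj1, hj2, hj3⟩ := tv_red F l m h1 hex
      have hz : ∀ i, i ∉ F → l i = 0 → m i = 0 := by
        intro i hi h0
        apply hm1
        simp [hS, hi, h0]
      refine ih _ ?_ (fun i => l i - t * m i) ht1 ?_ ?_ rfl
      · rw [hn]
        apply Finset.card_lt_card
        rw [Finset.ssubset_iff_of_subset]
        · refine ⟨j, ?_, ?_⟩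
          · simp only [hS, Finset.mem_filter, Finset.mem_univ, true_and]
            exact ⟨hj1, fun h0 => hj2.ne' (hz j hj1 h0)⟩
          · simp [hj3]
        · intro i hi
          simp only [hS, Finset.mem_filter, Finset.mem_univ, true_and] at hi ⊢
          refine ⟨hi.1, fun h0 => hi.2 ?_⟩
          rw [h0, hz i hi.1 h0]; simp
      · intro i hi
        have hiF : i ∉ F := fun h => hi (hFC h)
        rw [h2 i hi, hz i hiF (h2 i hi)]; simp
      · simp only [sub_smul, Finset.sum_sub_distrib, mul_smul, ← Finset.smul_sum, hm2, h3]
        simp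
    obtain ⟨i, hiF, hi⟩ := hex
    rcases lt_or_gt_of_ne hi with h | h
    · refine key (fun i => - m i) (fun i hi => by simp [hm1 i hi]) ?_ ⟨i, hiF, by simpa using h⟩
      simp [hm2]
    · exact key m hm1 hm2 ⟨i, hiF, h⟩

lemma tv_indep (hgen : TvGen v) (f : ι → κ) (E : Finset ι) (hE : E.card ≤ finrank ℝ V) :
    LinearIndependent ℝ (fun i : E => v i (f i)) := by
  classical
  rw [Fintype.linearIndependent_iff]
  intro g hg i
  have := hgen f E hE (fun i => if h : i ∈ E then g ⟨i, h⟩ else 0) (fun i hi => by simp [hi]) ?_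
  · have := congrFun this i.1
    simpa using this
  · rw [← hg, ← Finset.sum_subset (Finset.subset_univ E), ← Finset.sum_attach]
    · apply Finset.sum_congr rfl
      intro x _
      simp
    · intro x _ hx
      simp [hx]

lemma tv_rep_of_sub (F E : Finset ι) (f : ι → κ) (b : V) (g : E → ℝ)
    (h0 : ∀ i : E, i.1 ∉ F → 0 ≤ g i) (hg : ∑ i : E, g i • v i (f i) = b) : TvRep v F E f b := by
  classical
  refine ⟨fun i => if h : i ∈ E then g ⟨i, h⟩ else 0, ?_, ?_, ?_⟩
  · intro i hi
    by_cases h : i ∈ E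
    · simpa [h] using h0 ⟨i, h⟩ hi
    · simp [h]
  · intro i hi; simp [hi]
  · rw [← hg, ← Finset.sum_subset (Finset.subset_univ E), ← Finset.sum_attach]
    · apply Finset.sum_congr rfl
      intro x _
      simp
    · intro x _ hx
      simp [hx]

lemma tv_span (hgen : TvGen v) (f : ι → κ) (E : Finset ι) (hE : finrank ℝ V ≤ E.card) (s : V) :
    TvRep v E E f s := by
  obtain ⟨E', hE', hc⟩ := Finset.exists_subset_card_eq hE
  have hi := tv_indep hgen f E' hc.le
  have hs := hi.span_eq_top_of_card_eq_finrank' (by simp [hc])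
  have : s ∈ Submodule.span ℝ (Set.range (fun i : E' => v i (f i))) := by rw [hs]; trivial
  rw [Submodule.mem_span_range_iff_exists_fun] at this
  obtain ⟨c, hc⟩ := this
  exact (tv_rep_of_sub E E' f s c (fun i hi => absurd (hE' i.2) hi) hc).mono hE'

lemma tv_closed (hgen : TvGen v) {F C : Finset ι} (hFC : F ⊆ C) (hF : F.card ≤ finrank ℝ V)
    (f : ι → κ) : IsClosed {b | TvRep v F C f b} := by
  classical
  have heq : {b | TvRep v F C f b} = ⋃ E ∈ {E : Finset ι | E ⊆ C ∧ E.card ≤ finrank ℝ V},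
      {b | TvRep v F E f b} := by
    ext b
    simp only [Set.mem_ofPred_eq, Set.mem_iUnion, exists_prop]
    constructor
    · intro h
      obtain ⟨E, h1, h2, h3, h4⟩ := tv_carath hgen hFC hF h
      exact ⟨E, ⟨h2, h3⟩, h4.rep⟩
    · rintro ⟨E, ⟨h1, h2⟩, h3⟩
      exact h3.mono h1
  rw [heq]
  apply Set.Finite.isClosed_biUnion (Set.toFinite _)
  rintro E ⟨-, hE⟩
  have hi := tv_indep hgen f E hE
  set L := Fintype.linearCombination ℝ (fun i : E => v i (f i)) with hL
  have hker : LinearMap.ker L = ⊥ := by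
    rw [LinearMap.ker_eq_bot']
    intro g hg
    funext i
    exact Fintype.linearIndependent_iff.1 hi g (by rwa [hL, Fintype.linearCombination_apply] at hg) i
  have hce := LinearMap.isClosedEmbedding_of_injective hker
  have : {b | TvRep v F E f b} = L '' {g | ∀ i : E, i.1 ∉ F → 0 ≤ g i} := by
    ext b
    constructor
    · rintro ⟨l, h1, h2, h3⟩
      refine ⟨fun i => l i, fun i hi => h1 _ hi, ?_⟩
      rw [hL, Fintype.linearCombination_apply, ← h3, ← Finset.sum_subset (Finset.subset_univ E),
        ← Finset.sum_attach E]
      · rfl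
      · intro x _ hx
        simp [h2 x hx]
    · rintro ⟨g, hg, rfl⟩
      exact tv_rep_of_sub F E f _ g hg (by rw [hL, Fintype.linearCombination_apply])
  rw [this]
  apply hce.isClosedMap
  simp only [Set.ofPred_forall]
  refine isClosed_iInter fun i => isClosed_iInter fun _ => ?_
  exact isClosed_le continuous_const (continuous_apply i)

open Filter Topology in
lemma tv_small {F E C : Finset ι} {f : ι → κ} {b s : V} (hb : TvPos v F E f b)
    (hs : TvRep v E C f s) (hEC : E ⊆ C) :
    ∀ᶠ ε : ℝ in 𝓝[>] 0, TvRep v F C f (b + ε • s) := by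
  obtain ⟨l, h1, h2, h3⟩ := hb
  obtain ⟨m, m1, m2, m3⟩ := hs
  have : ∀ᶠ ε : ℝ in 𝓝[>] 0, ∀ i, i ∉ F → 0 ≤ l i + ε * m i := by
    rw [eventually_all]
    intro i
    by_cases hi : i ∈ F
    · simp [hi]
    by_cases hE : i ∈ E
    · have ht : Tendsto (fun ε : ℝ => l i + ε * m i) (𝓝[>] 0) (𝓝 (l i + 0 * m i)) := by
        apply Tendsto.mono_left _ nhdsWithin_le_nhds
        exact (Continuous.tendsto (by fun_prop) 0)
      have := ht.eventually (lt_mem_nhds (a := 0) (by simpa using h1 i hE hi))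
      filter_upwards [this] with ε h _ using h.le
    · filter_upwards [self_mem_nhdsWithin] with ε h _
      rw [h2 i hE]
      have := mul_nonneg (le_of_lt h) (m1 i hE)
      linarith
  filter_upwards [this] with ε h
  refine ⟨fun i => l i + ε * m i, h, ?_, ?_⟩
  · intro i hi
    simp only [h2 i (fun h => hi (hEC h)), m2 i hi]; simp
  · simp only [add_smul, Finset.sum_add_distrib, mul_smul, ← Finset.smul_sum, h3, m3]

open Filter Topology in
lemma tv_limit (hgen : TvGen v) {F C : Finset ι} (hFC : F ⊆ C) (hF : F.card ≤ finrank ℝ V)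
    (f : ι → κ) (b s : V) :
    ∀ᶠ ε : ℝ in 𝓝[>] 0, TvRep v F C f (b + ε • s) → TvRep v F C f b := by
  by_cases h : TvRep v F C f b
  · simp [h]
  · have ho := (tv_closed hgen hFC hF f).isOpen_compl.mem_nhds (x := b) h
    have ht : Tendsto (fun ε : ℝ => b + ε • s) (𝓝[>] 0) (𝓝 b) := by
      apply Tendsto.mono_left _ nhdsWithin_le_nhds
      have : Continuous (fun ε : ℝ => b + ε • s) := by fun_prop
      simpa using this.tendsto 0
    filter_upwards [ht.eventually ho] with ε h1 h2
    exact absurd h2 h1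

lemma tv_uniq (hgen : TvGen v) {F E E' : Finset ι} {f : ι → κ} {b : V} (hE : TvPos v F E f b)
    (hE' : TvPos v F E' f b) (hF : F ⊆ E) (hF' : F ⊆ E') (hc : (E ∪ E').card ≤ finrank ℝ V) :
    E = E' := by
  obtain ⟨l, h1, h2, h3⟩ := hE
  obtain ⟨m, m1, m2, m3⟩ := hE'
  have h := hgen f (E ∪ E') hc (fun i => l i - m i) ?_ ?_
  · have h' : ∀ i, l i = m i := fun i => by
      have := congrFun h i
      simp at this
      linarith
    ext i
    by_cases hi : i ∈ F
    · simp [hF hi, hF' hi]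
    constructor
    · intro hiE
      by_contra hn
      have := h1 i hiE hi
      rw [h', m2 i hn] at this
      exact lt_irrefl _ this
    · intro hiE
      by_contra hn
      have := m1 i hiE hi
      rw [← h', h2 i hn] at this
      exact lt_irrefl _ this
  · intro i hi
    simp only [Finset.mem_union, not_or] at hi
    simp [h2 i hi.1, m2 i hi.2]
  · simp [sub_smul, Finset.sum_sub_distrib, h3, m3]

lemma tv_pos_union {F E E' : Finset ι} {f : ι → κ} {b : V} (hE : TvPos v F E f b)
    (hE' : TvPos v F E' f b) : TvPos v F (E ∪ E') f b := by
  have r1 := hE.rep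
  obtain ⟨l, h1, h2, h3⟩ := hE
  obtain ⟨m, m1, m2, m3⟩ := hE'
  have hl : ∀ i, i ∉ F → 0 ≤ l i := fun i hi => by
    by_cases h : i ∈ E
    · exact (h1 i h hi).le
    · rw [h2 i h]
  have hm : ∀ i, i ∉ F → 0 ≤ m i := fun i hi => by
    by_cases h : i ∈ E'
    · exact (m1 i h hi).le
    · rw [m2 i h]
  refine ⟨fun i => (1/2) * (l i + m i), ?_, ?_, ?_⟩
  · intro i hi hF
    rcases Finset.mem_union.1 hi with h | h
    · have := h1 i h hF
      have := hm i hF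
      linarith
    · have := m1 i h hF
      have := hl i hF
      linarith
  · intro i hi
    simp only [Finset.mem_union, not_or] at hi
    simp [h2 i hi.1, m2 i hi.2]
  · simp only [mul_smul, ← Finset.smul_sum, add_smul, Finset.sum_add_distrib, h3, m3]
    rw [← two_smul ℝ b, smul_smul]; norm_num

open Filter Topology in
lemma tv_real_ind (p : ℝ → Prop) (h0 : p 0)
    (hr : ∀ t, 0 ≤ t → t < 1 → p t → ∀ᶠ ε : ℝ in 𝓝[>] 0, p (t + ε))
    (hl : ∀ t, 0 < t → t ≤ 1 → ∀ᶠ ε : ℝ in 𝓝[>] 0, p (t - ε) → p t) : p 1 := by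
  set S : Set ℝ := {t | 0 ≤ t ∧ t ≤ 1 ∧ ∀ u, 0 ≤ u → u ≤ t → p u} with hS
  have h0S : (0 : ℝ) ∈ S := ⟨le_rfl, zero_le_one, fun u h1 h2 => by
    have : u = 0 := le_antisymm h2 h1
    rwa [this]⟩
  have hbdd : BddAbove S := ⟨1, fun t ht => ht.2.1⟩
  set c := sSup S with hc
  have hc0 : 0 ≤ c := le_csSup hbdd h0S
  have hc1 : c ≤ 1 := csSup_le ⟨0, h0S⟩ (fun t ht => ht.2.1)
  have hlt : ∀ u, 0 ≤ u → u < c → p u := by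
    intro u hu huc
    obtain ⟨t, ht, hut⟩ := exists_lt_of_lt_csSup ⟨0, h0S⟩ huc
    exact ht.2.2 u hu hut.le
  have hpc : p c := by
    rcases hc0.eq_or_lt with h | h
    · rwa [← h]
    · obtain ⟨ε, h1, h2⟩ := ((hl c h hc1).and (Ioo_mem_nhdsGT h)).exists
      exact h1 (hlt _ (by linarith [h2.2]) (by linarith [h2.1]))
  rcases hc1.eq_or_lt with h | h
  · rwa [← h]
  · exfalso
    have h1 := hr c hc0 h hpc
    rw [Filter.Eventually, mem_nhdsGT_iff_exists_Ioo_subset] at h1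
    obtain ⟨δ, hδ, hsub⟩ := h1
    have hδ' : (0 : ℝ) < δ := hδ
    set e := min (δ / 2) (1 - c) with he
    have he0 : 0 < e := lt_min (by linarith) (by linarith)
    have he1 : e ≤ δ / 2 := min_le_left _ _
    have he2 : e ≤ 1 - c := min_le_right _ _
    have : c + e ∈ S := by
      refine ⟨by linarith, by linarith, ?_⟩
      intro u hu1 hu2
      rcases lt_trichotomy u c with h | h | h
      · exact hlt u hu1 h
      · rwa [h]
      · have := hsub (show u - c ∈ Set.Ioo 0 δ from ⟨by linarith, by linarith⟩)
        simpa using this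
    have := le_csSup hbdd this
    linarith

/-- The span of the free part. -/
def tvSub (v : ι → κ → V) (F : Finset ι) (f : ι → κ) : Submodule ℝ V where
  carrier := {b | TvRep v F F f b}
  add_mem' := by
    rintro a b ⟨l, h1, h2, h3⟩ ⟨m, m1, m2, m3⟩
    refine ⟨fun i => if i ∈ F then l i + m i else 0, ?_, ?_, ?_⟩
    · intro i hi; simp [hi]
    · intro i hi; simp [hi]
    · rw [← h3, ← m3, ← Finset.sum_add_distrib]
      apply Finset.sum_congr rfl
      intro i _
      by_cases hi : i ∈ F
      · simp [hi, add_smul]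
      · simp [hi, h2 i hi, m2 i hi]
  zero_mem' := ⟨0, by simp⟩
  smul_mem' := by
    rintro c b ⟨l, h1, h2, h3⟩
    refine ⟨fun i => c * l i, ?_, ?_, ?_⟩
    · intro i hi; simp [h2 i hi]
    · intro i hi; simp [h2 i hi]
    · simp only [mul_smul, ← Finset.smul_sum, h3]

lemma tv_pick [Nonempty κ] (hgen : TvGen v) (hsum : ∀ i, ∑ k, v i k = 0) {F : Finset ι}
    (hF : F.card < finrank ℝ V) (f0 : ι → κ) (b : V) (hb : ¬ TvRep v F F f0 b) (y : ι)
    (hy : y ∉ F) :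
    ∃ k, ∀ t : ℝ, 0 ≤ t → t ≤ 1 → ¬ TvRep v F F f0 (v y k + t • (b - v y k)) := by
  by_contra hcon
  push Not at hcon
  have hx : ∀ k, v y k ∉ tvSub v F f0 := by
    rintro k ⟨l, h1, h2, h3⟩
    have := hgen (Function.update f0 y k) (insert y F)
      (by rw [Finset.card_insert_of_notMem hy]; omega) (fun i => l i - (if i = y then 1 else 0)) ?_ ?_
    · have := congrFun this y
      simp [h2 y hy] at this
    · intro i hi
      simp only [Finset.mem_insert, not_or] at hi
      simp [hi.1, h2 i hi.2]
    · simp only [sub_smul, Finset.sum_sub_distrib, ite_smul, one_smul, zero_smul,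
        Finset.sum_ite_eq', Finset.mem_univ, if_true, Function.update_self]
      rw [sub_eq_zero, ← h3]
      apply Finset.sum_congr rfl
      intro i _
      by_cases hi : i = y
      · subst hi; simp [h2 i hy]
      · rw [Function.update_of_ne hi]
  have hb' : b ∉ tvSub v F f0 := hb
  have hc : ∀ k, ∃ c : ℝ, 0 ≤ c ∧ v y k + c • b ∈ tvSub v F f0 := by
    intro k
    obtain ⟨t, h0, h1, h2⟩ := hcon k
    have h2' : v y k + t • (b - v y k) ∈ tvSub v F f0 := h2
    rcases h1.eq_or_lt with h | h
    · subst h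
      simp at h2'
      exact absurd h2' hb'
    · refine ⟨t / (1 - t), div_nonneg h0 (by linarith), ?_⟩
      have := (tvSub v F f0).smul_mem (1 - t)⁻¹ h2'
      convert this using 1
      have h3 : (1 - t) ≠ 0 := by linarith
      have h4 : v y k + t • (b - v y k) = (1 - t) • v y k + t • b := by module
      rw [h4, smul_add, smul_smul, inv_mul_cancel₀ h3, smul_smul, one_smul, div_eq_inv_mul]
  choose c hc0 hc1 using hc
  have hs := Submodule.sum_mem (tvSub v F f0) (t := Finset.univ) (fun k _ => hc1 k)
  rw [Finset.sum_add_distrib, hsum, zero_add, ← Finset.sum_smul] at hs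
  by_cases h0 : ∑ k, c k = 0
  · rw [Finset.sum_eq_zero_iff_of_nonneg (fun k _ => hc0 k)] at h0
    obtain ⟨k⟩ := ‹Nonempty κ›
    have := hc1 k
    rw [h0 k (Finset.mem_univ k)] at this
    simp at this
    exact hx k this
  · exact hb' (((tvSub v F f0).smul_mem_iff h0).1 hs)

lemma tv_single {F C : Finset ι} (f : ι → κ) {y : ι} (hy : y ∈ C) : TvRep v F C f (v y (f y)) := by
  refine ⟨fun i => if i = y then 1 else 0, ?_, ?_, ?_⟩
  · intro i _
    dsimp only
    split_ifs <;> norm_num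
  · intro i hi
    have : i ≠ y := fun h => hi (h ▸ hy)
    simp [this]
  · simp

open Filter Topology in
lemma tv_exists [Nonempty κ] (hgen : TvGen v) (hsum : ∀ i, ∑ k, v i k = 0) (C : Finset ι)
    (hC : finrank ℝ V ≤ C.card) (n : ℕ) : ∀ (F : Finset ι) (_ : finrank ℝ V - F.card = n)
    (_ : F.card ≤ finrank ℝ V) (_ : F ⊆ C) (f0 : ι → κ) (b : V),
    ∃ f, (∀ i ∈ F, f i = f0 i) ∧ TvRep v F C f b := by
  induction n using Nat.strong_induction_on with
  | _ n ih =>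
  intro F hn hF hFC f0 b
  by_cases hb : TvRep v F F f0 b
  · exact ⟨f0, fun _ _ => rfl, hb.mono hFC⟩
  have hF' : F.card < finrank ℝ V := by
    by_contra h
    exact hb (tv_span hgen f0 F (by omega) b)
  obtain ⟨y, hyC, hyF⟩ := Finset.exists_mem_notMem_of_card_lt_card (lt_of_lt_of_le hF' hC)
  obtain ⟨k, hk⟩ := tv_pick hgen hsum hF' f0 b hb y hyF
  set s := b - v y k with hs
  have := tv_real_ind (fun t => ∃ f, (∀ i ∈ F, f i = f0 i) ∧ TvRep v F C f (v y k + t • s)) ?_ ?_ ?_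
  · obtain ⟨f, h1, h2⟩ := this
    refine ⟨f, h1, ?_⟩
    simpa [hs] using h2
  · refine ⟨Function.update f0 y k, ?_, ?_⟩
    · intro i hi
      have : i ≠ y := fun h => hyF (h ▸ hi)
      rw [Function.update_of_ne this]
    · have := tv_single (v := v) (F := F) (Function.update f0 y k) hyC
      simpa using this
  · rintro t h0 h1 ⟨f, hf, hrep⟩
    obtain ⟨E, hE1, hE2, hE3, hE4⟩ := tv_carath hgen hFC hF hrep
    have hne : F ≠ E := by
      rintro rfl
      exact hk t h0 h1.le (hE4.rep.congr hf)
    have hlt := Finset.card_lt_card (lt_of_le_of_ne hE1 hne)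
    obtain ⟨f', hf', hrep'⟩ := ih (finrank ℝ V - E.card) (by omega) E rfl hE3 hE2 f s
    filter_upwards [tv_small (hE4.congr (fun i hi => (hf' i hi).symm)) hrep' hE2] with ε hε
    refine ⟨f', fun i hi => (hf' i (hE1 hi)).trans (hf i hi), ?_⟩
    rw [add_smul, ← add_assoc]
    exact hε
  · intro t h0 h1
    have : ∀ᶠ ε : ℝ in 𝓝[>] 0, ∀ f : ι → κ,
        TvRep v F C f ((v y k + t • s) + ε • (-s)) → TvRep v F C f (v y k + t • s) := by
      rw [eventually_all]
      intro f
      exact tv_limit hgen hFC hF f _ _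
    filter_upwards [this] with ε hε
    rintro ⟨f, h1, h2⟩
    refine ⟨f, h1, hε f ?_⟩
    convert h2 using 1
    module

/-- adjacency -/
def TvAdjC (v : ι → κ → V) (F : Finset ι) (f0 : ι → κ) (b : V) (f g : ι → κ) : Prop :=
  (∀ i ∈ F, f i = f0 i) ∧ ∃ z, z ∉ F ∧ (∀ i, i ≠ z → f i = g i) ∧
    TvRep v F (Finset.univ.erase z) f b

/-- connectedness -/
def TvConn (v : ι → κ → V) (F : Finset ι) (f0 : ι → κ) (b : V) : Prop :=
  ∀ f g, (∀ i ∈ F, f i = f0 i) → (∀ i ∈ F, g i = f0 i) → TvRep v F Finset.univ f b →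
    TvRep v F Finset.univ g b → Relation.ReflTransGen (TvAdjC v F f0 b) f g

lemma TvAdjC.symm {F : Finset ι} {f0 : ι → κ} {b : V} {f g : ι → κ} (h : TvAdjC v F f0 b f g) :
    TvAdjC v F f0 b g f := by
  obtain ⟨h1, z, hz, h2, h3⟩ := h
  refine ⟨?_, z, hz, fun i hi => (h2 i hi).symm, h3.congr ?_⟩
  · intro i hi
    have : i ≠ z := fun h => hz (h ▸ hi)
    rw [← h2 i this, h1 i hi]
  · intro i hi
    exact h2 i (Finset.ne_of_mem_erase hi)

lemma tv_rtg_symm {F : Finset ι} {f0 : ι → κ} {b : V} {f g : ι → κ}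
    (h : Relation.ReflTransGen (TvAdjC v F f0 b) f g) :
    Relation.ReflTransGen (TvAdjC v F f0 b) g f := by
  induction h with
  | refl => exact .refl
  | tail _ h2 ih => exact Relation.ReflTransGen.head h2.symm ih

lemma tv_free {F E : Finset ι} (hFE : F ⊆ E) {f0 : ι → κ} {b : V} {f g : ι → κ}
    (hf : ∀ i ∈ F, f i = f0 i) (hfg : ∀ i ∈ E, f i = g i) (hrep : TvRep v F E f b) :
    Relation.ReflTransGen (TvAdjC v F f0 b) f g := by
  classical
  obtain ⟨n, hn⟩ : ∃ n, n = (Finset.univ.filter (fun i => f i ≠ g i)).card := ⟨_, rfl⟩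
  induction n generalizing f with
  | zero =>
    have : f = g := by
      funext i
      by_contra h
      have := Finset.card_eq_zero.1 hn.symm
      have h2 : i ∈ Finset.univ.filter (fun i => f i ≠ g i) := by simp [h]
      rw [this] at h2
      simp at h2
    rw [this]
  | succ n ih =>
    obtain ⟨z, hz⟩ := Finset.card_pos.1 (show 0 < (Finset.univ.filter (fun i => f i ≠ g i)).card by omega)
    have hz' : f z ≠ g z := by simpa using hz
    have hzE : z ∉ E := fun h => hz' (hfg z h)
    have hE : ∀ i ∈ E, i ≠ z := fun i hi h => hzE (h ▸ hi)
    refine Relation.ReflTransGen.head (b := Function.update f z (g z)) ?_ (ih ?_ ?_ ?_ ?_)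
    · refine ⟨hf, z, fun h => hzE (hFE h), fun i hi => by rw [Function.update_of_ne hi], hrep.mono ?_⟩
      intro i hi
      simp [hE i hi]
    · intro i hi
      rw [Function.update_of_ne (hE i (hFE hi)), hf i hi]
    · intro i hi
      rw [Function.update_of_ne (hE i hi), hfg i hi]
    · apply hrep.congr
      intro i hi
      rw [Function.update_of_ne (hE i hi)]
    · have : (Finset.univ.filter (fun i => Function.update f z (g z) i ≠ g i)) =
          (Finset.univ.filter (fun i => f i ≠ g i)).erase z := by
        ext i
        by_cases h : i = z
        · subst h; simp
        · simp [h]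
      rw [this, Finset.card_erase_of_mem hz]
      omega

lemma tv_back {F E C : Finset ι} (hFE : F ⊆ E) (hEC : E ⊆ C) {f : ι → κ} {b s : V} {ε : ℝ}
    (hε : 0 < ε) (hb : TvPos v F E f b) (h : TvRep v F C f (b + ε • s)) : TvRep v E C f s := by
  obtain ⟨l, h1, h2, h3⟩ := hb
  obtain ⟨m, m1, m2, m3⟩ := h
  refine ⟨fun i => ε⁻¹ * (m i - l i), ?_, ?_, ?_⟩
  · intro i hi
    simp only [h2 i hi, sub_zero]
    exact mul_nonneg (inv_nonneg.2 hε.le) (m1 i (fun h => hi (hFE h)))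
  · intro i hi
    simp [m2 i hi, h2 i (fun h => hi (hEC h))]
  · simp only [mul_smul, sub_smul, ← Finset.smul_sum, Finset.sum_sub_distrib, h3, m3]
    rw [add_sub_cancel_left, smul_smul, inv_mul_cancel₀ hε.ne', one_smul]

open Filter Topology in
lemma tv_closed_step [Nonempty κ] (hgen : TvGen v) (hsum : ∀ i, ∑ k, v i k = 0)
    (hcard : finrank ℝ V ≤ Fintype.card ι) (F : Finset ι) (hF : F.card ≤ finrank ℝ V)
    (f0 : ι → κ) (b s : V) :
    ∀ᶠ ε : ℝ in 𝓝[>] 0, TvConn v F f0 (b + ε • s) → TvConn v F f0 b := by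
  have c1 : ∀ᶠ ε : ℝ in 𝓝[>] 0, ∀ f : ι → κ, ∀ C : Finset ι, F ⊆ C →
      TvRep v F C f (b + ε • s) → TvRep v F C f b := by
    simp only [eventually_all]
    intro f C hFC
    exact tv_limit hgen hFC hF f b s
  have c2 : ∀ᶠ ε : ℝ in 𝓝[>] 0, ∀ f : ι → κ, ∀ E C : Finset ι, TvPos v F E f b →
      TvRep v E C f s → E ⊆ C → TvRep v F C f (b + ε • s) := by
    simp only [eventually_all]
    intro f E C h1 h2 h3
    exact tv_small h1 h2 h3
  filter_upwards [c1, c2] with ε c1 c2 hconn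
  have key : ∀ f, (∀ i ∈ F, f i = f0 i) → TvRep v F Finset.univ f b →
      ∃ u, (∀ i ∈ F, u i = f0 i) ∧ TvRep v F Finset.univ u (b + ε • s) ∧
        Relation.ReflTransGen (TvAdjC v F f0 b) f u := by
    intro f hf hrep
    obtain ⟨E, hE1, hE2, hE3, hE4⟩ := tv_carath hgen (Finset.subset_univ F) hF hrep
    obtain ⟨u, hu, hur⟩ := tv_exists hgen hsum Finset.univ (by simpa using hcard) _ E rfl hE3 hE2 f s
    exact ⟨u, fun i hi => (hu i (hE1 hi)).trans (hf i hi),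
      c2 u E _ (hE4.congr (fun i hi => (hu i hi).symm)) hur hE2,
      tv_free hE1 hf (fun i hi => (hu i hi).symm) hE4.rep⟩
  intro f g hf hg hfr hgr
  obtain ⟨u, u1, u2, u3⟩ := key f hf hfr
  obtain ⟨w, w1, w2, w3⟩ := key g hg hgr
  refine u3.trans (Relation.ReflTransGen.trans ?_ (tv_rtg_symm w3))
  refine tv_lift id ?_ (hconn u w u1 w1 u2 w2)
  rintro a c ⟨h1, z, hz, h2, h3⟩
  refine ⟨h1, z, hz, h2, c1 a _ ?_ h3⟩
  intro i hi
  have : i ≠ z := fun h => hz (h ▸ hi)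
  simp [this]

open Filter Topology in
lemma tv_open_step [Nonempty κ] (hgen : TvGen v) (hsum : ∀ i, ∑ k, v i k = 0)
    (hcard : finrank ℝ V ≤ Fintype.card ι) (F : Finset ι) (hF : F.card ≤ finrank ℝ V)
    (f0 : ι → κ) (b s : V) (hb : ¬ TvRep v F F f0 b)
    (ih : ∀ E : Finset ι, F ⊂ E → E.card ≤ finrank ℝ V → ∀ f, TvConn v E f s)
    (hconn : TvConn v F f0 b) :
    ∀ᶠ ε : ℝ in 𝓝[>] 0, TvConn v F f0 (b + ε • s) := by
  have c1 : ∀ᶠ ε : ℝ in 𝓝[>] 0, ∀ f : ι → κ, ∀ C : Finset ι, F ⊆ C →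
      TvRep v F C f (b + ε • s) → TvRep v F C f b := by
    simp only [eventually_all]
    intro f C hFC
    exact tv_limit hgen hFC hF f b s
  have c2 : ∀ᶠ ε : ℝ in 𝓝[>] 0, ∀ f : ι → κ, ∀ E C : Finset ι, TvPos v F E f b →
      TvRep v E C f s → E ⊆ C → TvRep v F C f (b + ε • s) := by
    simp only [eventually_all]
    intro f E C h1 h2 h3
    exact tv_small h1 h2 h3
  filter_upwards [c1, c2, self_mem_nhdsWithin] with ε c1 c2 hε
  have hε' : 0 < ε := hε
  -- clusters are connected
  have clus : ∀ E : Finset ι, F ⊆ E → E.card ≤ finrank ℝ V → ∀ u w : ι → κ,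
      (∀ i ∈ F, u i = f0 i) → TvPos v F E u b → (∀ i ∈ E, w i = u i) →
      TvRep v F Finset.univ u (b + ε • s) → TvRep v F Finset.univ w (b + ε • s) →
      Relation.ReflTransGen (TvAdjC v F f0 (b + ε • s)) u w := by
    intro E hFE hE u w hu hpos hwu hur hwr
    have hne : F ≠ E := by
      rintro rfl
      exact hb (hpos.rep.congr hu)
    have hposw : TvPos v F E w b := hpos.congr (fun i hi => (hwu i hi).symm)
    have := ih E (lt_of_le_of_ne hFE hne) hE u u w (fun _ _ => rfl) hwu
      (tv_back hFE (Finset.subset_univ _) hε' hpos hur)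
      (tv_back hFE (Finset.subset_univ _) hε' hposw hwr)
    refine tv_lift id ?_ this
    rintro a c ⟨h1, z, hz, h2, h3⟩
    refine ⟨fun i hi => (h1 i (hFE hi)).trans (hu i hi), z, fun h => hz (hFE h), h2, ?_⟩
    refine c2 a E _ (hpos.congr (fun i hi => (h1 i hi).symm)) h3 ?_
    intro i hi
    have : i ≠ z := fun h => hz (h ▸ hi)
    simp [this]
  intro P Q hP hQ hPr hQr
  have hpath := hconn P Q hP hQ (c1 P _ (Finset.subset_univ _) hPr) (c1 Q _ (Finset.subset_univ _) hQr)
  have main : ∀ T, Relation.ReflTransGen (TvAdjC v F f0 b) P T → (∀ i ∈ F, T i = f0 i) ∧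
      ∀ E : Finset ι, F ⊆ E → E.card ≤ finrank ℝ V → TvPos v F E T b → ∀ u : ι → κ,
      (∀ i ∈ E, u i = T i) → TvRep v F Finset.univ u (b + ε • s) →
      Relation.ReflTransGen (TvAdjC v F f0 (b + ε • s)) P u := by
    intro T hT
    induction hT with
    | refl =>
      exact ⟨hP, fun E hFE hE hpos u hu hur => clus E hFE hE P u hP hpos hu hPr hur⟩
    | @tail T T' _ hadj ihT =>
      obtain ⟨ihT0, ihT⟩ := ihT
      have hT' : ∀ i ∈ F, T' i = f0 i := hadj.symm.1
      refine ⟨hT', ?_⟩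
      obtain ⟨-, z, hz, hTT, hrep⟩ := hadj
      have hFz : F ⊆ Finset.univ.erase z := by
        intro i hi
        have : i ≠ z := fun h => hz (h ▸ hi)
        simp [this]
      obtain ⟨E0, h1, h2, h3, h4⟩ := tv_carath hgen hFz hF hrep
      have hTT' : ∀ i ∈ E0, T i = T' i := fun i hi => hTT i (Finset.ne_of_mem_erase (h2 hi))
      obtain ⟨u0, hu0, hur0⟩ := tv_exists hgen hsum Finset.univ (by simpa using hcard) _ E0 rfl h3
        (Finset.subset_univ _) T s
      have hr0 := c2 u0 E0 _ (h4.congr (fun i hi => (hu0 i hi).symm)) hur0 (Finset.subset_univ _)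
      have hPu0 := ihT E0 h1 h3 h4 u0 hu0 hr0
      have h4' : TvPos v F E0 T' b := h4.congr hTT'
      have hu0' : ∀ i ∈ E0, u0 i = T' i := fun i hi => (hu0 i hi).trans (hTT' i hi)
      intro E hFE hE hpos u hu hur
      refine hPu0.trans ?_
      have hu0F : ∀ i ∈ F, u0 i = f0 i := fun i hi => (hu0' i (h1 hi)).trans (hT' i hi)
      by_cases hEE : E = E0
      · subst hEE
        exact clus E hFE hE u0 u hu0F (h4'.congr (fun i hi => (hu0' i hi).symm))
          (fun i hi => (hu i hi).trans (hu0' i hi).symm) hr0 hur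
      · have hbig : finrank ℝ V ≤ (E ∪ E0).card := by
          by_contra hcon
          exact hEE (tv_uniq hgen hpos h4' hFE h1 (by omega))
        have hTr : TvRep v F Finset.univ T' (b + ε • s) :=
          c2 T' (E ∪ E0) _ (tv_pos_union hpos h4')
            ((tv_span hgen T' (E ∪ E0) hbig s).mono (Finset.subset_univ _)) (Finset.subset_univ _)
        refine (clus E0 h1 h3 u0 T' hu0F (h4'.congr (fun i hi => (hu0' i hi).symm))
          (fun i hi => (hu0' i hi).symm) hr0 hTr).trans ?_
        exact clus E hFE hE T' u hT' hpos hu hTr hur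
  obtain ⟨-, hmain⟩ := main Q hpath
  obtain ⟨E, h1, h2, h3, h4⟩ := tv_carath hgen (Finset.subset_univ F) hF
    (c1 Q _ (Finset.subset_univ _) hQr)
  exact hmain E h1 h3 h4 Q (fun _ _ => rfl) hQr

lemma tv_add {F C : Finset ι} {f : ι → κ} {b : V} (h : TvRep v F C f b) (y : ι) {c : ℝ}
    (hc : 0 ≤ c) : TvRep v F (insert y C) f (b + c • v y (f y)) := by
  obtain ⟨l, h1, h2, h3⟩ := h
  refine ⟨fun i => l i + (if i = y then c else 0), ?_, ?_, ?_⟩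
  · intro i hi
    have := h1 i hi
    dsimp only
    split_ifs <;> linarith
  · intro i hi
    simp only [Finset.mem_insert, not_or] at hi
    simp [hi.1, h2 i hi.2]
  · simp [add_smul, Finset.sum_add_distrib, h3, ite_smul]

open Filter Topology in
lemma tv_base [Nonempty κ] (hgen : TvGen v) (hsum : ∀ i, ∑ k, v i k = 0)
    (hcard : finrank ℝ V + 1 ≤ Fintype.card ι) (F : Finset ι) (hF : F.card ≤ finrank ℝ V)
    (f0 : ι → κ) (y : ι) (hy : y ∉ F) (k : κ) (f : ι → κ) (hf : ∀ i ∈ F, f i = f0 i)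
    (hrep : TvRep v F Finset.univ f (v y k)) :
    ∃ g, Relation.ReflTransGen (TvAdjC v F f0 (v y k)) f g ∧ g y = k ∧ ∀ i ∈ F, g i = f0 i := by
  obtain ⟨l, h1, h2, h3⟩ := hrep
  have hFy : F ⊆ Finset.univ.erase y := by
    intro i hi
    have : i ≠ y := fun h => hy (h ▸ hi)
    simp [this]
  have hs0 := h1 y hy
  set s := l y • v y (f y) with hs
  have := tv_real_ind (fun t => ∃ g, Relation.ReflTransGen (TvAdjC v F f0 (v y k)) f g ∧
    g y = f y ∧ (∀ i ∈ F, g i = f0 i) ∧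
    TvRep v F (Finset.univ.erase y) g ((v y k - s) + t • s)) ?_ ?_ ?_
  · obtain ⟨g, g1, g2, g3, g4⟩ := this
    simp only [one_smul, sub_add_cancel] at g4
    refine ⟨Function.update g y k, g1.tail ⟨g3, y, hy, ?_, g4⟩, by simp, ?_⟩
    · intro i hi
      rw [Function.update_of_ne hi]
    · intro i hi
      have hne : i ≠ y := fun h => hy (h ▸ hi)
      rw [Function.update_of_ne hne, g3 i hi]
  · refine ⟨f, .refl, rfl, hf, fun i => l i - (if i = y then l y else 0), ?_, ?_, ?_⟩
    · intro i hi
      have := h1 i hi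
      dsimp only
      split_ifs with h
      · rw [h]; simp
      · simpa using this
    · intro i hi
      have : i = y := by simpa using hi
      simp [this]
    · simp [sub_smul, Finset.sum_sub_distrib, h3, hs, ite_smul]
  · rintro t t0 t1 ⟨g, g1, g2, g3, g4⟩
    obtain ⟨E, hE1, hE2, hE3, hE4⟩ := tv_carath hgen hFy hF g4
    obtain ⟨g', hg', hrep'⟩ := tv_exists hgen hsum (Finset.univ.erase y)
      (by rw [Finset.card_erase_of_mem (Finset.mem_univ y), Finset.card_univ]; omega) _ E rfl hE3 hE2 g s
    have hyE : y ∉ E := fun h => Finset.notMem_erase y _ (hE2 h)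
    set u := Function.update g' y (f y) with hu
    have hug : ∀ i ∈ E, u i = g i := by
      intro i hi
      have hne : i ≠ y := fun h => hyE (h ▸ hi)
      rw [hu, Function.update_of_ne hne, hg' i hi]
    have hrepu : TvRep v E (Finset.univ.erase y) u s := by
      apply hrep'.congr
      intro i hi
      rw [hu, Function.update_of_ne (Finset.ne_of_mem_erase hi)]
    filter_upwards [tv_small (hE4.congr (fun i hi => (hug i hi).symm)) hrepu hE2] with ε hε
    refine ⟨u, g1.trans ?_, by simp [hu], fun i hi => (hug i (hE1 hi)).trans (g3 i hi), ?_⟩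
    · refine tv_free (E := insert y E) (hE1.trans (Finset.subset_insert _ _)) g3 ?_ ?_
      · intro i hi
        rcases Finset.mem_insert.1 hi with h | h
        · rw [h, g2, hu]; simp
        · exact (hug i h).symm
      · have := tv_add hE4.rep y (c := (1 - t) * l y) (mul_nonneg (by linarith) hs0)
        convert this using 1
        rw [g2, mul_smul, ← hs]
        module
    · rw [add_smul, ← add_assoc]
      exact hε
  · intro t t0 t1
    have : ∀ᶠ ε : ℝ in 𝓝[>] 0, ∀ f : ι → κ,
        TvRep v F (Finset.univ.erase y) f ((v y k - s + t • s) + ε • (-s)) →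
        TvRep v F (Finset.univ.erase y) f (v y k - s + t • s) := by
      rw [eventually_all]
      intro f
      exact tv_limit hgen hFy hF f _ _
    filter_upwards [this] with ε hε
    rintro ⟨g, g1, g2, g3, g4⟩
    refine ⟨g, g1, g2, g3, hε g ?_⟩
    convert g4 using 1
    module

open Filter Topology in
lemma tv_main [Nonempty κ] (hgen : TvGen v) (hsum : ∀ i, ∑ k, v i k = 0)
    (hcard : finrank ℝ V + 1 ≤ Fintype.card ι) (n : ℕ) : ∀ (F : Finset ι)
    (_ : finrank ℝ V - F.card = n) (_ : F.card ≤ finrank ℝ V) (f0 : ι → κ) (b : V),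
    TvConn v F f0 b := by
  induction n using Nat.strong_induction_on with
  | _ n ih =>
  intro F hn hF f0 b
  by_cases hb : TvRep v F F f0 b
  · intro f g hf hg _ _
    exact tv_free (E := F) subset_rfl hf (fun i hi => (hf i hi).trans (hg i hi).symm)
      (hb.congr (fun i hi => (hf i hi).symm))
  have hF' : F.card < finrank ℝ V := by
    by_contra h
    exact hb (tv_span hgen f0 F (by omega) b)
  obtain ⟨y, -, hyF⟩ := Finset.exists_mem_notMem_of_card_lt_card
    (show F.card < (Finset.univ : Finset ι).card by rw [Finset.card_univ]; omega)
  obtain ⟨k, hk⟩ := tv_pick hgen hsum hF' f0 b hb y hyF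
  set s := b - v y k with hs
  have := tv_real_ind (fun t => TvConn v F f0 (v y k + t • s)) ?_ ?_ ?_
  · simpa [hs] using this
  · simp only [zero_smul, add_zero]
    intro f g hf hg hfr hgr
    obtain ⟨f', p1, p2, p3⟩ := tv_base hgen hsum hcard F hF f0 y hyF k f hf hfr
    obtain ⟨g', q1, q2, q3⟩ := tv_base hgen hsum hcard F hF f0 y hyF k g hg hgr
    refine p1.trans (Relation.ReflTransGen.trans ?_ (tv_rtg_symm q1))
    refine tv_free (E := insert y F) (Finset.subset_insert _ _) p3 ?_ ?_
    · intro i hi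
      rcases Finset.mem_insert.1 hi with h | h
      · rw [h, p2, q2]
      · rw [p3 i h, q3 i h]
    · have := tv_single (v := v) (F := F) f' (Finset.mem_insert_self y F)
      rwa [p2] at this
  · intro t t0 t1 ht
    filter_upwards [tv_open_step hgen hsum (by omega) F hF f0 (v y k + t • s) s (hk t t0 t1.le)
      (fun E hE hEc f => ih (finrank ℝ V - E.card)
        (by have := Finset.card_lt_card hE; omega) E rfl hEc f s) ht] with ε hε
    rw [add_smul, ← add_assoc]
    exact hε
  · intro t t0 t1
    filter_upwards [tv_closed_step hgen hsum (by omega) F hF f0 (v y k + t • s) (-s)] with ε hε h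
    apply hε
    convert h using 1
    module

/-- zero lies in the convex hull -/
def TvZ (v : ι → κ → V) (C : Finset ι) (f : ι → κ) : Prop :=
  ∃ l : ι → ℝ, (∀ i, 0 ≤ l i) ∧ (∀ i, i ∉ C → l i = 0) ∧ ∑ i, l i = 1 ∧ ∑ i, l i • v i (f i) = 0

/-- adjacency for zero in the convex hull -/
def TvAdjO (v : ι → κ → V) (f g : ι → κ) : Prop :=
  ∃ z, (∀ i, i ≠ z → f i = g i) ∧ TvZ v (Finset.univ.erase z) f

lemma TvZ.mono {C C' : Finset ι} {f : ι → κ} (h : TvZ v C f) (hC : C ⊆ C') : TvZ v C' f := by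
  obtain ⟨l, h1, h2, h3⟩ := h
  exact ⟨l, h1, fun i hi => h2 i (fun h => hi (hC h)), h3⟩

lemma TvZ.congr {C : Finset ι} {f g : ι → κ} (h : TvZ v C f)
    (hC : ∀ i ∈ C, f i = g i) : TvZ v C g := by
  obtain ⟨l, h1, h2, h4, h3⟩ := h
  refine ⟨l, h1, h2, h4, ?_⟩
  rw [← h3]
  apply Finset.sum_congr rfl
  intro i _
  by_cases hi : i ∈ C
  · rw [hC i hi]
  · simp [h2 i hi]

lemma TvAdjO.symm {f g : ι → κ} (h : TvAdjO v f g) : TvAdjO v g f := by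
  obtain ⟨z, h2, h3⟩ := h
  exact ⟨z, fun i hi => (h2 i hi).symm, h3.congr (fun i hi => h2 i (Finset.ne_of_mem_erase hi))⟩

lemma tvo_rtg_symm {f g : ι → κ} (h : Relation.ReflTransGen (TvAdjO v) f g) :
    Relation.ReflTransGen (TvAdjO v) g f := by
  induction h with
  | refl => exact .refl
  | tail _ h2 ih => exact Relation.ReflTransGen.head h2.symm ih

lemma tvz_of_rep {C : Finset ι} {f : ι → κ} {y : ι}
    (h : TvRep v ∅ C f (-v y (f y))) : TvZ v (insert y C) f := by
  obtain ⟨l, h1, h2, h3⟩ := tv_add h y (c := 1) zero_le_one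
  obtain ⟨m, m1, m2, m3⟩ := h
  have hpos : 0 < ∑ i, (m i + if i = y then 1 else 0) := by
    rw [Finset.sum_add_distrib]
    have : 0 ≤ ∑ i, m i := Finset.sum_nonneg (fun i _ => m1 i (by simp))
    simp
    linarith
  set S := ∑ i, (m i + if i = y then (1 : ℝ) else 0) with hS
  refine ⟨fun i => S⁻¹ * (m i + if i = y then 1 else 0), ?_, ?_, ?_, ?_⟩
  · intro i
    apply mul_nonneg (inv_nonneg.2 hpos.le)
    have := m1 i (by simp)
    split_ifs <;> linarith
  · intro i hi
    simp only [Finset.mem_insert, not_or] at hi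
    simp [hi.1, m2 i hi.2]
  · rw [← Finset.mul_sum, ← hS, inv_mul_cancel₀ hpos.ne']
  · simp [mul_smul, ← Finset.smul_sum, add_smul, Finset.sum_add_distrib, m3, ite_smul]

open Filter Topology in
lemma tv_rep_of_z (hgen : TvGen v) {f : ι → κ} (x : ι) (h : TvZ v Finset.univ f) :
    TvRep v ∅ (Finset.univ.erase x) f (-v x (f x)) := by
  classical
  obtain ⟨l, h1, -, h2, h3⟩ := h
  rcases (h1 x).eq_or_lt with h0 | h0
  · set S := Finset.univ.filter (fun i => l i ≠ 0) with hS
    have hSx : S ⊆ Finset.univ.erase x := by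
      intro i hi
      simp only [hS, Finset.mem_filter, Finset.mem_univ, true_and] at hi
      have : i ≠ x := fun h => hi (by rw [h, ← h0])
      simp [this]
    have hz : ∀ i, i ∉ S → l i = 0 := by
      intro i hi
      by_contra h
      exact hi (by simp [hS, h])
    have hbig : finrank ℝ V ≤ S.card := by
      by_contra hc
      have := hgen f S (by omega) l hz h3
      rw [this] at h2
      simp at h2
    have hpos : TvPos v ∅ S f 0 := by
      refine ⟨l, ?_, hz, h3⟩
      intro i hi _
      simp only [hS, Finset.mem_filter, Finset.mem_univ, true_and] at hi
      exact lt_of_le_of_ne (h1 i) (Ne.symm hi)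
    obtain ⟨ε, ⟨m, m1, m2, m3⟩, hε⟩ := ((tv_small hpos (tv_span hgen f S hbig (-v x (f x)))
      subset_rfl).and self_mem_nhdsWithin).exists
    have hε' : 0 < ε := hε
    refine TvRep.mono ⟨fun i => ε⁻¹ * m i, ?_, ?_, ?_⟩ hSx
    · intro i hi
      exact mul_nonneg (inv_nonneg.2 hε'.le) (m1 i hi)
    · intro i hi
      simp [m2 i hi]
    · simp only [mul_smul, ← Finset.smul_sum, m3, zero_add]
      rw [smul_smul, inv_mul_cancel₀ hε'.ne', one_smul]
  · refine ⟨fun i => (l x)⁻¹ * l i - if i = x then 1 else 0, ?_, ?_, ?_⟩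
    · intro i _
      dsimp only
      split_ifs with h
      · rw [h, inv_mul_cancel₀ h0.ne']; simp
      · have := mul_nonneg (inv_nonneg.2 h0.le) (h1 i)
        linarith
    · intro i hi
      have : i = x := by simpa using hi
      simp [this, h0.ne']
    · simp [sub_smul, mul_smul, Finset.sum_sub_distrib, ← Finset.smul_sum, h3, ite_smul]

lemma tv_gen_conn [Nonempty κ] (hgen : TvGen v) (hsum : ∀ i, ∑ k, v i k = 0)
    (hcard : finrank ℝ V + 2 ≤ Fintype.card ι) (f g : ι → κ) (hf : TvZ v Finset.univ f)
    (hg : TvZ v Finset.univ g) : Relation.ReflTransGen (TvAdjO v) f g := by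
  classical
  obtain ⟨x, y, hxy⟩ := Fintype.exists_pair_of_one_lt_card (show 1 < Fintype.card ι by omega)
  -- a colourful choice avoiding `x`
  obtain ⟨u, hu⟩ : ∃ u, TvZ v (Finset.univ.erase x) u := by
    obtain ⟨k0⟩ := ‹Nonempty κ›
    obtain ⟨u, -, hu⟩ := tv_exists hgen hsum ((Finset.univ.erase x).erase y) (by
      rw [Finset.card_erase_of_mem (by simp [hxy.symm]), Finset.card_erase_of_mem (Finset.mem_univ x),
        Finset.card_univ]; omega) _ ∅ rfl (by simp) (by simp) (fun _ => k0) (-v y k0)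
    have hu' : TvRep v ∅ ((Finset.univ.erase x).erase y) (Function.update u y k0)
        (-v y ((Function.update u y k0) y)) := by
      rw [Function.update_self]
      apply hu.congr
      intro i hi
      rw [Function.update_of_ne (Finset.ne_of_mem_erase hi)]
    refine ⟨_, (tvz_of_rep hu').mono ?_⟩
    rw [Finset.insert_erase (by simp [hxy.symm])]
  have hux : ∀ k, TvZ v (Finset.univ.erase x) (Function.update u x k) := by
    intro k
    apply hu.congr
    intro i hi
    rw [Function.update_of_ne (Finset.ne_of_mem_erase hi)]
  -- the restricted colours
  let v' : {i : ι // i ≠ x} → κ → V := fun i => v i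
  let e : κ → ({i : ι // i ≠ x} → κ) → ι → κ := fun q a i => if h : i ≠ x then a ⟨i, h⟩ else q
  have hsumc : ∀ (l : {i : ι // i ≠ x} → ℝ) (a : {i : ι // i ≠ x} → κ) (q : κ),
      ∑ i, (if h : i ≠ x then l ⟨i, h⟩ else 0) • v i (e q a i) = ∑ i, l i • v' i (a i) := by
    intro l a q
    rw [← Finset.sum_subset (Finset.subset_univ (Finset.univ.filter (fun i => i ≠ x)))]
    · symm
      rw [← Finset.sum_subtype_eq_sum_filter, Finset.subtype_univ]
      apply Finset.sum_congr rfl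
      rintro ⟨i, hi⟩ -
      simp [e, hi, v']
    · intro i _ hi
      simp at hi
      simp [hi]
  have hgen' : TvGen v' := by
    intro a E hE l hl hl0
    obtain ⟨k0⟩ := ‹Nonempty κ›
    have := hgen (e k0 a) (E.map (Function.Embedding.subtype _)) (by simpa using hE)
      (fun i => if h : i ≠ x then l ⟨i, h⟩ else 0) ?_ ?_
    · funext i
      have := congrFun this i.1
      simpa [i.2] using this
    · intro i hi
      by_cases h : i = x
      · simp [h]
      · simp only [ne_eq, h, not_false_eq_true, dif_pos]
        apply hl
        intro h2
        apply hi
        simp [h, h2]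
    · rw [hsumc, hl0]
  have hcard' : finrank ℝ V + 1 ≤ Fintype.card {i : ι // i ≠ x} := by
    have : Fintype.card {i : ι // i ≠ x} = Fintype.card ι - 1 := by
      rw [Fintype.card_subtype_compl, Fintype.card_subtype_eq]
    omega
  have key : ∀ a c : ι → κ, a x = c x → TvZ v Finset.univ a → TvZ v Finset.univ c →
      Relation.ReflTransGen (TvAdjO v) a c := by
    intro a c hac ha hc
    have hrest : ∀ a : ι → κ, TvZ v Finset.univ a →
        TvRep v' ∅ Finset.univ (fun i => a i) (-v x (a x)) := by
      intro a ha
      obtain ⟨l, h1, h2, h3⟩ := tv_rep_of_z hgen x ha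
      refine ⟨fun i => l i, fun i _ => h1 i (by simp), by simp, ?_⟩
      rw [← hsumc _ _ (a x), ← h3]
      apply Finset.sum_congr rfl
      intro i _
      by_cases h : i = x
      · subst h; simp [h2 i (by simp)]
      · simp [h, e]
    have hext : ∀ a : ι → κ, e (a x) (fun i => a i) = a := by
      intro a
      funext i
      by_cases h : i = x
      · subst h; simp [e]
      · simp [e, h]
    have := tv_main hgen' (fun i => hsum i) hcard' _ ∅ rfl (by simp) (fun i => a i) (-v x (a x))
      (fun i => a i) (fun i => c i) (by simp) (by simp) (hrest a ha) (by rw [hac]; exact hrest c hc)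
    have h2 := tv_lift (p := TvAdjO v) (e (a x)) ?_ this
    · rw [hext a] at h2
      rw [hac, hext c] at h2
      exact h2
    · rintro p q ⟨-, z, -, hpq, l, l1, l2, l3⟩
      refine ⟨z.1, ?_, ?_⟩
      · intro i hi
        by_cases h : i = x
        · simp [e, h]
        · simp only [e, ne_eq, h, not_false_eq_true, dif_pos]
          exact hpq _ (fun h2 => hi (by rw [← h2]))
      · have hex : e (a x) p x = a x := by simp [e]
        have h4 : TvRep v ∅ ((Finset.univ.erase x).erase z.1) (e (a x) p) (-v x (e (a x) p x)) := by
          refine ⟨fun i => if h : i ≠ x then l ⟨i, h⟩ else 0, ?_, ?_, ?_⟩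
          · intro i _
            dsimp only
            split_ifs with h
            · exact l1 _ (by simp)
            · exact le_rfl
          · intro i hi
            by_cases h : i = x
            · simp [h]
            · have hiz : i = z.1 := by
                by_contra h3
                exact hi (by simp [h, h3])
              simp only [ne_eq, h, not_false_eq_true, dif_pos]
              apply l2
              simp [hiz]
          · rw [hsumc, l3, hex]
        refine (tvz_of_rep h4).mono ?_
        intro i hi
        rcases Finset.mem_insert.1 hi with h | h
        · rw [h]; simp [z.2.symm]
        · simp at h; simp [h.1]
  refine (key f (Function.update u x (f x)) (by simp) hf ((hux _).mono (Finset.subset_univ _))).trans ?_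
  refine Relation.ReflTransGen.head (b := Function.update u x (g x)) ⟨x, ?_, hux _⟩ ?_
  · intro i hi
    rw [Function.update_of_ne hi, Function.update_of_ne hi]
  · exact key _ _ (by simp) ((hux _).mono (Finset.subset_univ _)) hg


end Conic

section Perturb

open Module

variable {V : Type*} [NormedAddCommGroup V] [InnerProductSpace ℝ V] [FiniteDimensional ℝ V]
variable {ι κ : Type*} [Fintype ι] [DecidableEq ι] [Fintype κ]

/-- Vectors on the moment curve: any `dim V` of them are independent. -/
lemma tv_moment (V ι : Type*) [NormedAddCommGroup V] [InnerProductSpace ℝ V]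
    [FiniteDimensional ℝ V] [Fintype ι] :
    ∃ w : ι → V, ∀ E : Finset ι, E.card = finrank ℝ V → LinearIndependent ℝ (fun i : E => w i) := by
  classical
  let b := finBasis ℝ V
  let s : ι → ℝ := fun i => ((Fintype.equivFin ι i : ℕ) : ℝ)
  have hs : Function.Injective s := by
    intro i j h
    have h2 : (Fintype.equivFin ι i : ℕ) = (Fintype.equivFin ι j : ℕ) := by
      simp only [s] at h
      exact_mod_cast h
    exact (Fintype.equivFin ι).injective (Fin.ext h2)
  refine ⟨fun i => ∑ j : Fin (finrank ℝ V), s i ^ (j : ℕ) • b j, ?_⟩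
  intro E hE
  rw [Fintype.linearIndependent_iff]
  intro g hg
  have e : E ≃ Fin (finrank ℝ V) := E.equivFinOfCardEq hE
  have hz : (fun j => g (e.symm j)) = 0 := by
    apply Matrix.eq_zero_of_forall_pow_sum_mul_pow_eq_zero
      (f := fun j => s (e.symm j))
    · intro x y h
      exact e.symm.injective (Subtype.ext (hs h))
    · intro j
      have h1 : ∑ i : E, g i * s i ^ (j : ℕ) = 0 := by
        have := congrArg (fun x => b.repr x j) hg
        simpa [Finsupp.single_apply] using this
      rw [← h1]
      exact Equiv.sum_comp e.symm (fun i : E => g i * s i ^ (j : ℕ))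
  intro i
  have := congrFun hz (e i)
  simpa using this

lemma tv_generic (v : ι → κ → V) (hsum : ∀ i, ∑ k, v i k = 0) (a : κ → ℝ) (ha : ∀ k, a k ≠ 0)
    (ha0 : ∑ k, a k = 0) (hcard : finrank ℝ V ≤ Fintype.card ι) {δ : ℝ} (hδ : 0 < δ) :
    ∃ v' : ι → κ → V, TvGen v' ∧ (∀ i, ∑ k, v' i k = 0) ∧ ∀ i k, ‖v' i k - v i k‖ ≤ δ := by
  classical
  obtain ⟨w, hw⟩ := tv_moment V ι
  -- bad parameters
  have hbad : ∀ (f : ι → κ) (E : Finset ι), {t : ℝ | E.card = finrank ℝ V ∧ ∃ l : ι → ℝ,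
      (∀ i, i ∉ E → l i = 0) ∧ ∑ i, l i • (v i (f i) + t • (a (f i) • w i)) = 0 ∧ l ≠ 0}.Finite := by
    intro f E
    by_cases hE : E.card = finrank ℝ V
    swap
    · simp [hE]
    rcases E.eq_empty_or_nonempty with h0 | hne
    · apply Set.Finite.subset Set.finite_empty
      rintro t ⟨-, l, h1, -, h2⟩
      exfalso
      apply h2
      funext i
      exact h1 i (by simp [h0])
    have : Nonempty E := hne.to_subtype
    let B := basisOfLinearIndependentOfCardEqFinrank (hw E hE) (by simpa using hE)
    have hB : ∀ i : E, B i = w i := by intro i; simp [B]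
    let L : End ℝ V := B.constr ℝ (fun i : E => (a (f i))⁻¹ • v i (f i))
    have hL : ∀ i : E, L (w i) = (a (f i))⁻¹ • v i (f i) := by
      intro i
      rw [← hB i]
      exact B.constr_basis ℝ _ i
    have hfin : {μ : ℝ | L.HasEigenvalue μ}.Finite := Module.End.finite_hasEigenvalue L
    refine (hfin.image (fun x => -x)).subset ?_
    rintro t ⟨-, l, h1, h2, h3⟩
    refine ⟨-t, ?_, by simp⟩
    have hsub : ∀ u : ι → V, ∑ i, l i • u i = ∑ i : E, l i • u i := by
      intro u
      rw [← Finset.sum_subset (Finset.subset_univ E), ← Finset.sum_coe_sort E (fun i => l i • u i)]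
      intro i _ hi
      simp [h1 i hi]
    rw [hsub (fun i => v i (f i) + t • (a (f i) • w i))] at h2
    set x := ∑ i : E, (l i * a (f i)) • w i with hx
    apply Module.End.hasEigenvalue_of_hasEigenvector (x := x)
    refine ⟨Module.End.mem_eigenspace_iff.2 ?_, ?_⟩
    · have hLx : L x = ∑ i : E, l i • v i (f i) := by
        rw [hx, map_sum]
        apply Finset.sum_congr rfl
        intro i _
        rw [map_smul, hL, smul_smul, mul_assoc, mul_inv_cancel₀ (ha _), mul_one]
      rw [hLx, neg_smul, eq_neg_iff_add_eq_zero, ← h2, hx, Finset.smul_sum, ← Finset.sum_add_distrib]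
      apply Finset.sum_congr rfl
      intro i _
      module
    · intro h0
      apply h3
      have := Fintype.linearIndependent_iff.1 (hw E hE) (fun i : E => l i * a (f i)) h0
      funext i
      by_cases hi : i ∈ E
      · have h5 := this ⟨i, hi⟩
        simpa [ha] using h5
      · exact h1 i hi
  have hbad2 := Set.finite_iUnion (fun f : ι → κ => Set.finite_iUnion (fun E : Finset ι => hbad f E))
  set M := ∑ i, ∑ k, ‖a k • w i‖ + 1 with hM
  have hMk : ∀ i k, ‖a k • w i‖ ≤ M := by
    intro i k
    have h1 : ‖a k • w i‖ ≤ ∑ k, ‖a k • w i‖ :=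
      Finset.single_le_sum (f := fun k => ‖a k • w i‖) (fun _ _ => norm_nonneg _) (Finset.mem_univ k)
    have h2 : ∑ k, ‖a k • w i‖ ≤ ∑ i, ∑ k, ‖a k • w i‖ :=
      Finset.single_le_sum (f := fun i => ∑ k, ‖a k • w i‖)
        (fun _ _ => Finset.sum_nonneg (fun _ _ => norm_nonneg _)) (Finset.mem_univ i)
    linarith
  have hMpos : 0 < M := by positivity
  obtain ⟨t, ht, htb⟩ := (Set.Ioo_infinite (show (0 : ℝ) < δ / M by positivity)).exists_notMem_finite
    hbad2
  refine ⟨fun i k => v i k + t • (a k • w i), ?_, ?_, ?_⟩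
  · intro f E hE l h1 h2
    obtain ⟨E', hE', hE'c⟩ := Finset.exists_superset_card_eq hE hcard
    by_contra h3
    apply htb
    rw [Set.mem_iUnion]
    refine ⟨f, Set.mem_iUnion.2 ⟨E', hE'c, l, fun i hi => h1 i (fun h => hi (hE' h)), h2, h3⟩⟩
  · intro i
    rw [Finset.sum_add_distrib, hsum, ← Finset.smul_sum, ← Finset.sum_smul, ha0]
    simp
  · intro i k
    rw [add_sub_cancel_left, norm_smul, Real.norm_of_nonneg ht.1.le]
    calc t * ‖a k • w i‖ ≤ t * M := mul_le_mul_of_nonneg_left (hMk i k) ht.1.le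
      _ ≤ δ / M * M := mul_le_mul_of_nonneg_right ht.2.le hMpos.le
      _ = δ := by field_simp

open Filter Topology in
lemma tv_delta (v : ι → κ → V) : ∃ δ : ℝ, 0 < δ ∧ ∀ (f : ι → κ) (C : Finset ι) (l : ι → ℝ),
    (∀ i, 0 ≤ l i) → (∀ i, i ∉ C → l i = 0) → ∑ i, l i = 1 → ‖∑ i, l i • v i (f i)‖ ≤ δ →
    TvZ v C f := by
  have : ∀ᶠ δ : ℝ in 𝓝[>] 0, ∀ (f : ι → κ) (C : Finset ι), ∀ (l : ι → ℝ),
      (∀ i, 0 ≤ l i) → (∀ i, i ∉ C → l i = 0) → ∑ i, l i = 1 → ‖∑ i, l i • v i (f i)‖ ≤ δ →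
      TvZ v C f := by
    rw [eventually_all]
    intro f
    rw [eventually_all]
    intro C
    by_cases hz : TvZ v C f
    · exact Eventually.of_forall (fun _ _ _ _ _ _ => hz)
    set K : Set (ι → ℝ) := stdSimplex ℝ ι ∩ {l | ∀ i, i ∉ C → l i = 0} with hK
    have hKc : IsCompact K := by
      apply (isCompact_stdSimplex ℝ ι).inter_right
      simp only [Set.ofPred_forall]
      exact isClosed_iInter (fun i => isClosed_iInter (fun _ =>
        isClosed_eq (continuous_apply i) continuous_const))
    rcases K.eq_empty_or_nonempty with h0 | hne
    · refine Eventually.of_forall (fun _ l h1 h2 h3 _ => ?_)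
      exfalso
      have : l ∈ K := ⟨⟨h1, h3⟩, h2⟩
      rw [h0] at this
      exact this
    · obtain ⟨l0, hl0, hmin⟩ := hKc.exists_isMinOn hne
        (f := fun l => ‖∑ i, l i • v i (f i)‖) (by fun_prop)
      have hpos : 0 < ‖∑ i, l0 i • v i (f i)‖ := by
        rw [norm_pos_iff]
        intro h
        exact hz ⟨l0, hl0.1.1, hl0.2, hl0.1.2, h⟩
      filter_upwards [Ioo_mem_nhdsGT hpos] with δ hδ l h1 h2 h3 h4
      exfalso
      have := hmin (show l ∈ K from ⟨⟨h1, h3⟩, h2⟩)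
      simp only [Set.mem_ofPred_eq] at this
      linarith [hδ.2]
  obtain ⟨δ, h1, h2⟩ := (this.and self_mem_nhdsWithin).exists
  exact ⟨δ, h2, h1⟩

lemma tv_closer (p s : V) (h : inner ℝ p s < 0) :
    ∃ t : ℝ, 0 < t ∧ t ≤ 1 ∧ ‖p + t • s‖ < ‖p‖ := by
  set c := -(inner ℝ p s) with hc
  have hcpos : 0 < c := by linarith
  have hden : 0 < ‖s‖ ^ 2 + 1 := by positivity
  refine ⟨min 1 (c / (‖s‖ ^ 2 + 1)), lt_min one_pos (by positivity), min_le_left _ _, ?_⟩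
  set t := min 1 (c / (‖s‖ ^ 2 + 1)) with ht
  have htpos : 0 < t := lt_min one_pos (by positivity)
  have ht2 : t * (‖s‖ ^ 2 + 1) ≤ c := by
    rw [← le_div_iff₀ hden]
    exact min_le_right _ _
  apply lt_of_pow_lt_pow_left₀ 2 (norm_nonneg _)
  rw [norm_add_sq_real, inner_smul_right, norm_smul, Real.norm_of_nonneg htpos.le, mul_pow]
  have h3 : t * (t * (‖s‖ ^ 2 + 1)) ≤ t * c := mul_le_mul_of_nonneg_left ht2 htpos.le
  have h4 : inner ℝ p s = -c := by rw [hc]; ring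
  rw [h4]
  nlinarith [mul_pos htpos hcpos, mul_pos htpos htpos]

lemma tv_approach (v v' : ι → κ → V) (hsum : ∀ i, ∑ k, v' i k = 0) [Nonempty κ]
    (hcard : finrank ℝ V + 1 ≤ Fintype.card ι) {δ : ℝ}
    (H : ∀ (f : ι → κ) (C : Finset ι) (l : ι → ℝ),
      (∀ i, 0 ≤ l i) → (∀ i, i ∉ C → l i = 0) → ∑ i, l i = 1 → ‖∑ i, l i • v' i (f i)‖ ≤ δ →
      TvZ v C f) (f : ι → κ) (l0 : ι → ℝ) (hl0 : ∀ i, 0 ≤ l0 i) (hl1 : ∑ i, l0 i = 1)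
    (hl2 : ‖∑ i, l0 i • v' i (f i)‖ ≤ δ) :
    ∃ g, Relation.ReflTransGen (TvAdjO v) f g ∧ TvZ v' Finset.univ g := by
  classical
  have hmin : ∀ g : ι → κ, ∃ l ∈ stdSimplex ℝ ι, ∀ l' ∈ stdSimplex ℝ ι,
      ‖∑ i, l i • v' i (g i)‖ ≤ ‖∑ i, l' i • v' i (g i)‖ := by
    intro g
    obtain ⟨l, h1, h2⟩ := (isCompact_stdSimplex ℝ ι).exists_isMinOn ⟨l0, hl0, hl1⟩
      (f := fun l => ‖∑ i, l i • v' i (g i)‖) (by fun_prop)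
    exact ⟨l, h1, fun l' hl' => h2 hl'⟩
  choose m hm1 hm2 using hmin
  obtain ⟨g, hg, hgmin⟩ := Finset.exists_min_image
    (Finset.univ.filter (fun g => Relation.ReflTransGen (TvAdjO v) f g))
    (fun g => ‖∑ i, m g i • v' i (g i)‖) ⟨f, by simp [Relation.ReflTransGen.refl]⟩
  simp only [Finset.mem_filter, Finset.mem_univ, true_and] at hg hgmin
  refine ⟨g, hg, ?_⟩
  set l := m g with hl
  set p := ∑ i, l i • v' i (g i) with hp
  have hpδ : ‖p‖ ≤ δ := (hgmin f .refl).trans ((hm2 f l0 ⟨hl0, hl1⟩).trans hl2)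
  by_contra hnz
  have hp0 : p ≠ 0 := fun h => hnz ⟨l, (hm1 g).1, by simp, (hm1 g).2, h⟩
  have hpp : 0 < ‖p‖ ^ 2 := by positivity
  -- moving towards a vertex
  have hmove : ∀ (q : ι → ℝ) (t : ℝ) (z : ι), q ∈ stdSimplex ℝ ι → 0 ≤ t → t ≤ 1 →
      (fun i => (1 - t) * q i + if i = z then t else 0) ∈ stdSimplex ℝ ι := by
    intro q t z hq h0 h1
    refine ⟨?_, ?_⟩
    · intro i
      have := mul_nonneg (sub_nonneg.2 h1) (hq.1 i)
      dsimp only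
      split_ifs <;> linarith
    · simp [Finset.sum_add_distrib, ← Finset.mul_sum, hq.2]
  have hge : ∀ i, ‖p‖ ^ 2 ≤ inner ℝ p (v' i (g i)) := by
    intro z
    by_contra hlt
    push Not at hlt
    obtain ⟨t, t0, t1, ht⟩ := tv_closer p (v' z (g z) - p)
      (by rw [inner_sub_right, real_inner_self_eq_norm_sq]; linarith)
    have h5 := hm2 g _ (hmove l t z (hm1 g) t0.le t1)
    have h6 : ∑ i, ((1 - t) * l i + if i = z then t else 0) • v' i (g i)
        = p + t • (v' z (g z) - p) := by
      simp only [add_smul, mul_smul, Finset.sum_add_distrib, ← Finset.smul_sum, ite_smul, zero_smul,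
        Finset.sum_ite_eq', Finset.mem_univ, if_true, ← hp]
      module
    rw [h6] at h5
    exact absurd ht (not_lt.2 h5)
  -- a minimiser with a vanishing coefficient
  obtain ⟨q, hq, hqp, z, hqz⟩ : ∃ q ∈ stdSimplex ℝ ι, ∑ i, q i • v' i (g i) = p ∧
      ∃ z, q z = 0 := by
    by_cases hzero : ∃ z, l z = 0
    · exact ⟨l, hm1 g, rfl, hzero⟩
    push Not at hzero
    have hlpos : ∀ i, 0 < l i := fun i => lt_of_le_of_ne ((hm1 g).1 i) (hzero i).symm
    have hs0 : ∑ i, l i * (inner ℝ p (v' i (g i)) - ‖p‖ ^ 2) = 0 := by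
      simp only [mul_sub, Finset.sum_sub_distrib, ← Finset.sum_mul]
      rw [(hm1 g).2, ← real_inner_self_eq_norm_sq]
      nth_rewrite 3 [hp]
      simp [inner_sum, inner_smul_right]
    have heq : ∀ i, inner ℝ p (v' i (g i)) = ‖p‖ ^ 2 := by
      intro i
      have := (Finset.sum_eq_zero_iff_of_nonneg (fun i _ => mul_nonneg (hlpos i).le
        (sub_nonneg.2 (hge i)))).1 hs0 i (Finset.mem_univ i)
      rcases mul_eq_zero.1 this with h | h
      · exact absurd h (hzero i)
      · linarith
    obtain ⟨μ, -, hμ, hμ0⟩ := tv_dep (fun i => v' i (g i)) Finset.univ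
      (by rw [Finset.card_univ]; omega)
    have hμs : ∑ i, μ i = 0 := by
      have h7 : inner ℝ p (∑ i, μ i • v' i (g i)) = (∑ i, μ i) * ‖p‖ ^ 2 := by
        simp [inner_sum, inner_smul_right, heq, Finset.sum_mul]
      rw [hμ, inner_zero_right] at h7
      rcases mul_eq_zero.1 h7.symm with h | h
      · exact h
      · exact absurd h hpp.ne'
    have hex : ∃ i, 0 < μ i := by
      by_contra hno
      push Not at hno
      apply hμ0
      funext i
      have := (Finset.sum_eq_zero_iff_of_nonpos (fun i _ => hno i)).1 hμs i (Finset.mem_univ i)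
      simpa using this
    obtain ⟨i0, hi0⟩ := hex
    obtain ⟨t, ht1, z, -, -, ht2⟩ := tv_red ∅ l μ (fun i _ => (hm1 g).1 i) ⟨i0, by simp, hi0⟩
    refine ⟨fun i => l i - t * μ i, ⟨fun i => ht1 i (by simp), ?_⟩, ?_, z, ht2⟩
    · rw [Finset.sum_sub_distrib, ← Finset.mul_sum, hμs, (hm1 g).2]; simp
    · simp only [sub_smul, mul_smul, Finset.sum_sub_distrib, ← Finset.smul_sum, hμ, smul_zero,
        sub_zero, ← hp]
  obtain ⟨k, hk⟩ : ∃ k, inner ℝ p (v' z k) ≤ 0 := by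
    by_contra hno
    push Not at hno
    have h8 : 0 < ∑ k, inner ℝ p (v' z k) :=
      Finset.sum_pos (fun k _ => hno k) Finset.univ_nonempty
    rw [← inner_sum, hsum, inner_zero_right] at h8
    exact lt_irrefl _ h8
  obtain ⟨t, t0, t1, ht⟩ := tv_closer p (v' z k - p)
    (by rw [inner_sub_right, real_inner_self_eq_norm_sq]; linarith)
  have hadj : TvAdjO v g (Function.update g z k) := by
    refine ⟨z, fun i hi => by rw [Function.update_of_ne hi], H g _ q hq.1 ?_ hq.2 (by rwa [hqp])⟩
    intro i hi
    have : i = z := by simpa using hi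
    rw [this, hqz]
  have h5 := hm2 (Function.update g z k) _ (hmove q t z hq t0.le t1)
  have h6 : ∑ i, ((1 - t) * q i + if i = z then t else 0) • v' i (Function.update g z k i)
      = p + t • (v' z k - p) := by
    have h9 : ∑ i, q i • v' i (Function.update g z k i) = p := by
      rw [← hqp]
      apply Finset.sum_congr rfl
      intro i _
      by_cases hi : i = z
      · rw [hi, hqz]; simp
      · rw [Function.update_of_ne hi]
    simp only [add_smul, mul_smul, Finset.sum_add_distrib, ← Finset.smul_sum, ite_smul, zero_smul,
      Finset.sum_ite_eq', Finset.mem_univ, if_true, h9, Function.update_self]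
    module
  rw [h6] at h5
  have h10 := hgmin _ (hg.tail hadj)
  exact absurd ht (not_lt.2 (h10.trans h5))

lemma tv_conn [Nonempty κ] (v : ι → κ → V) (hsum : ∀ i, ∑ k, v i k = 0) (a : κ → ℝ)
    (ha : ∀ k, a k ≠ 0) (ha0 : ∑ k, a k = 0)
    (hcard : finrank ℝ V + 2 ≤ Fintype.card ι) (f g : ι → κ) (hf : TvZ v Finset.univ f)
    (hg : TvZ v Finset.univ g) : Relation.ReflTransGen (TvAdjO v) f g := by
  obtain ⟨δ, hδ, hδ2⟩ := tv_delta v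
  obtain ⟨v', hgen, hsum', hclose⟩ := tv_generic v hsum a ha ha0 (by omega) (half_pos hδ)
  have hdist : ∀ (f : ι → κ) (l : ι → ℝ), (∀ i, 0 ≤ l i) → ∑ i, l i = 1 →
      ‖∑ i, l i • v' i (f i) - ∑ i, l i • v i (f i)‖ ≤ δ / 2 := by
    intro f l h1 h2
    rw [← Finset.sum_sub_distrib]
    calc _ ≤ ∑ i, ‖l i • v' i (f i) - l i • v i (f i)‖ := norm_sum_le _ _
      _ ≤ ∑ i, l i * (δ / 2) := by
        apply Finset.sum_le_sum
        intro i _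
        rw [← smul_sub, norm_smul, Real.norm_of_nonneg (h1 i)]
        exact mul_le_mul_of_nonneg_left (hclose i (f i)) (h1 i)
      _ = δ / 2 := by rw [← Finset.sum_mul, h2, one_mul]
  have H : ∀ (f : ι → κ) (C : Finset ι) (l : ι → ℝ),
      (∀ i, 0 ≤ l i) → (∀ i, i ∉ C → l i = 0) → ∑ i, l i = 1 →
      ‖∑ i, l i • v' i (f i)‖ ≤ δ / 2 → TvZ v C f := by
    intro f C l h1 h2 h3 h4
    refine hδ2 f C l h1 h2 h3 ?_
    have h5 := hdist f l h1 h3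
    have h6 := norm_sub_norm_le (∑ i, l i • v i (f i)) (∑ i, l i • v' i (f i))
    rw [norm_sub_rev] at h6
    linarith
  have hap : ∀ f, TvZ v Finset.univ f →
      ∃ g, Relation.ReflTransGen (TvAdjO v) f g ∧ TvZ v' Finset.univ g := by
    rintro f ⟨l, h1, -, h2, h3⟩
    refine tv_approach v v' hsum' (by omega) H f l h1 h2 ?_
    have h5 := hdist f l h1 h2
    rwa [h3, sub_zero] at h5
  obtain ⟨f', p1, p2⟩ := hap f hf
  obtain ⟨g', q1, q2⟩ := hap g hg
  refine p1.trans (Relation.ReflTransGen.trans ?_ (tvo_rtg_symm q1))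
  refine tv_lift id ?_ (tv_gen_conn hgen hsum' hcard f' g' p2 q2)
  rintro s u ⟨z, h1, l, h2, h3, h4, h5⟩
  exact ⟨z, h1, H s _ l h2 h3 h4 (by rw [h5, norm_zero]; linarith)⟩

end Perturb

section Translate

variable {d m : ℕ}

/-- The point `x` with an extra coordinate `1`. -/
def tvHat (x : Fin d → ℝ) (q : Option (Fin d)) : ℝ := q.elim 1 x

/-- Sarkaria's transform. -/
noncomputable def tvS (m : ℕ) (x : Fin d → ℝ) (k : Fin (m + 1)) :
    EuclideanSpace ℝ (Fin m × Option (Fin d)) :=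
  WithLp.toLp 2 (fun q => ((if k = q.1.castSucc then 1 else 0) - (if k = Fin.last m then 1 else 0))
    * tvHat x q.2)

lemma tvS_sum (x : Fin d → ℝ) : ∑ k, tvS m x k = 0 := by
  ext q
  simp [tvS, ← Finset.sum_mul, Finset.sum_sub_distrib]

variable {X : Finset (Fin d → ℝ)}

/-- The part of `C` with colour `k`. -/
def tvP (C : Finset {x // x ∈ X}) (f : {x // x ∈ X} → Fin (m + 1)) (k : Fin (m + 1)) :
    Finset (Fin d → ℝ) :=
  (C.filter (fun x => f x = k)).map (Function.Embedding.subtype _)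

lemma mem_tvP {C : Finset {x // x ∈ X}} {f : {x // x ∈ X} → Fin (m + 1)} {k : Fin (m + 1)}
    {y : Fin d → ℝ} : y ∈ tvP C f k ↔ ∃ h : y ∈ X, (⟨y, h⟩ : {x // x ∈ X}) ∈ C ∧ f ⟨y, h⟩ = k := by
  simp [tvP]

lemma tvS_coord (f : {x // x ∈ X} → Fin (m + 1)) (l : {x // x ∈ X} → ℝ) (j : Fin m)
    (q : Option (Fin d)) : (∑ x, l x • tvS m x.1 (f x)) (j, q) =
      (∑ x, if f x = j.castSucc then l x * tvHat x.1 q else 0)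
      - ∑ x, if f x = Fin.last m then l x * tvHat x.1 q else 0 := by
  rw [← Finset.sum_sub_distrib]
  simp only [tvS, WithLp.ofLp_sum, Finset.sum_apply, WithLp.ofLp_smul, Pi.smul_apply, smul_eq_mul]
  apply Finset.sum_congr rfl
  intro x _
  split_ifs <;> ring

lemma tv_to (C : Finset {x // x ∈ X}) (f : {x // x ∈ X} → Fin (m + 1))
    (h : TvZ (fun (x : {x // x ∈ X}) k => tvS m x.1 k) C f) :
    (⋂ k, convexHull ℝ ((tvP C f k : Finset (Fin d → ℝ)) : Set (Fin d → ℝ))).Nonempty := by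
  classical
  obtain ⟨l, h1, h2, h3, h4⟩ := h
  set A : Fin (m + 1) → Option (Fin d) → ℝ :=
    fun k q => ∑ x, if f x = k then l x * tvHat x.1 q else 0 with hA
  have hAeq : ∀ k q, A k q = A (Fin.last m) q := by
    intro k q
    induction k using Fin.lastCases with
    | last => rfl
    | cast j =>
      have := tvS_coord f l j q
      rw [h4] at this
      simp only [PiLp.zero_apply] at this
      simp only [hA]
      linarith
  have hfil : ∀ k (u : {x // x ∈ X} → ℝ), ∑ x ∈ C.filter (fun x => f x = k), l x * u x
      = ∑ x, if f x = k then l x * u x else 0 := by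
    intro k u
    rw [Finset.sum_filter]
    apply Finset.sum_subset (Finset.subset_univ C)
    intro x _ hx
    simp [h2 x hx]
  have hnone : ∀ k, ∑ x ∈ C.filter (fun x => f x = k), l x = A k none := by
    intro k
    have := hfil k (fun _ => 1)
    simpa [hA, tvHat] using this
  have htot : ∑ k, A k none = 1 := by
    rw [← h3]
    simp only [hA]
    rw [Finset.sum_comm]
    simp [tvHat]
  have hσ : 0 < A (Fin.last m) none := by
    simp only [hAeq, Finset.sum_const, Finset.card_univ, Fintype.card_fin, nsmul_eq_mul] at htot
    by_contra hno
    push Not at hno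
    have : ((m + 1 : ℕ) : ℝ) * A (Fin.last m) none ≤ 0 :=
      mul_nonpos_of_nonneg_of_nonpos (by positivity) hno
    linarith
  refine ⟨fun j => (A (Fin.last m) none)⁻¹ * A (Fin.last m) (some j), Set.mem_iInter.2 ?_⟩
  intro k
  have := (C.filter (fun x => f x = k)).centerMass_mem_convexHull (R := ℝ) (w := l)
    (z := fun x => x.1) (s := ((tvP C f k : Finset (Fin d → ℝ)) : Set (Fin d → ℝ)))
    (fun i _ => h1 i) (by rw [hnone, hAeq]; exact hσ) (by
      intro i hi
      rw [Finset.mem_filter] at hi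
      exact Finset.mem_coe.2 (mem_tvP.2 ⟨i.2, hi⟩))
  convert this using 1
  funext j
  rw [Finset.centerMass, hnone, hAeq k none, Pi.smul_apply, Finset.sum_apply, smul_eq_mul]
  congr 1
  exact (hAeq k (some j)).symm.trans (hfil k (fun x => x.1 j)).symm

lemma tv_from (C : Finset {x // x ∈ X}) (f : {x // x ∈ X} → Fin (m + 1))
    (h : (⋂ k, convexHull ℝ ((tvP C f k : Finset (Fin d → ℝ)) : Set (Fin d → ℝ))).Nonempty) :
    TvZ (fun (x : {x // x ∈ X}) k => tvS m x.1 k) C f := by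
  classical
  obtain ⟨p, hp⟩ := h
  have hp' : ∀ k, ∃ w : (Fin d → ℝ) → ℝ, (∀ y ∈ tvP C f k, 0 ≤ w y) ∧ ∑ y ∈ tvP C f k, w y = 1 ∧
      ∑ y ∈ tvP C f k, w y • y = p := by
    intro k
    exact Finset.mem_convexHull'.1 (Set.mem_iInter.1 hp k)
  choose w w1 w2 w3 using hp'
  set l : {x // x ∈ X} → ℝ := fun x => if x ∈ C then w (f x) x.1 / (m + 1) else 0 with hl
  have hsum : ∀ k (u : (Fin d → ℝ) → ℝ), (∑ x, if f x = k then l x * u x.1 else 0)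
      = (∑ y ∈ tvP C f k, w k y * u y) / (m + 1) := by
    intro k u
    rw [tvP, Finset.sum_map, Finset.sum_filter, Finset.sum_div]
    symm
    apply Finset.sum_subset_zero_on_sdiff (Finset.subset_univ C)
    · intro x hx
      have : x ∉ C := by simpa using hx
      simp [hl, this]
    · intro x hx
      by_cases hk : f x = k
      · simp [hl, hx, hk]; ring
      · simp [hk]
  have hhat : ∀ k q, (∑ y ∈ tvP C f k, w k y * tvHat y q) = q.elim 1 p := by
    intro k q
    cases q with
    | none => simp [tvHat, w2]
    | some j =>
      have := congrFun (w3 k) j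
      simpa [tvHat] using this
  refine ⟨l, ?_, ?_, ?_, ?_⟩
  · intro x
    simp only [hl]
    split_ifs with hx
    · exact div_nonneg (w1 _ _ (mem_tvP.2 ⟨x.2, hx, rfl⟩)) (by positivity)
    · exact le_rfl
  · intro x hx
    simp [hl, hx]
  · have h1 : ∑ x, l x = ∑ k, ∑ x, if f x = k then l x * 1 else 0 := by
      rw [Finset.sum_comm]
      simp
    rw [h1]
    have h5 : ∀ k, (∑ x, if f x = k then l x * 1 else 0) = 1 / (m + 1 : ℝ) := by
      intro k
      rw [hsum k (fun _ => 1)]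
      simp [w2]
    simp only [h5]
    simp
    field_simp
  · ext ⟨j, q⟩
    rw [tvS_coord f l j q, hsum _ (fun y => tvHat y q), hsum _ (fun y => tvHat y q), hhat, hhat]
    simp

lemma tv_part (f : {x // x ∈ X} → Fin (m + 1))
    (h : TvZ (fun (x : {x // x ∈ X}) k => tvS m x.1 k) Finset.univ f) :
    IsTverbergPartition X (m + 1) (tvP Finset.univ f) := by
  refine ⟨?_, ?_, tv_to _ _ h⟩
  · intro i j hij
    rw [Finset.disjoint_left]
    intro y h1 h2
    obtain ⟨_, -, h3⟩ := mem_tvP.1 h1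
    obtain ⟨_, -, h4⟩ := mem_tvP.1 h2
    exact hij (h3.symm.trans h4)
  · ext y
    simp [mem_tvP]

lemma tv_unpart (P : Fin (m + 1) → Finset (Fin d → ℝ)) (hP : IsTverbergPartition X (m + 1) P) :
    ∃ f : {x // x ∈ X} → Fin (m + 1), TvZ (fun (x : {x // x ∈ X}) k => tvS m x.1 k) Finset.univ f ∧
      tvP Finset.univ f = P := by
  obtain ⟨h1, h2, h3⟩ := hP
  have hex : ∀ x : {x // x ∈ X}, ∃ k, x.1 ∈ P k := by
    intro x
    have h5 : x.1 ∈ Finset.univ.biUnion P := h2.symm ▸ x.2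
    simpa using h5
  choose f hf using hex
  have hfP : tvP Finset.univ f = P := by
    funext k
    ext y
    rw [mem_tvP]
    constructor
    · rintro ⟨h, -, h5⟩
      rw [← h5]
      exact hf _
    · intro hy
      have hyX : y ∈ X := by
        rw [← h2]
        simp only [Finset.mem_biUnion, Finset.mem_univ, true_and]
        exact ⟨k, hy⟩
      refine ⟨hyX, Finset.mem_univ _, ?_⟩
      by_contra hne
      exact Finset.disjoint_left.1 (h1 _ _ hne) (hf ⟨y, hyX⟩) hy
  refine ⟨f, tv_from _ _ ?_, hfP⟩
  rw [hfP]
  exact h3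

lemma tv_adj (f g : {x // x ∈ X} → Fin (m + 1))
    (h : TvAdjO (fun (x : {x // x ∈ X}) k => tvS m x.1 k) f g) :
    Relation.ReflTransGen (TvAdj X (m + 1)) (tvP Finset.univ f) (tvP Finset.univ g) := by
  classical
  obtain ⟨z, hz, hzz⟩ := h
  by_cases hfg : f z = g z
  · have : f = g := by
      funext i
      by_cases hi : i = z
      · rw [hi, hfg]
      · exact hz i hi
    rw [this]
  apply Relation.ReflTransGen.single
  have hg : TvZ (fun (x : {x // x ∈ X}) k => tvS m x.1 k) (Finset.univ.erase z) g :=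
    hzz.congr (fun i hi => hz i (Finset.ne_of_mem_erase hi))
  refine ⟨tv_part f (hzz.mono (Finset.subset_univ _)), tv_part g (hg.mono (Finset.subset_univ _)),
    z.1, z.2, f z, g z, hfg, mem_tvP.2 ⟨z.2, Finset.mem_univ _, rfl⟩, ?_, ?_, ?_, ?_⟩
  · ext y
    simp only [Finset.mem_erase, mem_tvP, Finset.mem_univ, true_and]
    constructor
    · rintro ⟨hy, h5⟩
      have hne : (⟨y, hy⟩ : {x // x ∈ X}) ≠ z := by
        intro h6
        rw [h6] at h5
        exact hfg h5.symm
      exact ⟨fun h6 => hne (Subtype.ext h6), hy, by rw [hz _ hne, h5]⟩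
    · rintro ⟨h6, hy, h5⟩
      have hne : (⟨y, hy⟩ : {x // x ∈ X}) ≠ z := fun h7 => h6 (congrArg Subtype.val h7)
      exact ⟨hy, by rw [← hz _ hne, h5]⟩
  · ext y
    simp only [Finset.mem_insert, mem_tvP, Finset.mem_univ, true_and]
    constructor
    · rintro ⟨hy, h5⟩
      by_cases hne : (⟨y, hy⟩ : {x // x ∈ X}) = z
      · exact Or.inl (congrArg Subtype.val hne)
      · exact Or.inr ⟨hy, by rw [hz _ hne, h5]⟩
    · rintro (h6 | ⟨hy, h5⟩)
      · subst h6
        exact ⟨z.2, rfl⟩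
      · by_cases hne : (⟨y, hy⟩ : {x // x ∈ X}) = z
        · exact ⟨hy, by rw [hne]⟩
        · exact ⟨hy, by rw [← hz _ hne, h5]⟩
  · intro k hk1 hk2
    ext y
    simp only [mem_tvP, Finset.mem_univ, true_and]
    apply exists_congr
    intro hy
    by_cases hne : (⟨y, hy⟩ : {x // x ∈ X}) = z
    · rw [hne]
      exact ⟨fun h6 => absurd h6.symm hk2, fun h6 => absurd h6.symm hk1⟩
    · rw [hz _ hne]
  · have he : ∀ k, (tvP Finset.univ f k).erase z.1 = tvP (Finset.univ.erase z) f k := by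
      intro k
      ext y
      simp only [Finset.mem_erase, mem_tvP, Finset.mem_univ, true_and, and_true, ne_eq]
      constructor
      · rintro ⟨h6, hy, h5⟩
        exact ⟨hy, fun h7 => h6 (congrArg Subtype.val h7), h5⟩
      · rintro ⟨hy, h6, h5⟩
        exact ⟨fun h7 => h6 (Subtype.ext h7), hy, h5⟩
    have := tv_to _ _ hzz
    convert this using 6
    exact he _

lemma tv_adj_rtg (f g : {x // x ∈ X} → Fin (m + 1))
    (h : Relation.ReflTransGen (TvAdjO (fun (x : {x // x ∈ X}) k => tvS m x.1 k)) f g) :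
    Relation.ReflTransGen (TvAdj X (m + 1)) (tvP Finset.univ f) (tvP Finset.univ g) := by
  induction h with
  | refl => exact .refl
  | tail _ h2 ih => exact ih.trans (tv_adj _ _ h2)

end Translate

/-- Reconfiguration version of Tverberg's theorem: if `|X| ≥ (d+1)(r-1)+2`, then the
reconfiguration graph on ordered Tverberg `r`-partitions of `X` is connected. -/
theorem stmt_2 {d : ℕ} (X : Finset (Fin d → ℝ)) (r : ℕ) (hr : 1 ≤ r)
    (hX : (d + 1) * (r - 1) + 2 ≤ X.card)
    (P Q : Fin r → Finset (Fin d → ℝ))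
    (hP : IsTverbergPartition X r P) (hQ : IsTverbergPartition X r Q) :
    Relation.ReflTransGen (TvAdj X r) P Q := by
  obtain ⟨m, rfl⟩ : ∃ m, r = m + 1 := ⟨r - 1, by omega⟩
  rcases Nat.eq_zero_or_pos m with hm | hm
  · subst hm
    have hall : ∀ P : Fin (0 + 1) → Finset (Fin d → ℝ), IsTverbergPartition X (0 + 1) P →
        P = fun _ => X := by
      intro P hP
      have h2 := hP.2.1
      simp at h2
      funext i
      rw [← h2]
      have hi : i = 0 := by apply Fin.ext; omega
      rw [hi]
    rw [hall P hP, hall Q hQ]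
  · obtain ⟨f, hf, rfl⟩ := tv_unpart P hP
    obtain ⟨g, hg, rfl⟩ := tv_unpart Q hQ
    apply tv_adj_rtg
    have hm' : (m : ℝ) ≠ 0 := by exact_mod_cast hm.ne'
    refine tv_conn _ (fun x => tvS_sum x.1) (fun k => if k = Fin.last m then -(m : ℝ) else 1)
      ?_ ?_ ?_ f g hf hg
    · intro k
      split_ifs
      · exact neg_ne_zero.2 hm'
      · exact one_ne_zero
    · rw [Fin.sum_univ_castSucc]
      simp [Fin.castSucc_ne_last]
    · have h1 : Module.finrank ℝ (EuclideanSpace ℝ (Fin m × Option (Fin d))) = m * (d + 1) := by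
        simp
      have h2 : Fintype.card {x // x ∈ X} = X.card := by simp
      rw [h1, h2]
      simp only [Nat.add_sub_cancel] at hX
      rw [mul_comm]
      exact hX
end
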